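/- Let ℓ ≥ 5 be prime. If ℓ divides a(ℓn) for every integer n ≥ 1, then for every integer n ≥ −1 such that the Legendre symbol (−n / ℓ) is not equal to 1, ℓ divides a(n). -/

import Mathlib

open Finset

/-- `spt n`: the total number of smallest parts in the partitions of `n`. -/
def spt (n : ℕ) : ℕ :=
  ∑ p : Nat.Partition n, (p.parts.filter (fun j => ∀ i ∈ p.parts, j ≤ i)).card

/-- `partitionCount n` is the number of partitions of `n`. -/
def partitionCount (n : ℕ) : ℕ := Fintype.card (Nat.Partition n)

/-- The coefficients `a(n)` of the mock modular form `f = ∑ a(n) q^(n/24)`: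
for `n ≥ -1` with `n ≡ -1 (mod 24)`, `a(n) = -(12 spt((n+1)/24) + n p((n+1)/24))`,
and `a(n) = 0` otherwise. -/
noncomputable def sptA (n : ℤ) : ℤ :=
  if -1 ≤ n ∧ (24 : ℤ) ∣ n + 1 then
    -(12 * spt ((n + 1) / 24).toNat + n * partitionCount ((n + 1) / 24).toNat)
  else 0

namespace SptCongruence

open PowerSeries PowerSeries.WithPiTopology

/-! ### The Euler operator `q d/dq` on power series -/

section EulerOperator

variable (R : Type*) [CommRing R]

/-- The derivation `q d/dq` on power series in `q`. -/
noncomputable def qD : Derivation R R⟦X⟧ R⟦X⟧ := (X : R⟦X⟧) • derivative R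

variable {R}

theorem coeff_qD (f : R⟦X⟧) (n : ℕ) : coeff n (qD R f) = n * coeff n f := by
  rcases n with _ | n
  · simp [qD]
  · simp [qD, coeff_succ_X_mul, coeff_derivative]
    ring

theorem qD_X_pow (n : ℕ) : qD R (X ^ n) = (n : R⟦X⟧) * X ^ n := by
  ext m
  rw [coeff_qD, ← map_natCast (C (R := R)), coeff_C_mul, coeff_X_pow]
  split_ifs with h <;> simp [h]

theorem qD_C (r : R) : qD R (C r) = 0 := by
  simp [qD]

theorem map_qD {S : Type*} [CommRing S] (φ : R →+* S) (f : R⟦X⟧) :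
    PowerSeries.map φ (qD R f) = qD S (PowerSeries.map φ f) := by
  ext n
  simp [coeff_qD]

end EulerOperator

/-! ### Summable families of power series -/

section Summability

variable {ι : Type*} {R : Type*} [CommRing R] [TopologicalSpace R]

theorem hasSum_qD [IsTopologicalRing R] {f : ι → R⟦X⟧} {a : R⟦X⟧} (h : HasSum f a) :
    HasSum (fun i => qD R (f i)) (qD R a) := by
  rw [hasSum_iff_hasSum_coeff] at h ⊢
  intro d
  simp only [coeff_qD]
  exact (h d).mul_left _

theorem summable_of_X_pow_dvd {f : ι → R⟦X⟧} {e : ι → ℕ} (he : ∀ N, {i | e i ≤ N}.Finite)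
    (h : ∀ i, X ^ e i ∣ f i) : Summable f := by
  rw [summable_iff_summable_coeff]
  intro d
  refine summable_of_hasFiniteSupport ((he d).subset fun i hi => ?_)
  by_contra hlt
  exact hi (X_pow_dvd_iff.mp (h i) d (by simpa using hlt))

theorem coeff_hasSum_eq_sum [T2Space R] {f : ι → R⟦X⟧} {a : R⟦X⟧} (h : HasSum f a) (d : ℕ)
    (s : Finset ι) (hs : ∀ i ∉ s, coeff d (f i) = 0) : coeff d a = ∑ i ∈ s, coeff d (f i) :=
  ((hasSum_iff_hasSum_coeff R).mp h d).unique (hasSum_sum_of_ne_finset_zero hs)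

theorem finite_add_le {κ : Type*} {e : ι → ℕ} {e' : κ → ℕ} (he : ∀ N, {i | e i ≤ N}.Finite)
    (he' : ∀ N, {i | e' i ≤ N}.Finite) (N : ℕ) : {i : ι × κ | e i.1 + e' i.2 ≤ N}.Finite :=
  ((he N).prod (he' N)).subset fun i hi => by
    simp only [Set.mem_ofPred_eq, Set.mem_prod] at hi ⊢
    omega

instance [RegularSpace R] : RegularSpace R⟦X⟧ :=
  inferInstanceAs (RegularSpace ((Unit →₀ ℕ) → R))

instance [T2Space R] [RegularSpace R] : T3Space R⟦X⟧ where

theorem hasSum_mul_of_X_pow_dvd [IsTopologicalRing R] [T3Space R] {κ : Type*}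
    {f : ι → R⟦X⟧} {g : κ → R⟦X⟧} {a b : R⟦X⟧} (hf : HasSum f a) (hg : HasSum g b)
    {e : ι → ℕ} (he : ∀ N, {i | e i ≤ N}.Finite) (hfe : ∀ i, X ^ e i ∣ f i)
    {e' : κ → ℕ} (he' : ∀ N, {i | e' i ≤ N}.Finite) (hge : ∀ i, X ^ e' i ∣ g i) :
    HasSum (fun x : ι × κ => f x.1 * g x.2) (a * b) :=
  hf.mul hg (summable_of_X_pow_dvd (finite_add_le he he') fun i => by
    rw [pow_add]; exact mul_dvd_mul (hfe _) (hge _))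

end Summability

theorem eq_of_forall_X_pow_dvd_sub {R : Type*} [CommRing R] {a b : R⟦X⟧}
    (h : ∀ N : ℕ, X ^ (N + 1) ∣ a - b) : a = b := by
  ext n
  have := X_pow_dvd_iff.mp (h n) n (by omega)
  rwa [map_sub, sub_eq_zero] at this

/-! ### Euler's product and its logarithmic derivative -/

section EulerProduct

/-- The finite product `(q)_n`. -/
noncomputable def qPoch (n : ℕ) : ℚ⟦X⟧ := ∏ i ∈ range n, (1 - X ^ (i + 1))

/-- Euler's product `(q)_∞`. -/
noncomputable abbrev eulerProd : ℚ⟦X⟧ := pentagonalSeries ℚ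

theorem qPoch_succ (n : ℕ) : qPoch (n + 1) = qPoch n * (1 - X ^ (n + 1)) :=
  prod_range_succ _ _

theorem X_pow_dvd_prod_sub_one {s : Finset ℕ} {N : ℕ} (hs : ∀ i ∈ s, N ≤ i) :
    (X : ℚ⟦X⟧) ^ (N + 1) ∣ ∏ i ∈ s, (1 - X ^ (i + 1)) - 1 := by
  induction s using Finset.induction_on with
  | empty => simp
  | insert a s ha ih =>
    rw [prod_insert ha]
    have h1 : (X : ℚ⟦X⟧) ^ (N + 1) ∣ X ^ (a + 1) :=
      pow_dvd_pow _ (by have := hs a (by simp); omega)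
    have h2 := ih fun i hi => hs i (mem_insert_of_mem hi)
    have : (1 - (X : ℚ⟦X⟧) ^ (a + 1)) * ∏ i ∈ s, (1 - X ^ (i + 1)) - 1
        = (1 - X ^ (a + 1)) * (∏ i ∈ s, (1 - X ^ (i + 1)) - 1) - X ^ (a + 1) := by ring
    rw [this]
    exact dvd_sub (h2.mul_left _) h1

theorem X_pow_dvd_eulerProd_sub_qPoch (N : ℕ) : X ^ (N + 1) ∣ eulerProd - qPoch N := by
  rw [X_pow_dvd_iff]
  intro m hm
  obtain ⟨s, hs, hNs⟩ := ((coeff_prod_one_sub_X_pow_eventually_eq ℚ m).and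
    (Filter.eventually_ge_atTop (range N))).exists
  rw [map_sub, ← hs, ← map_sub, ← prod_sdiff hNs]
  have h1 : (X : ℚ⟦X⟧) ^ (N + 1) ∣ ∏ i ∈ s \ range N, (1 - X ^ (i + 1)) - 1 :=
    X_pow_dvd_prod_sub_one fun i hi => by simp at hi; exact hi.2
  have h2 : (∏ i ∈ s \ range N, (1 - (X : ℚ⟦X⟧) ^ (i + 1))) * ∏ i ∈ range N, (1 - X ^ (i + 1))
      - qPoch N = (∏ i ∈ s \ range N, (1 - X ^ (i + 1)) - 1) * qPoch N := by
    rw [qPoch]; ring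
  rw [h2]
  exact X_pow_dvd_iff.mp (h1.mul_right _) m hm

/-- The series `∑_{m ≥ 0} q^{nm}`. -/
noncomputable def geom (n : ℕ) : ℚ⟦X⟧ := mk fun m => if n ∣ m then 1 else 0

theorem one_sub_mul_geom {n : ℕ} (hn : n ≠ 0) : (1 - X ^ n) * geom n = 1 := by
  ext m
  rw [sub_mul, one_mul, map_sub, coeff_X_pow_mul', geom, coeff_mk, coeff_one]
  rcases Nat.lt_or_ge m n with h | h
  · rw [if_neg (show ¬ n ≤ m by omega), sub_zero]
    rcases Nat.eq_zero_or_pos m with rfl | hm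
    · simp
    · rw [if_neg (Nat.not_dvd_of_pos_of_lt hm h), if_neg (show m ≠ 0 by omega)]
  · rw [if_pos h, coeff_mk, if_neg (by omega : m ≠ 0)]
    have : n ∣ m - n ↔ n ∣ m := Nat.dvd_sub_iff_left h dvd_rfl
    simp [this]

/-- The series `∑_{m ≥ 1} m q^{nm}`. -/
noncomputable def geomSq (n : ℕ) : ℚ⟦X⟧ := mk fun m => if n ∣ m then ((m / n : ℕ) : ℚ) else 0

theorem geomSq_eq {n : ℕ} (hn : n ≠ 0) : geomSq n = X ^ n * geom n ^ 2 := by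
  have key : (1 - X ^ n) * geomSq n = X ^ n * geom n := by
    ext m
    rw [sub_mul, one_mul, map_sub, coeff_X_pow_mul', coeff_X_pow_mul', geom, geomSq, coeff_mk]
    rcases Nat.lt_or_ge m n with h | h
    · rw [if_neg (show ¬ n ≤ m by omega), if_neg (show ¬ n ≤ m by omega), sub_zero, Nat.div_eq_of_lt h]
      simp
    · rw [if_pos h, if_pos h, coeff_mk, coeff_mk]
      obtain ⟨k, rfl⟩ := Nat.exists_eq_add_of_le h
      have : n ∣ n + k ↔ n ∣ k := by simp
      rw [Nat.add_sub_cancel_left]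
      by_cases hk : n ∣ k
      · rw [if_pos (this.mpr hk), if_pos hk, if_pos hk, Nat.add_div_left k (by omega)]
        push_cast; ring
      · rw [if_neg (this.not.mpr hk), if_neg hk, if_neg hk, sub_zero]
  linear_combination geom n * key - geomSq n * one_sub_mul_geom hn

/-- The divisor series `∑ σ(n) q^n`. -/
noncomputable def sigmaSeries (R : Type*) [CommRing R] : R⟦X⟧ :=
  mk fun n => ((ArithmeticFunction.sigma 1 n : ℕ) : R)

theorem X_pow_dvd_sigmaSeries_sub (N : ℕ) :
    X ^ (N + 1) ∣ sigmaSeries ℚ - ∑ n ∈ range N, geomSq (n + 1) := by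
  rw [X_pow_dvd_iff]
  intro m hm
  rw [map_sub, map_sum, sub_eq_zero, sigmaSeries, coeff_mk, ArithmeticFunction.sigma_one_apply,
    ← Nat.sum_div_divisors]
  simp only [geomSq, coeff_mk]
  push_cast
  rcases Nat.eq_zero_or_pos m with rfl | hpos
  · simp
  rw [← sum_filter]
  refine sum_bij_ne_zero (fun d _ _ => d - 1) ?_ ?_ ?_ ?_
  · intro d hd _
    have := Nat.le_of_dvd hpos (Nat.dvd_of_mem_divisors hd)
    have := Nat.pos_of_mem_divisors hd
    simp only [mem_filter, mem_range]
    refine ⟨by omega, ?_⟩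
    rw [Nat.sub_add_cancel this]
    exact Nat.dvd_of_mem_divisors hd
  · intro a ha _ b hb _ hab
    have := Nat.pos_of_mem_divisors ha
    have := Nat.pos_of_mem_divisors hb
    omega
  · intro b hb _
    simp only [mem_filter, mem_range] at hb
    refine ⟨b + 1, Nat.mem_divisors.mpr ⟨hb.2, by omega⟩, ?_, by simp⟩
    have := Nat.div_pos (Nat.le_of_dvd hpos hb.2) (Nat.succ_pos b)
    positivity
  · intro d hd _
    rw [Nat.sub_add_cancel (Nat.pos_of_mem_divisors hd)]

theorem X_pow_dvd_sigmaSeries_sub_lambert (N : ℕ) :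
    X ^ (N + 1) ∣ sigmaSeries ℚ - ∑ n ∈ range N, (n + 1 : ℚ⟦X⟧) * (X ^ (n + 1) * geom (n + 1)) := by
  rw [X_pow_dvd_iff]
  intro m hm
  have hc : ∀ n : ℕ, coeff m ((n + 1 : ℚ⟦X⟧) * (X ^ (n + 1) * geom (n + 1)))
      = if n + 1 ∣ m ∧ m ≠ 0 then ((n + 1 : ℕ) : ℚ) else 0 := by
    intro n
    rw [show (n + 1 : ℚ⟦X⟧) = C ((n + 1 : ℕ) : ℚ) by simp, coeff_C_mul, coeff_X_pow_mul', geom]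
    rcases Nat.lt_or_ge m (n + 1) with h | h
    · rw [if_neg (by omega), if_neg, mul_zero]
      rintro ⟨h1, h2⟩
      exact absurd (Nat.le_of_dvd (by omega) h1) (by omega)
    · rw [if_pos h, coeff_mk]
      obtain ⟨k, rfl⟩ := Nat.exists_eq_add_of_le h
      simp
  rw [map_sub, map_sum, sub_eq_zero, sigmaSeries, coeff_mk, ArithmeticFunction.sigma_one_apply]
  simp only [hc]
  push_cast
  rcases Nat.eq_zero_or_pos m with rfl | hpos
  · simp
  rw [← sum_filter]
  refine sum_bij (fun d _ => d - 1) ?_ ?_ ?_ ?_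
  · intro d hd
    have := Nat.le_of_dvd hpos (Nat.dvd_of_mem_divisors hd)
    have := Nat.pos_of_mem_divisors hd
    simp only [mem_filter, mem_range]
    refine ⟨by omega, ?_, by omega⟩
    rw [Nat.sub_add_cancel this]
    exact Nat.dvd_of_mem_divisors hd
  · intro a ha b hb hab
    have := Nat.pos_of_mem_divisors ha
    have := Nat.pos_of_mem_divisors hb
    omega
  · intro b hb
    simp only [mem_filter, mem_range] at hb
    exact ⟨b + 1, Nat.mem_divisors.mpr ⟨hb.2.1, by omega⟩, by simp⟩
  · intro d hd
    have := Nat.pos_of_mem_divisors hd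
    rw [Nat.cast_sub this]
    simp

theorem qD_qPoch (N : ℕ) : qD ℚ (qPoch N)
    = -(qPoch N * ∑ n ∈ range N, (n + 1 : ℚ⟦X⟧) * (X ^ (n + 1) * geom (n + 1))) := by
  induction N with
  | zero => simp [qPoch]
  | succ N ih =>
    rw [qPoch_succ, Derivation.leibniz, ih, map_sub, qD_X_pow, sum_range_succ,
      Derivation.map_one_eq_zero]
    have := one_sub_mul_geom (Nat.succ_ne_zero N)
    simp only [Nat.succ_eq_add_one, smul_eq_mul] at *
    push_cast
    linear_combination (qPoch N * (N + 1) * X ^ (N + 1)) * this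

theorem X_pow_dvd_qD {f : ℚ⟦X⟧} {N : ℕ} (h : X ^ N ∣ f) : X ^ N ∣ qD ℚ f := by
  rw [X_pow_dvd_iff] at h ⊢
  intro m hm
  rw [coeff_qD, h m hm, mul_zero]

theorem qD_eulerProd : qD ℚ eulerProd = -(eulerProd * sigmaSeries ℚ) := by
  refine eq_of_forall_X_pow_dvd_sub fun N => ?_
  have h1 := X_pow_dvd_eulerProd_sub_qPoch N
  have h2 := X_pow_dvd_qD h1
  have h3 := X_pow_dvd_sigmaSeries_sub_lambert N
  rw [map_sub, qD_qPoch] at h2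
  have := dvd_add (dvd_add h2 (h1.mul_right (∑ n ∈ range N, (n + 1 : ℚ⟦X⟧) *
    (X ^ (n + 1) * geom (n + 1))))) (h3.mul_right eulerProd)
  convert this using 1
  ring

/-- The weight two Eisenstein series `P = 1 - 24 ∑ σ(n) q^n`. -/
noncomputable def eisP (R : Type*) [CommRing R] : R⟦X⟧ := 1 - 24 * sigmaSeries R

theorem qD_eulerProd_eq_eisP_mul : 24 * qD ℚ eulerProd + eulerProd = eisP ℚ * eulerProd := by
  rw [qD_eulerProd, eisP]; ring

theorem map_eisP {R S : Type*} [CommRing R] [CommRing S] (φ : R →+* S) :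
    PowerSeries.map φ (eisP R) = eisP S := by
  have : PowerSeries.map φ (sigmaSeries R) = sigmaSeries S := by
    ext n; simp [sigmaSeries]
  rw [eisP, eisP, map_sub, map_mul, this, map_one, map_ofNat]

end EulerProduct

/-! ### Moments of the odd theta series -/

section Theta

/-- Triangular numbers indexed by the integers. -/
def tri (n : ℤ) : ℕ := (n * (n + 1) / 2).toNat

theorem two_mul_tri (n : ℤ) : 2 * (tri n : ℤ) = n * (n + 1) := by
  have h : 0 ≤ n * (n + 1) := by
    rcases lt_or_ge n 0 with h | h <;> nlinarith
  rw [tri, Int.toNat_of_nonneg (Int.ediv_nonneg h (by norm_num))]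
  exact Int.two_mul_ediv_two_of_even (Int.even_mul_succ_self n)

theorem tri_finite (N : ℕ) : {n : ℤ | tri n ≤ N}.Finite := by
  refine (Set.finite_Icc (-(2 * N + 1 : ℤ)) (2 * N + 1)).subset fun n hn => ?_
  have h := two_mul_tri n
  have hn' : (tri n : ℤ) ≤ N := by exact_mod_cast hn
  constructor <;> nlinarith

theorem tri_neg (n : ℤ) : tri (-1 - n) = tri n := by
  have h1 := two_mul_tri n
  have h2 := two_mul_tri (-1 - n)
  have : (2 * (tri (-1 - n) : ℤ)) = 2 * tri n := by rw [h1, h2]; ring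
  omega

/-- The coefficient `(-1)^n q^{n(n+1)/2}` of the odd theta series. -/
noncomputable def thetaCoeff (n : ℤ) : ℚ⟦X⟧ := (Int.negOnePow n : ℚ⟦X⟧) * X ^ tri n

theorem negOnePow_cast_neg (n : ℤ) :
    ((Int.negOnePow (-1 - n) : ℤˣ) : ℚ⟦X⟧) = -((Int.negOnePow n : ℤˣ) : ℚ⟦X⟧) := by
  rw [Int.negOnePow_sub, Int.negOnePow_neg]
  simp

theorem thetaCoeff_neg (n : ℤ) : thetaCoeff (-1 - n) = -thetaCoeff n := by
  rw [thetaCoeff, thetaCoeff, negOnePow_cast_neg, tri_neg, neg_mul]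

/-- The reflection `n ↦ -1 - n` of the integers. -/
def reflect : ℤ ≃ ℤ where
  toFun n := -1 - n
  invFun n := -1 - n
  left_inv n := by ring
  right_inv n := by ring

/-- The `k`-th moment `∑ (-1)^n (2n+1)^k q^{n(n+1)/2}`, the sum being over all integers. -/
noncomputable def moment (k : ℕ) : ℚ⟦X⟧ := ∑' n : ℤ, thetaCoeff n * (2 * (n : ℚ⟦X⟧) + 1) ^ k

theorem X_pow_tri_dvd (k : ℕ) (n : ℤ) : X ^ tri n ∣ thetaCoeff n * (2 * (n : ℚ⟦X⟧) + 1) ^ k :=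
  (dvd_mul_left _ _).mul_right _

theorem hasSum_moment (k : ℕ) : HasSum (fun n : ℤ => thetaCoeff n * (2 * (n : ℚ⟦X⟧) + 1) ^ k) (moment k) :=
  (summable_of_X_pow_dvd tri_finite (X_pow_tri_dvd k)).hasSum

theorem eq_zero_of_eq_neg {R : Type*} [CommRing R] [Algebra ℚ R] {a : R} (h : a = -a) : a = 0 := by
  have h2 : (2 : R) * a = 0 := by linear_combination h
  have : algebraMap ℚ R (1 / 2) * 2 = 1 := by
    rw [← map_ofNat (algebraMap ℚ R) 2, ← map_mul]; norm_num
  linear_combination algebraMap ℚ R (1 / 2) * h2 - a * this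

theorem moment_even {k : ℕ} (hk : Even k) : moment k = 0 := by
  have h := (Equiv.hasSum_iff reflect).mpr (hasSum_moment k)
  refine eq_zero_of_eq_neg (h.unique ?_)
  refine ((hasSum_moment k).neg).congr_fun fun n => ?_
  simp only [Function.comp_apply, reflect, Equiv.coe_fn_mk, thetaCoeff_neg]
  rw [show (2 * ((-1 - n : ℤ) : ℚ⟦X⟧) + 1) = -(2 * (n : ℚ⟦X⟧) + 1) by push_cast; ring, hk.neg_pow]
  ring

theorem moment_add_two (k : ℕ) : moment (k + 2) = 8 * qD ℚ (moment k) + moment k := by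
  refine (hasSum_moment (k + 2)).unique ?_
  refine (((hasSum_qD (hasSum_moment k)).mul_left 8).add (hasSum_moment k)).congr_fun fun n => ?_
  have h := congrArg (Int.cast : ℤ → ℚ⟦X⟧) (two_mul_tri n)
  push_cast at h
  have h2 : qD ℚ (thetaCoeff n * (2 * (n : ℚ⟦X⟧) + 1) ^ k) = (tri n : ℚ⟦X⟧) * (thetaCoeff n * (2 * (n : ℚ⟦X⟧) + 1) ^ k) := by
    have h3 : thetaCoeff n * (2 * (n : ℚ⟦X⟧) + 1) ^ k
        = C ((Int.negOnePow n : ℚ) * (2 * (n : ℚ) + 1) ^ k) * X ^ tri n := by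
      rw [thetaCoeff]; simp [map_ofNat]; ring
    rw [h3, Derivation.leibniz, qD_C, qD_X_pow]
    simp only [smul_eq_mul]
    ring
  rw [h2]
  linear_combination (-4 * thetaCoeff n * (2 * (n : ℚ⟦X⟧) + 1) ^ k) * h

end Theta

/-! ### The bilateral Lambert coefficients -/

section Lambert

/-- The exponent `n(3n+1)/2 + ni`. -/
def pentExp (i n : ℕ) : ℕ := n * (3 * n + 1) / 2 + n * i

theorem two_mul_pentExp (i n : ℕ) : 2 * pentExp i n = n * (3 * n + 1) + 2 * (n * i) := by
  have : 2 ∣ n * (3 * n + 1) := by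
    rcases Nat.even_or_odd' n with ⟨m, rfl | rfl⟩
    · exact ⟨m * (3 * (2 * m) + 1), by ring⟩
    · exact ⟨(2 * m + 1) * (3 * m + 2), by ring⟩
  rw [pentExp]; omega

theorem le_pentExp (i n : ℕ) : n ≤ pentExp i n := by
  have := two_mul_pentExp i n
  nlinarith [Nat.zero_le (n * i), Nat.zero_le n, sq_nonneg ((n : ℤ) - 1), Nat.le_mul_self n]

theorem pentExp_finite (i N : ℕ) : {n | pentExp i n ≤ N}.Finite :=
  (Set.finite_Iic N).subset fun n hn => (le_pentExp i n).trans hn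

/-- Terms of `∑ (-1)^n ((6n+2i+1)^2 - P) q^{n(3n+2i+1)/2}`. -/
noncomputable def lambertTerm (i n : ℕ) : ℚ⟦X⟧ :=
  (-1) ^ n * ((6 * (n : ℚ⟦X⟧) + 2 * (i : ℚ⟦X⟧) + 1) ^ 2 - eisP ℚ) * X ^ pentExp i n

/-- The series `∑_{n ≥ 0} (-1)^n ((6n+2i+1)^2 - P) q^{n(3n+2i+1)/2}`. -/
noncomputable def lambertNat (i : ℕ) : ℚ⟦X⟧ := ∑' n, lambertTerm i n

theorem hasSum_lambertNat (i : ℕ) : HasSum (lambertTerm i) (lambertNat i) :=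
  (summable_of_X_pow_dvd (pentExp_finite i) fun _ => dvd_mul_left _ _).hasSum

/-- The polynomial factor `(2i+1)^2 - P`. -/
noncomputable def quadFactor (i : ℤ) : ℚ⟦X⟧ := (2 * (i : ℚ⟦X⟧) + 1) ^ 2 - eisP ℚ

/-- The extension of `lambertNat` to all integers, odd up to the factor `(2i+1)^2 - P`. -/
noncomputable def lambert : ℤ → ℚ⟦X⟧
  | Int.ofNat i => lambertNat i
  | Int.negSucc i => quadFactor i - lambertNat i

theorem hasSum_lambertNat_sub (i : ℕ) :
    HasSum (fun n => lambertTerm i (n + 1)) (lambertNat i - quadFactor i) := by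
  have := (hasSum_nat_add_iff' 1).mpr (hasSum_lambertNat i)
  rw [sum_range_one] at this
  refine cast ?_ this
  congr 1
  simp [lambertTerm, pentExp, quadFactor]

theorem lambertNat_rec (i : ℕ) :
    lambertNat i = quadFactor i - X ^ (i + 2) * lambertNat (i + 3) := by
  have h1 := hasSum_lambertNat_sub i
  have h2 := ((hasSum_lambertNat (i + 3)).mul_left (X ^ (i + 2))).neg
  have : (fun n => lambertTerm i (n + 1)) = fun n => -(X ^ (i + 2) * lambertTerm (i + 3) n) := by
    funext n
    have he : pentExp i (n + 1) = i + 2 + pentExp (i + 3) n := by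
      have a := two_mul_pentExp i (n + 1)
      have b := two_mul_pentExp (i + 3) n
      nlinarith
    rw [lambertTerm, lambertTerm, he]
    push_cast
    ring
  rw [this] at h1
  linear_combination h1.unique h2

theorem lambertNat_zero : lambertNat 0 = X * lambertNat 2 := by
  have hE := hasSum_pentagonalSeries ℚ
  rw [← neg_injective.hasSum_iff (fun x hx ↦ by absurd hx; use -x; simp)] at hE
  have h1 := ((hasSum_qD hE).mul_left 24).add ((hE.mul_left (1 - eisP ℚ)))
  have h0 : 24 * qD ℚ eulerProd + (1 - eisP ℚ) * eulerProd = 0 := by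
    linear_combination qD_eulerProd_eq_eisP_mul
  rw [h0] at h1
  have h2 : HasSum (fun k : ℤ => (Int.negOnePow k : ℚ⟦X⟧) * ((6 * (k : ℚ⟦X⟧) + 1) ^ 2 - eisP ℚ)
      * X ^ pentagonal (-k)) 0 := by
    refine (h1).congr_fun fun k => ?_
    have e := congrArg (Int.cast : ℤ → ℚ⟦X⟧) (two_mul_natCast_pentagonal_neg k)
    push_cast at e
    have h3 : qD ℚ ((Int.negOnePow (-k) : ℚ⟦X⟧) * X ^ pentagonal (-k))
        = (pentagonal (-k) : ℚ⟦X⟧) * ((Int.negOnePow (-k) : ℚ⟦X⟧) * X ^ pentagonal (-k)) := by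
      have : (Int.negOnePow (-k) : ℚ⟦X⟧) = C (Int.negOnePow (-k) : ℚ) := by simp
      rw [this, Derivation.leibniz, qD_C, qD_X_pow]
      simp only [smul_eq_mul]
      ring
    simp only [Function.comp_apply]
    rw [h3, Int.negOnePow_neg]
    linear_combination (-12 * (Int.negOnePow k : ℚ⟦X⟧) * X ^ pentagonal (-k)) * e
  have h3 : HasSum (fun k : ℕ => lambertTerm 0 k + -(X * lambertTerm 2 k)) 0 := by
    refine (h2.nat_add_neg_add_one).congr_fun fun n => ?_
    have e1 := two_mul_natCast_pentagonal_neg (n : ℤ)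
    have e2 := two_mul_natCast_pentagonal (n + 1 : ℤ)
    have a1 : pentExp 0 n = pentagonal (-n) := by
      have := two_mul_pentExp 0 n; zify at this ⊢; linarith
    have a2 : pentExp 2 n + 1 = pentagonal (- -(n + 1 : ℤ)) := by
      rw [neg_neg]
      have := two_mul_pentExp 2 n; zify at this ⊢; linarith
    rw [lambertTerm, lambertTerm, ← a1, ← a2, Int.negOnePow_neg, Int.negOnePow_add]
    simp
    ring
  have h4 := (hasSum_lambertNat 0).add ((hasSum_lambertNat 2).mul_left X).neg
  linear_combination h4.unique h3

theorem quadFactor_reflect (i : ℤ) : quadFactor (-1 - i) = quadFactor i := by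
  rw [quadFactor, quadFactor]; push_cast; ring

theorem lambert_reflect (i : ℤ) : lambert (-1 - i) = quadFactor i - lambert i := by
  rcases i with i | i
  · have : (-1 - Int.ofNat i) = Int.negSucc i := by
      rw [Int.negSucc_eq]; simp; ring
    rw [this]; rfl
  · have : (-1 - Int.negSucc i) = Int.ofNat i := by
      rw [Int.negSucc_eq]; simp
    rw [this]
    have h2 : quadFactor (Int.negSucc i) = quadFactor i := by
      rw [← quadFactor_reflect]; congr 1
    rw [h2]
    change lambertNat i = quadFactor i - (quadFactor i - lambertNat i)
    ring

theorem lambert_natCast (i : ℕ) : lambert i = lambertNat i := rfl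

theorem lambert_rec_nat (k : ℕ) :
    lambert ((k : ℤ) - 2) = quadFactor ((k : ℤ) - 2) - X ^ k * lambert ((k : ℤ) + 1) := by
  rcases k with _ | _ | k
  · have := lambert_reflect 1
    rw [show (-1 - 1 : ℤ) = ((0 : ℕ) : ℤ) - 2 by norm_num] at this
    rw [this, ← quadFactor_reflect 1]
    simp
  · have h1 := lambert_reflect 0
    have h2 : lambert 0 = X * lambert 2 := lambertNat_zero
    norm_num at h1 ⊢
    rw [h1, ← quadFactor_reflect 0, h2]
    norm_num
  · have h := lambertNat_rec k
    rw [← lambert_natCast, ← lambert_natCast] at h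
    rw [show ((k + 1 + 1 : ℕ) : ℤ) - 2 = k by push_cast; ring, h]
    congr 3

theorem lambert_rec_neg (k : ℕ) :
    lambert (1 - (k : ℤ)) = X ^ k * (quadFactor (-2 - (k : ℤ)) - lambert (-2 - (k : ℤ))) := by
  have h := lambert_rec_nat k
  have a1 := lambert_reflect ((k : ℤ) + 1)
  have a2 := lambert_reflect ((k : ℤ) - 2)
  rw [show (-1 - ((k : ℤ) + 1)) = -2 - k by ring] at a1
  rw [show (-1 - ((k : ℤ) - 2)) = 1 - k by ring] at a2
  rw [a2, a1, h, ← quadFactor_reflect (-2 - (k : ℤ)), show (-1 - (-2 - (k : ℤ))) = k + 1 by ring]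
  ring

end Lambert

/-! ### The coefficients of the product of the theta cube with the Lambert series -/

section Cube

/-- The coefficient of the cube of the theta series. -/
noncomputable def cubeCoeff (n : ℤ × ℤ × ℤ) : ℚ⟦X⟧ :=
  thetaCoeff n.1 * (thetaCoeff n.2.1 * thetaCoeff n.2.2)

/-- The total index. -/
def total (n : ℤ × ℤ × ℤ) : ℤ := n.1 + n.2.1 + n.2.2

/-- The total exponent. -/
def cubeExp (n : ℤ × ℤ × ℤ) : ℕ := tri n.1 + (tri n.2.1 + tri n.2.2)

theorem cubeExp_finite (N : ℕ) : {n | cubeExp n ≤ N}.Finite :=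
  finite_add_le tri_finite (finite_add_le tri_finite tri_finite) N

theorem cubeCoeff_eq (n : ℤ × ℤ × ℤ) :
    cubeCoeff n = (Int.negOnePow (total n) : ℚ⟦X⟧) * X ^ cubeExp n := by
  rw [cubeCoeff, thetaCoeff, thetaCoeff, thetaCoeff, total, cubeExp, Int.negOnePow_add,
    Int.negOnePow_add]
  push_cast
  ring

theorem X_pow_dvd_cubeCoeff (n : ℤ × ℤ × ℤ) : X ^ cubeExp n ∣ cubeCoeff n := by
  rw [cubeCoeff_eq]; exact dvd_mul_left _ _

theorem cubeExp_shift (n : ℤ × ℤ × ℤ) :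
    (cubeExp (n + (1, 1, 1)) : ℤ) = cubeExp n + (total n + 3) := by
  have h1 := two_mul_tri n.1
  have h2 := two_mul_tri n.2.1
  have h3 := two_mul_tri n.2.2
  have h4 := two_mul_tri (n.1 + 1)
  have h5 := two_mul_tri (n.2.1 + 1)
  have h6 := two_mul_tri (n.2.2 + 1)
  simp only [cubeExp, total, Prod.fst_add, Prod.snd_add]
  push_cast
  linarith

theorem total_shift (n : ℤ × ℤ × ℤ) : total (n + (1, 1, 1)) = total n + 3 := by
  simp only [total, Prod.fst_add, Prod.snd_add]; ring

theorem cubeCoeff_shift_of_nonneg (n : ℤ × ℤ × ℤ) {p : ℕ} (hp : total n + 3 = p) :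
    cubeCoeff (n + (1, 1, 1)) = -(X ^ p * cubeCoeff n) := by
  have h : cubeExp (n + (1, 1, 1)) = cubeExp n + p := by
    have := cubeExp_shift n; omega
  rw [cubeCoeff_eq, cubeCoeff_eq, h, total_shift, Int.negOnePow_add, pow_add]
  simp [Int.negOnePow_odd 3 (by decide)]
  ring

theorem cubeCoeff_shift_of_nonpos (n : ℤ × ℤ × ℤ) {p : ℕ} (hp : total n + 3 = -p) :
    cubeCoeff n = -(X ^ p * cubeCoeff (n + (1, 1, 1))) := by
  have h : cubeExp n = cubeExp (n + (1, 1, 1)) + p := by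
    have := cubeExp_shift n; omega
  rw [cubeCoeff_eq, cubeCoeff_eq, h, total_shift, Int.negOnePow_add, pow_add]
  simp [Int.negOnePow_odd 3 (by decide)]
  ring

theorem hasSum_cubeCoeff_mul_pow (i j k : ℕ) :
    HasSum (fun n : ℤ × ℤ × ℤ => cubeCoeff n * ((2 * (n.1 : ℚ⟦X⟧) + 1) ^ i
      * (2 * (n.2.1 : ℚ⟦X⟧) + 1) ^ j * (2 * (n.2.2 : ℚ⟦X⟧) + 1) ^ k)) (moment i * (moment j * moment k)) := by
  have h := hasSum_mul_of_X_pow_dvd (hasSum_moment j) (hasSum_moment k) tri_finite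
    (X_pow_tri_dvd j) tri_finite (X_pow_tri_dvd k)
  have h' := hasSum_mul_of_X_pow_dvd (hasSum_moment i) h tri_finite
    (X_pow_tri_dvd i) (finite_add_le tri_finite tri_finite)
    (fun x => by rw [pow_add]; exact mul_dvd_mul (X_pow_tri_dvd j _) (X_pow_tri_dvd k _))
  refine (h').congr_fun fun n => ?_
  rw [cubeCoeff]
  ring

theorem hasSum_cubeCoeff_mul_quadFactor (t : ℤ) :
    HasSum (fun n => cubeCoeff n * quadFactor (t - total n)) 0 := by
  have h0 : moment 0 = 0 := moment_even (by decide)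
  have H := hasSum_cubeCoeff_mul_pow
  have := ((((((((((H 0 0 0).mul_left ((2 * (t : ℚ⟦X⟧) + 4) ^ 2 - eisP ℚ)).add (H 2 0 0)).add
    (H 0 2 0)).add (H 0 0 2)).add ((H 1 0 0).mul_left (-2 * (2 * (t : ℚ⟦X⟧) + 4)))).add
    ((H 0 1 0).mul_left (-2 * (2 * (t : ℚ⟦X⟧) + 4)))).add ((H 0 0 1).mul_left (-2 * (2 * (t : ℚ⟦X⟧) + 4)))).add
    ((H 1 1 0).mul_left 2)).add ((H 1 0 1).mul_left 2)).add ((H 0 1 1).mul_left 2)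
  simp only [h0, zero_mul, mul_zero, add_zero] at this
  refine (this).congr_fun fun n => ?_
  rw [quadFactor, total]
  push_cast
  ring

/-- The coefficients of the product of the theta cube with the bilateral Lambert series. -/
noncomputable def cubeLambert (t : ℤ) : ℚ⟦X⟧ := ∑' n, cubeCoeff n * lambert (t - total n)

theorem hasSum_cubeLambert (t : ℤ) :
    HasSum (fun n => cubeCoeff n * lambert (t - total n)) (cubeLambert t) :=
  (summable_of_X_pow_dvd cubeExp_finite fun n => (X_pow_dvd_cubeCoeff n).mul_right _).hasSum

theorem cubeCoeff_mul_lambert_shift (h : ℕ) (n : ℤ × ℤ × ℤ) :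
    cubeCoeff (n + (1, 1, 1)) * lambert ((h : ℤ) - 2 - total (n + (1, 1, 1)))
      = cubeCoeff (n + (1, 1, 1)) * quadFactor ((h : ℤ) - 2 - total (n + (1, 1, 1)))
        + X ^ h * (cubeCoeff n * lambert ((h : ℤ) - 2 - total n)) := by
  rw [total_shift]
  rcases le_total 0 (total n + 3) with hp | hp
  · obtain ⟨p, hp⟩ := Int.eq_ofNat_of_zero_le hp
    have hc := cubeCoeff_shift_of_nonneg n hp
    have ht : total n = p - 3 := by linarith
    rw [ht]
    rcases le_total p h with hph | hph
    · obtain ⟨k, rfl⟩ := Nat.exists_eq_add_of_le hph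
      have hL := lambert_rec_nat k
      rw [show ((p + k : ℕ) : ℤ) - 2 - ((p : ℤ) - 3 + 3) = k - 2 by push_cast; ring,
        show ((p + k : ℕ) : ℤ) - 2 - ((p : ℤ) - 3) = k + 1 by push_cast; ring, hL, hc]
      ring
    · obtain ⟨k, rfl⟩ := Nat.exists_eq_add_of_le hph
      have hL := lambert_rec_neg k
      rw [show (h : ℤ) - 2 - (((h + k : ℕ) : ℤ) - 3 + 3) = -2 - k by push_cast; ring,
        show (h : ℤ) - 2 - (((h + k : ℕ) : ℤ) - 3) = 1 - k by push_cast; ring, hL, hc]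
      ring
  · obtain ⟨p, hp'⟩ := Int.eq_ofNat_of_zero_le (neg_nonneg.mpr hp)
    have hp : total n + 3 = -p := by linarith
    have hc := cubeCoeff_shift_of_nonpos n hp
    have ht : total n = -p - 3 := by linarith
    have hL := lambert_rec_nat (h + p)
    rw [ht, hc]
    rw [show (h : ℤ) - 2 - (-(p : ℤ) - 3 + 3) = ((h + p : ℕ) : ℤ) - 2 by push_cast; ring,
        show (h : ℤ) - 2 - (-(p : ℤ) - 3) = ((h + p : ℕ) : ℤ) + 1 by push_cast; ring, hL]
    ring

theorem cubeLambert_eq_zero_of_nat (h : ℕ) (hh : h ≠ 0) : cubeLambert ((h : ℤ) - 2) = 0 := by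
  have h1 := (Equiv.hasSum_iff (Equiv.addRight ((1, 1, 1) : ℤ × ℤ × ℤ))).mpr
    (hasSum_cubeLambert ((h : ℤ) - 2))
  have h2 := (Equiv.hasSum_iff (Equiv.addRight ((1, 1, 1) : ℤ × ℤ × ℤ))).mpr
    (hasSum_cubeCoeff_mul_quadFactor ((h : ℤ) - 2))
  have h3 := h2.add ((hasSum_cubeLambert ((h : ℤ) - 2)).mul_left (X ^ h))
  have h4 := h1.unique (h3.congr_fun fun n => cubeCoeff_mul_lambert_shift h n)
  have h5 : (1 - X ^ h) * cubeLambert ((h : ℤ) - 2) = 0 := by linear_combination h4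
  have h6 := one_sub_mul_geom hh
  linear_combination geom h * h5 - cubeLambert ((h : ℤ) - 2) * h6

theorem cubeLambert_reflect (t : ℤ) : cubeLambert t = cubeLambert (-4 - t) := by
  let e : ℤ × ℤ × ℤ ≃ ℤ × ℤ × ℤ := reflect.prodCongr (reflect.prodCongr reflect)
  have h1 := (Equiv.hasSum_iff e).mpr (hasSum_cubeLambert t)
  have h2 := (hasSum_cubeCoeff_mul_quadFactor (-4 - t)).neg.add (hasSum_cubeLambert (-4 - t))
  have h3 : (fun n => cubeCoeff n * lambert (t - total n)) ∘ e = fun n =>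
      -(cubeCoeff n * quadFactor (-4 - t - total n)) + cubeCoeff n * lambert (-4 - t - total n) := by
    funext n
    have a1 : cubeCoeff (e n) = -cubeCoeff n := by
      simp only [cubeCoeff, e, Equiv.prodCongr_apply, Prod.map, reflect, Equiv.coe_fn_mk,
        thetaCoeff_neg]
      ring
    have a2 : total (e n) = -3 - total n := by
      simp only [total, e, Equiv.prodCongr_apply, Prod.map, reflect, Equiv.coe_fn_mk]
      ring
    rw [Function.comp_apply, a1, a2,
      show t - (-3 - total n) = -1 - (-4 - t - total n) by ring, lambert_reflect]
    ring
  rw [h3] at h1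
  simpa using h1.unique h2

theorem cubeLambert_eq_zero {t : ℤ} (ht : t ≠ -2) : cubeLambert t = 0 := by
  rcases lt_or_gt_of_ne ht with h | h
  · rw [cubeLambert_reflect]
    have := cubeLambert_eq_zero_of_nat (-2 - t).toNat (by omega)
    rwa [Int.toNat_of_nonneg (by omega), show -2 - t - 2 = -4 - t by ring] at this
  · have := cubeLambert_eq_zero_of_nat (t + 2).toNat (by omega)
    rwa [Int.toNat_of_nonneg (by omega), show t + 2 - 2 = t by ring] at this

end Cube

/-! ### Bivariate series: derivations, exponentials, and sums -/

section MapCoeff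

variable {k R : Type*} [CommRing k] [CommRing R] [Algebra k R]

/-- The derivation of `R⟦X⟧` that applies a derivation of `R` to each coefficient. -/
noncomputable def mapCoeffD (d : Derivation k R R) : Derivation k R⟦X⟧ R⟦X⟧ :=
  Derivation.mk'
    { toFun := fun f => PowerSeries.mk fun n => d (coeff n f)
      map_add' := fun f g => by ext; simp
      map_smul' := fun c f => by
        ext n
        change (coeff n) (PowerSeries.mk fun n => d (c • coeff n f))
          = c • coeff n (PowerSeries.mk fun n => d (coeff n f))
        simp }
    fun f g => by
      ext n
      simp only [LinearMap.coe_mk, AddHom.coe_mk, coeff_mk, smul_eq_mul, map_add, coeff_mul,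
        map_sum, Derivation.leibniz, sum_add_distrib]
      congr 1
      rw [← Finset.Nat.sum_antidiagonal_swap]
      rfl

theorem coeff_mapCoeffD (d : Derivation k R R) (f : R⟦X⟧) (n : ℕ) :
    coeff n (mapCoeffD d f) = d (coeff n f) := by
  change coeff n (PowerSeries.mk fun n => d (coeff n f)) = _
  rw [coeff_mk]

theorem mapCoeffD_C (d : Derivation k R R) (r : R) : mapCoeffD d (C r) = C (d r) := by
  ext n
  rw [coeff_mapCoeffD, coeff_C, coeff_C]
  split_ifs <;> simp

theorem mapCoeffD_X (d : Derivation k R R) : mapCoeffD d (X : R⟦X⟧) = 0 := by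
  ext n
  rw [coeff_mapCoeffD, coeff_X]
  split_ifs <;> simp

end MapCoeff

section Bivariate

/-- The operator `q d/dq` on series in `z` with coefficients in `ℚ⟦q⟧`. -/
noncomputable def qDz : Derivation ℚ ℚ⟦X⟧⟦X⟧ ℚ⟦X⟧⟦X⟧ := mapCoeffD (qD ℚ)

theorem coeff_qDz (f : ℚ⟦X⟧⟦X⟧) (n : ℕ) : coeff n (qDz f) = qD ℚ (coeff n f) :=
  coeff_mapCoeffD _ _ _

theorem qDz_C (f : ℚ⟦X⟧) : qDz (C f) = C (qD ℚ f) := mapCoeffD_C _ _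

theorem qDz_X : qDz X = 0 := mapCoeffD_X _

/-- The exponential `e^{nz}`. -/
noncomputable def expZ (n : ℤ) : ℚ⟦X⟧⟦X⟧ := rescale (n : ℚ⟦X⟧) (exp ℚ⟦X⟧)

theorem expZ_add (m n : ℤ) : expZ (m + n) = expZ m * expZ n := by
  rw [expZ, expZ, expZ, exp_mul_exp_eq_exp_add]
  push_cast
  rfl

theorem expZ_zero : expZ 0 = 1 := by
  ext n
  simp [expZ]

theorem coeff_expZ (n : ℤ) (k : ℕ) :
    coeff k (expZ n) = (n : ℚ⟦X⟧) ^ k * C (1 / k.factorial : ℚ) := by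
  rw [expZ, coeff_rescale, coeff_exp]
  rfl

theorem qDz_expZ (n : ℤ) : qDz (expZ n) = 0 := by
  ext1 k
  rw [coeff_qDz, coeff_expZ, show ((n : ℚ⟦X⟧) ^ k * C (1 / k.factorial : ℚ))
    = C ((n : ℚ) ^ k * (1 / k.factorial : ℚ)) by simp, qD_C, map_zero]

theorem zD_expZ (n : ℤ) : qD ℚ⟦X⟧ (expZ n) = (n : ℚ⟦X⟧⟦X⟧) * X * expZ n := by
  ext1 k
  rw [coeff_qD, show (n : ℚ⟦X⟧⟦X⟧) * X * expZ n = X * (C (n : ℚ⟦X⟧) * expZ n) by simp; ring]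
  rcases k with _ | k
  · simp
  · rw [coeff_succ_X_mul, coeff_C_mul, coeff_expZ, coeff_expZ]
    have : C (1 / (k.factorial : ℚ)) = ((k + 1 : ℕ) : ℚ⟦X⟧) * C (1 / ((k + 1).factorial : ℚ)) := by
      rw [← map_natCast (C (R := ℚ)), ← map_mul, Nat.factorial_succ]
      congr 1
      push_cast
      field_simp
    rw [this]
    ring

theorem summable_of_C_X_pow_dvd {ι : Type*} {f : ι → ℚ⟦X⟧⟦X⟧} {e : ι → ℕ}
    (he : ∀ N, {i | e i ≤ N}.Finite) (h : ∀ i, C (X ^ e i) ∣ f i) : Summable f := by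
  rw [summable_iff_summable_coeff]
  intro k
  refine summable_of_X_pow_dvd he fun i => ?_
  obtain ⟨g, hg⟩ := h i
  rw [hg, coeff_C_mul]
  exact dvd_mul_right _ _

theorem C_X_pow_dvd {c : ℚ⟦X⟧} {e : ℕ} (h : X ^ e ∣ c) (f : ℚ⟦X⟧⟦X⟧) :
    C (X ^ e : ℚ⟦X⟧) ∣ C c * f :=
  (_root_.map_dvd C h).mul_right _

theorem hasSum_mul_of_C_X_pow_dvd {ι κ : Type*}
    {f : ι → ℚ⟦X⟧⟦X⟧} {g : κ → ℚ⟦X⟧⟦X⟧} {a b : ℚ⟦X⟧⟦X⟧} (hf : HasSum f a) (hg : HasSum g b)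
    {e : ι → ℕ} (he : ∀ N, {i | e i ≤ N}.Finite) (hfe : ∀ i, C (X ^ e i) ∣ f i)
    {e' : κ → ℕ} (he' : ∀ N, {i | e' i ≤ N}.Finite) (hge : ∀ i, C (X ^ e' i) ∣ g i) :
    HasSum (fun x : ι × κ => f x.1 * g x.2) (a * b) :=
  hf.mul hg (summable_of_C_X_pow_dvd (finite_add_le he he') fun i => by
    rw [pow_add, map_mul]; exact mul_dvd_mul (hfe _) (hge _))

theorem hasSum_C {ι : Type*} {f : ι → ℚ⟦X⟧} {a : ℚ⟦X⟧} (h : HasSum f a) :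
    HasSum (fun i => C (R := ℚ⟦X⟧) (f i)) (C a) :=
  h.map (C (R := ℚ⟦X⟧)) continuous_C

theorem hasSum_qDz {ι : Type*} {f : ι → ℚ⟦X⟧⟦X⟧} {a : ℚ⟦X⟧⟦X⟧} (h : HasSum f a) :
    HasSum (fun i => qDz (f i)) (qDz a) := by
  rw [hasSum_iff_hasSum_coeff] at h ⊢
  intro d
  simp only [coeff_qDz]
  exact hasSum_qD (h d)

end Bivariate

/-! ### The theta function and the Appell–Lerch sum -/

section Appell

/-- The odd theta function `∑ (-1)^n q^{n(n+1)/2} e^{(2n+1)z}`. -/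
noncomputable def thetaZ : ℚ⟦X⟧⟦X⟧ := ∑' n : ℤ, C (thetaCoeff n) * expZ (2 * n + 1)

theorem X_pow_tri_dvd_thetaCoeff (n : ℤ) : X ^ tri n ∣ thetaCoeff n := dvd_mul_left _ _

theorem hasSum_thetaZ : HasSum (fun n : ℤ => C (thetaCoeff n) * expZ (2 * n + 1)) thetaZ :=
  (summable_of_C_X_pow_dvd tri_finite fun n => C_X_pow_dvd (X_pow_tri_dvd_thetaCoeff n) _).hasSum

theorem coeff_thetaZ (k : ℕ) : coeff k thetaZ = moment k * C (1 / k.factorial : ℚ) := by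
  refine ((hasSum_iff_hasSum_coeff _).mp hasSum_thetaZ k).unique ?_
  refine ((hasSum_moment k).mul_right _).congr_fun fun n => ?_
  rw [coeff_C_mul, coeff_expZ]
  push_cast
  ring

theorem hasSum_thetaZ_cube :
    HasSum (fun n => C (cubeCoeff n) * expZ (2 * total n + 3)) (thetaZ ^ 3) := by
  have hd := fun n : ℤ => C_X_pow_dvd (X_pow_tri_dvd_thetaCoeff n) (expZ (2 * n + 1))
  have h2 := hasSum_mul_of_C_X_pow_dvd hasSum_thetaZ hasSum_thetaZ tri_finite hd tri_finite hd
  have h3 := hasSum_mul_of_C_X_pow_dvd hasSum_thetaZ h2 tri_finite hd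
    (finite_add_le tri_finite tri_finite)
    (fun x => by rw [pow_add, map_mul]; exact mul_dvd_mul (hd _) (hd _))
  rw [show thetaZ ^ 3 = thetaZ * (thetaZ * thetaZ) by ring]
  refine h3.congr_fun fun n => ?_
  rw [cubeCoeff, total, show 2 * (n.1 + n.2.1 + n.2.2) + 3
    = (2 * n.1 + 1) + ((2 * n.2.1 + 1) + (2 * n.2.2 + 1)) by ring, expZ_add (2 * n.1 + 1),
    expZ_add (2 * n.2.1 + 1), map_mul, map_mul]
  ring

/-- The series `∑_{n ≥ 1} (-1)^n q^{n(3n+1)/2+ni}`. -/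
noncomputable def appellCoeff (i : ℕ) : ℚ⟦X⟧ := ∑' n, (-1) ^ (n + 1) * X ^ pentExp i (n + 1)

theorem hasSum_appellCoeff (i : ℕ) :
    HasSum (fun n => (-1) ^ (n + 1) * X ^ pentExp i (n + 1)) (appellCoeff i) :=
  (summable_of_X_pow_dvd (e := fun n => pentExp i (n + 1))
    (fun N => (pentExp_finite i N).preimage (add_left_injective 1).injOn)
    fun _ => dvd_mul_left _ _).hasSum

theorem X_pow_dvd_of_hasSum {ι : Type*} {f : ι → ℚ⟦X⟧} {a : ℚ⟦X⟧} {N : ℕ} (h : HasSum f a)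
    (hf : ∀ i, X ^ N ∣ f i) : X ^ N ∣ a := by
  rw [X_pow_dvd_iff]
  intro m hm
  rw [coeff_hasSum_eq_sum h m ∅ fun i _ => X_pow_dvd_iff.mp (hf i) m hm, sum_empty]

theorem le_pentExp_succ (i n : ℕ) : i + n + 2 ≤ pentExp i (n + 1) := by
  have := two_mul_pentExp i (n + 1)
  nlinarith [Nat.zero_le (n * i), Nat.zero_le (n * n)]

theorem X_pow_dvd_appellCoeff (i : ℕ) : X ^ (i + 2) ∣ appellCoeff i :=
  X_pow_dvd_of_hasSum (hasSum_appellCoeff i) fun n =>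
    (pow_dvd_pow X (by have := le_pentExp_succ i n; omega)).mul_left _

theorem appellCoeff_eq (i : ℕ) :
    24 * qD ℚ (appellCoeff i) + quadFactor i * appellCoeff i = lambertNat i - quadFactor i := by
  refine HasSum.unique ?_ (hasSum_lambertNat_sub i)
  refine (((hasSum_qD (hasSum_appellCoeff i)).mul_left 24).add
    ((hasSum_appellCoeff i).mul_left (quadFactor i))).congr_fun fun n => ?_
  have h3 : qD ℚ ((-1) ^ (n + 1) * X ^ pentExp i (n + 1))
      = (pentExp i (n + 1) : ℚ⟦X⟧) * ((-1) ^ (n + 1) * X ^ pentExp i (n + 1)) := by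
    have : ((-1) ^ (n + 1) : ℚ⟦X⟧) = C ((-1) ^ (n + 1) : ℚ) := by simp
    rw [this, Derivation.leibniz, qD_C, qD_X_pow]
    simp only [smul_eq_mul]
    ring
  have e := congrArg (Nat.cast : ℕ → ℚ⟦X⟧) (two_mul_pentExp i (n + 1))
  push_cast at e
  rw [h3, lambertTerm, quadFactor]
  push_cast
  linear_combination (-12 * ((-1) ^ (n + 1) * X ^ pentExp i (n + 1) : ℚ⟦X⟧)) * e

/-- The odd part of the level one Appell–Lerch sum. -/
noncomputable def appellZ : ℚ⟦X⟧⟦X⟧ :=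
  ∑' i : ℕ, C (appellCoeff i) * (expZ (2 * i + 1) - expZ (-(2 * i + 1)))

theorem add_two_finite (N : ℕ) : {i : ℕ | i + 2 ≤ N}.Finite :=
  (Set.finite_Iic N).subset fun n hn => by simp only [Set.mem_ofPred_eq, Set.mem_Iic] at *; omega

theorem hasSum_appellZ :
    HasSum (fun i : ℕ => C (appellCoeff i) * (expZ (2 * i + 1) - expZ (-(2 * i + 1)))) appellZ :=
  (summable_of_C_X_pow_dvd add_two_finite fun i => C_X_pow_dvd (X_pow_dvd_appellCoeff i) _).hasSum

/-- The coefficients of the bilateral expansion of `appellZ` under the heat operator. -/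
noncomputable def heatCoeff (i : ℤ) : ℚ⟦X⟧ := lambert i - if 0 ≤ i then quadFactor i else 0

theorem heatCoeff_natCast (i : ℕ) : heatCoeff i = lambertNat i - quadFactor i := by
  rw [heatCoeff, if_pos (Int.natCast_nonneg i), lambert_natCast]

theorem heatCoeff_neg (i : ℕ) : heatCoeff (-(i + 1 : ℤ)) = -(lambertNat i - quadFactor i) := by
  rw [heatCoeff, if_neg (by omega), show (-(i + 1 : ℤ)) = Int.negSucc i from rfl, lambert]
  ring

theorem X_pow_dvd_lambertNat_sub (i : ℕ) : X ^ (i + 2) ∣ lambertNat i - quadFactor i := by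
  rw [← appellCoeff_eq]
  exact dvd_add ((X_pow_dvd_qD (X_pow_dvd_appellCoeff i)).mul_left _)
    ((X_pow_dvd_appellCoeff i).mul_left _)

theorem X_pow_dvd_heatCoeff (i : ℤ) : X ^ (i.natAbs + 1) ∣ heatCoeff i := by
  rcases lt_or_ge i 0 with h | h
  · obtain ⟨j, rfl⟩ : ∃ j : ℕ, i = -(j + 1 : ℤ) := ⟨(-i - 1).toNat, by omega⟩
    rw [heatCoeff_neg, dvd_neg, show (-(j + 1 : ℤ)).natAbs + 1 = j + 2 by omega]
    exact X_pow_dvd_lambertNat_sub j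
  · obtain ⟨j, rfl⟩ := Int.eq_ofNat_of_zero_le h
    rw [heatCoeff_natCast, Int.natAbs_natCast]
    exact (pow_dvd_pow X (by omega)).trans (X_pow_dvd_lambertNat_sub j)

theorem natAbs_finite (c N : ℕ) : {i : ℤ | i.natAbs - c ≤ N}.Finite :=
  (Set.finite_Icc (-(N + c : ℤ)) (N + c)).subset fun i hi => by
    simp only [Set.mem_ofPred_eq, Set.mem_Icc] at *; omega

/-- The image of `appellZ` under the heat operator, divided by `z²`. -/
noncomputable def heatZ : ℚ⟦X⟧⟦X⟧ := ∑' i : ℤ, C (heatCoeff i) * expZ (2 * i + 1)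

theorem hasSum_heatZ : HasSum (fun i : ℤ => C (heatCoeff i) * expZ (2 * i + 1)) heatZ :=
  (summable_of_C_X_pow_dvd (natAbs_finite 0) fun i =>
    C_X_pow_dvd ((pow_dvd_pow X (by omega)).trans (X_pow_dvd_heatCoeff i)) _).hasSum

theorem heat_appellZ : X ^ 2 * (24 * qDz appellZ - C (eisP ℚ) * appellZ)
    + (qD _ (qD _ appellZ) - qD _ appellZ) = X ^ 2 * heatZ := by
  have h1 := hasSum_appellZ
  have h2 := (((hasSum_qDz h1).mul_left 24).sub (h1.mul_left (C (eisP ℚ)))).mul_left (X ^ 2)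
  have h3 := h2.add ((hasSum_qD (hasSum_qD h1)).sub (hasSum_qD h1))
  have h4 := hasSum_heatZ.mul_left (X ^ 2)
  have h5 : HasSum (fun i : ℕ => X ^ 2 * (C (lambertNat i - quadFactor i)
      * (expZ (2 * i + 1) - expZ (-(2 * i + 1))))) (X ^ 2 * heatZ) := by
    refine h4.nat_add_neg_add_one.congr_fun fun i => ?_
    rw [heatCoeff_natCast, heatCoeff_neg, show 2 * (-(i + 1 : ℤ)) + 1 = -(2 * i + 1) by ring,
      map_neg]
    ring
  refine h3.unique (h5.congr_fun fun i => ?_)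
  have hX : qD ℚ⟦X⟧ (X : ℚ⟦X⟧⟦X⟧) = X := by simpa using qD_X_pow (R := ℚ⟦X⟧) 1
  have hn : ∀ n : ℤ, qD ℚ⟦X⟧ (n : ℚ⟦X⟧⟦X⟧) = 0 := fun n => by simp
  have h6 : ∀ n : ℤ, qD ℚ⟦X⟧ (qD ℚ⟦X⟧ (expZ n)) - qD ℚ⟦X⟧ (expZ n)
      = (n : ℚ⟦X⟧⟦X⟧) ^ 2 * X ^ 2 * expZ n := fun n => by
    simp only [zD_expZ, Derivation.leibniz, hX, hn, smul_eq_mul]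
    ring
  have h7 := h6 (2 * i + 1)
  have h8 := h6 (-(2 * i + 1))
  rw [← appellCoeff_eq]
  simp only [Derivation.leibniz, map_sub, qDz_expZ, qDz_C, qD_C, smul_eq_mul, map_add,
    map_mul, quadFactor, map_pow, map_one, map_ofNat, map_intCast, mul_zero, sub_zero, zero_add,
    add_zero]
  push_cast at h7 h8 ⊢
  linear_combination C (appellCoeff i) * (h7 - h8)

end Appell

/-! ### The heat equation with theta cube source -/

section HeatEquation

/-- The series `e^z - e^{-z}`. -/
noncomputable def sinhZ : ℚ⟦X⟧⟦X⟧ := expZ 1 - expZ (-1)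

theorem sinhZ_cube : sinhZ ^ 3 = expZ 3 - 3 * expZ 1 + 3 * expZ (-1) - expZ (-3) := by
  have h1 : expZ 1 * expZ (-1) = 1 := by rw [← expZ_add, ← expZ_zero]; rfl
  have h3 : expZ 3 = expZ 1 * (expZ 1 * expZ 1) := by rw [← expZ_add, ← expZ_add]; rfl
  have h4 : expZ (-3) = expZ (-1) * (expZ (-1) * expZ (-1)) := by
    rw [← expZ_add, ← expZ_add]; rfl
  rw [h3, h4, sinhZ]
  linear_combination (-3 * expZ 1 + 3 * expZ (-1)) * h1

theorem sinhZ_sq : sinhZ ^ 2 = expZ 2 - 2 + expZ (-2) := by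
  have h1 : expZ 1 * expZ (-1) = 1 := by rw [← expZ_add, ← expZ_zero]; rfl
  have h3 : expZ 2 = expZ 1 * expZ 1 := by rw [← expZ_add]; rfl
  have h4 : expZ (-2) = expZ (-1) * expZ (-1) := by rw [← expZ_add]; rfl
  rw [h3, h4, sinhZ]
  linear_combination (-2) * h1

/-- The third difference of a bilateral sequence. -/
noncomputable def thirdDiff (f : ℤ → ℚ⟦X⟧) (h : ℤ) : ℚ⟦X⟧ := f (h - 2) - 3 * f (h - 1) + 3 * f h - f (h + 1)

/-- The restriction of `quadFactor` to nonnegative indices. -/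
noncomputable def quadStep (i : ℤ) : ℚ⟦X⟧ := if 0 ≤ i then quadFactor i else 0

theorem hasSum_quadStep : HasSum (fun h : ℤ => C (thirdDiff quadStep h) * expZ (2 * h))
    ((C (eisP ℚ) - 1) * sinhZ ^ 2 - 8) := by
  have h : ∀ h ∉ ({-1, 0, 1} : Finset ℤ), C (thirdDiff quadStep h) * expZ (2 * h) = 0 := by
    intro h hh
    simp only [mem_insert, mem_singleton, not_or] at hh
    have : thirdDiff quadStep h = 0 := by
      rw [thirdDiff, quadStep, quadStep, quadStep, quadStep]
      rcases lt_or_ge h (-1) with h1 | h1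
      · rw [if_neg (by omega), if_neg (by omega), if_neg (by omega), if_neg (by omega)]; ring
      · rw [if_pos (by omega), if_pos (by omega), if_pos (by omega), if_pos (by omega)]
        simp only [quadFactor]
        push_cast
        ring
    rw [this, map_zero, zero_mul]
  have h2 := hasSum_sum_of_ne_finset_zero (L := .unconditional ℤ) h
  rw [sum_insert (by decide), sum_insert (by decide), sum_singleton] at h2
  refine cast ?_ h2
  congr 1
  rw [sinhZ_sq]
  simp [thirdDiff, quadStep, quadFactor, expZ_zero, map_ofNat]
  ring

theorem hasSum_heatCoeff_shift (c : ℤ) :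
    HasSum (fun h : ℤ => C (heatCoeff (h - c)) * expZ (2 * h)) (heatZ * expZ (2 * c - 1)) := by
  refine ((Equiv.hasSum_iff (Equiv.subRight c)).mpr
    (hasSum_heatZ.mul_right (expZ (2 * c - 1)))).congr_fun fun h => ?_
  rw [Function.comp_apply, Equiv.subRight_apply, mul_assoc, ← expZ_add]
  congr 2
  ring

theorem hasSum_thirdDiff_lambert : HasSum (fun h : ℤ => C (thirdDiff lambert h) * expZ (2 * h))
    ((C (eisP ℚ) - 1) * sinhZ ^ 2 - 8 + sinhZ ^ 3 * heatZ) := by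
  have h1 := (((hasSum_heatCoeff_shift 2).sub ((hasSum_heatCoeff_shift 1).mul_left 3)).add
    ((hasSum_heatCoeff_shift 0).mul_left 3)).sub (hasSum_heatCoeff_shift (-1))
  have h2 := hasSum_quadStep.add h1
  have h3 : heatZ * expZ (2 * 2 - 1) - 3 * (heatZ * expZ (2 * 1 - 1))
      + 3 * (heatZ * expZ (2 * 0 - 1)) - heatZ * expZ (2 * -1 - 1) = sinhZ ^ 3 * heatZ := by
    rw [sinhZ_cube]
    norm_num
    ring
  rw [h3] at h2
  refine h2.congr_fun fun h => ?_
  have hl : ∀ i, lambert i = quadStep i + heatCoeff i := fun i => by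
    rw [heatCoeff, quadStep]; ring
  simp only [thirdDiff, hl, map_add, map_sub, map_mul, map_ofNat, sub_zero, sub_neg_eq_add]
  ring

theorem X_pow_dvd_thirdDiff_lambert (h : ℤ) : X ^ (h.natAbs - 1) ∣ thirdDiff lambert h := by
  rcases le_or_gt h.natAbs 1 with h1 | h1
  · rw [Nat.sub_eq_zero_of_le h1, pow_zero]
    exact one_dvd _
  · have hl : ∀ i, lambert i = quadStep i + heatCoeff i := fun i => by
      rw [heatCoeff, quadStep]; ring
    have h0 : thirdDiff quadStep h = 0 := by
      rw [thirdDiff, quadStep, quadStep, quadStep, quadStep]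
      rcases lt_or_ge h (-1) with h1 | h1
      · rw [if_neg (by omega), if_neg (by omega), if_neg (by omega), if_neg (by omega)]; ring
      · rw [if_pos (by omega), if_pos (by omega), if_pos (by omega), if_pos (by omega)]
        simp only [quadFactor]
        push_cast
        ring
    have : thirdDiff lambert h = thirdDiff heatCoeff h := by
      rw [← sub_eq_zero, ← h0]
      simp only [thirdDiff, hl]
      ring
    rw [this, thirdDiff]
    have key : ∀ i : ℤ, h.natAbs - 1 ≤ i.natAbs + 1 → X ^ (h.natAbs - 1) ∣ heatCoeff i :=
      fun i hi => (pow_dvd_pow X hi).trans (X_pow_dvd_heatCoeff i)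
    exact dvd_sub (dvd_add (dvd_sub (key _ (by omega)) ((key _ (by omega)).mul_left _))
      ((key _ (by omega)).mul_left _)) (key _ (by omega))

theorem hasSum_cubeCoeff_mul_thirdDiff (t : ℤ) :
    HasSum (fun n => cubeCoeff n * thirdDiff lambert (t - total n)) (thirdDiff cubeLambert t) := by
  refine ((((hasSum_cubeLambert (t - 2)).sub ((hasSum_cubeLambert (t - 1)).mul_left 3)).add
    ((hasSum_cubeLambert t).mul_left 3)).sub (hasSum_cubeLambert (t + 1))).congr_fun fun n => ?_
  rw [thirdDiff, show t - total n - 2 = t - 2 - total n by ring,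
    show t - total n - 1 = t - 1 - total n by ring, show t - total n + 1 = t + 1 - total n by ring]
  ring

/-- The shear `(t, n) ↦ (n, t - total n)`. -/
def shear : ℤ × (ℤ × ℤ × ℤ) ≃ (ℤ × ℤ × ℤ) × ℤ where
  toFun x := (x.2, x.1 - total x.2)
  invFun y := (y.2 + total y.1, y.1)
  left_inv x := by simp
  right_inv y := by simp

theorem thetaZ_cube_mul : thetaZ ^ 3 * ((C (eisP ℚ) - 1) * sinhZ ^ 2 - 8 + sinhZ ^ 3 * heatZ)
    = C (cubeLambert (-2)) * sinhZ ^ 3 := by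
  have h1 := hasSum_mul_of_C_X_pow_dvd hasSum_thetaZ_cube hasSum_thirdDiff_lambert cubeExp_finite
    (fun n => C_X_pow_dvd (X_pow_dvd_cubeCoeff n) _) (natAbs_finite 1)
    (fun h => C_X_pow_dvd (X_pow_dvd_thirdDiff_lambert h) _)
  have h2 := (Equiv.hasSum_iff shear).mpr h1
  have h3 : ∀ t : ℤ, HasSum (fun n => ((fun x : (ℤ × ℤ × ℤ) × ℤ =>
      C (cubeCoeff x.1) * expZ (2 * total x.1 + 3) * (C (thirdDiff lambert x.2) * expZ (2 * x.2)))
        ∘ shear) (t, n)) (C (thirdDiff cubeLambert t) * expZ (2 * t + 3)) := by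
    intro t
    refine ((hasSum_C (hasSum_cubeCoeff_mul_thirdDiff t)).mul_right _).congr_fun fun n => ?_
    rw [Function.comp_apply, shear, Equiv.coe_fn_mk]
    dsimp only
    rw [show 2 * t + 3 = (2 * total n + 3) + 2 * (t - total n) by ring, expZ_add (2 * total n + 3), map_mul]
    ring
  have h4 := h2.prod_fiberwise h3
  have h5 : ∀ t ∉ ({0, -1, -2, -3} : Finset ℤ),
      C (thirdDiff cubeLambert t) * expZ (2 * t + 3) = 0 := by
    intro t ht
    simp only [mem_insert, mem_singleton, not_or] at ht
    rw [thirdDiff, cubeLambert_eq_zero (by omega), cubeLambert_eq_zero (by omega),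
      cubeLambert_eq_zero (by omega), cubeLambert_eq_zero (by omega)]
    simp
  have h6 := h4.unique (hasSum_sum_of_ne_finset_zero h5)
  rw [sum_insert (by decide), sum_insert (by decide), sum_insert (by decide), sum_singleton] at h6
  rw [h6, sinhZ_cube]
  have z : ∀ t : ℤ, t ≠ -2 → cubeLambert t = 0 := fun t => cubeLambert_eq_zero
  simp [thirdDiff, z, map_ofNat]
  ring

end HeatEquation

/-! ### Normalised forms of the heat equations -/

section Normalised

theorem qD_mul {R : Type*} [CommRing R] (f g : R⟦X⟧) :
    qD R (f * g) = f * qD R g + g * qD R f :=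
  (qD R).leibniz f g

theorem qD_one {R : Type*} [CommRing R] : qD R (1 : R⟦X⟧) = 0 := (qD R).map_one_eq_zero

theorem qDz_mul (f g : ℚ⟦X⟧⟦X⟧) : qDz (f * g) = f * qDz g + g * qDz f := qDz.leibniz f g

theorem zD_X : qD ℚ⟦X⟧ (X : ℚ⟦X⟧⟦X⟧) = X := by simpa using qD_X_pow (R := ℚ⟦X⟧) 1

instance charZero_powerSeries {R : Type*} [CommRing R] [CharZero R] : CharZero R⟦X⟧ :=
  charZero_of_injective_ringHom (C_injective (R := R))

/-- The hyperbolic sine divided by `z`. -/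
noncomputable def sinhcZ : ℚ⟦X⟧⟦X⟧ :=
  PowerSeries.mk fun k => if Even k then C (1 / (k + 1).factorial : ℚ) else 0

theorem sinhZ_eq : sinhZ = 2 * (X * sinhcZ) := by
  ext1 k
  rw [sinhZ, map_sub, coeff_expZ, coeff_expZ, ← map_ofNat (C (R := ℚ⟦X⟧)) 2, coeff_C_mul]
  rcases k with _ | k
  · simp
  · rw [coeff_succ_X_mul, sinhcZ, coeff_mk]
    rcases Nat.even_or_odd k with h | h
    · rw [if_pos h]
      push_cast
      rw [h.add_one.neg_one_pow]
      ring
    · rw [if_neg (Nat.not_even_iff_odd.mpr h)]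
      push_cast
      rw [h.add_one.neg_one_pow]
      ring

theorem X_ne_zero' : (2 : ℚ⟦X⟧⟦X⟧) * X ≠ 0 := mul_ne_zero two_ne_zero X_ne_zero

theorem zD_sinhZ : qD ℚ⟦X⟧ sinhZ = X * (expZ 1 + expZ (-1)) := by
  rw [sinhZ, map_sub, zD_expZ, zD_expZ]
  push_cast
  ring

theorem zD_zD_sinhZ : qD ℚ⟦X⟧ (qD ℚ⟦X⟧ sinhZ) - qD ℚ⟦X⟧ sinhZ = X ^ 2 * sinhZ := by
  rw [zD_sinhZ, qD_mul, map_add, zD_expZ, zD_expZ, zD_X, sinhZ]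
  push_cast
  ring

theorem zD_sinhZ_sq : (qD ℚ⟦X⟧ sinhZ) ^ 2 = X ^ 2 * (sinhZ ^ 2 + 4) := by
  have h1 : expZ 1 * expZ (-1) = 1 := by rw [← expZ_add, ← expZ_zero]; rfl
  rw [zD_sinhZ, sinhZ]
  linear_combination 4 * X ^ 2 * h1

theorem zD_two : qD ℚ⟦X⟧ (2 : ℚ⟦X⟧⟦X⟧) = 0 := by
  rw [← map_ofNat (C (R := ℚ⟦X⟧)) 2]
  exact qD_C _

theorem zD_sinhZ' : qD ℚ⟦X⟧ sinhZ = 2 * X * (sinhcZ + qD ℚ⟦X⟧ sinhcZ) := by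
  rw [sinhZ_eq, qD_mul, qD_mul, zD_two, zD_X]
  ring

theorem zD_zD_sinhcZ : qD ℚ⟦X⟧ (qD ℚ⟦X⟧ sinhcZ) + qD ℚ⟦X⟧ sinhcZ = X ^ 2 * sinhcZ := by
  refine mul_left_cancel₀ X_ne_zero' ?_
  have h := zD_zD_sinhZ
  rw [zD_sinhZ', qD_mul, qD_mul, zD_two, zD_X, map_add, sinhZ_eq] at h
  linear_combination h

theorem sinhcZ_add_zD_sq : (sinhcZ + qD ℚ⟦X⟧ sinhcZ) ^ 2 = X ^ 2 * sinhcZ ^ 2 + 1 := by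
  refine mul_left_cancel₀ (pow_ne_zero 2 X_ne_zero') ?_
  have h := zD_sinhZ_sq
  rw [zD_sinhZ', sinhZ_eq] at h
  linear_combination h

theorem constantCoeff_sinhcZ : constantCoeff sinhcZ = 1 := by
  rw [← coeff_zero_eq_constantCoeff_apply, sinhcZ, coeff_mk]
  simp

/-- The series `z / sinh z`. -/
noncomputable def cschZ : ℚ⟦X⟧⟦X⟧ := invOfUnit sinhcZ 1

theorem sinhcZ_mul_cschZ : sinhcZ * cschZ = 1 :=
  mul_invOfUnit _ _ (by rw [constantCoeff_sinhcZ]; rfl)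

theorem qDz_sinhcZ : qDz sinhcZ = 0 := by
  ext1 k
  rw [coeff_qDz, sinhcZ, coeff_mk, map_zero]
  split_ifs
  · rw [qD_C]
  · rw [map_zero]

theorem qDz_cschZ : qDz cschZ = 0 := by
  have h := congrArg qDz sinhcZ_mul_cschZ
  rw [qDz_mul, qDz_sinhcZ, Derivation.map_one_eq_zero] at h
  linear_combination cschZ * h - qDz cschZ * sinhcZ_mul_cschZ

theorem zD_cschZ : qD ℚ⟦X⟧ cschZ = -(cschZ ^ 2 * qD ℚ⟦X⟧ sinhcZ) := by
  have h := congrArg (qD ℚ⟦X⟧) sinhcZ_mul_cschZ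
  rw [qD_mul, qD_one] at h
  linear_combination cschZ * h - qD ℚ⟦X⟧ cschZ * sinhcZ_mul_cschZ

/-- The second order operator `z²(24D - P) + (ϑ - 1)(ϑ - 2)`. -/
noncomputable def heatOp (f : ℚ⟦X⟧⟦X⟧) : ℚ⟦X⟧⟦X⟧ :=
  X ^ 2 * (24 * qDz f - C (eisP ℚ) * f) + (qD ℚ⟦X⟧ (qD ℚ⟦X⟧ f) - 3 * qD ℚ⟦X⟧ f + 2 * f)

theorem heatOp_add (f g : ℚ⟦X⟧⟦X⟧) : heatOp (f + g) = heatOp f + heatOp g := by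
  simp only [heatOp, map_add]; ring

theorem heatOp_C_mul (c : ℚ) (f : ℚ⟦X⟧⟦X⟧) : heatOp (C (C c) * f) = C (C c) * heatOp f := by
  simp only [heatOp, qDz_mul, qD_mul, qDz_C, qD_C, map_zero, add_zero,
    mul_zero]
  ring

theorem heatOp_X_mul_appellZ : heatOp (X * appellZ) = X ^ 3 * heatZ := by
  have h := heat_appellZ
  simp only [heatOp, qDz_mul, qD_mul, zD_X, qDz_X, map_add]
  linear_combination X * h

theorem heatOp_cschZ :
    4 * sinhcZ ^ 3 * heatOp cschZ = 8 - (C (eisP ℚ) - 1) * sinhZ ^ 2 := by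
  have h1 := zD_zD_sinhcZ
  have h2 := sinhcZ_add_zD_sq
  have h3 := sinhcZ_mul_cschZ
  have h4 : qD ℚ⟦X⟧ (qD ℚ⟦X⟧ cschZ) = 2 * cschZ ^ 3 * (qD ℚ⟦X⟧ sinhcZ) ^ 2
      - cschZ ^ 2 * (X ^ 2 * sinhcZ - qD ℚ⟦X⟧ sinhcZ) := by
    rw [congrArg (qD ℚ⟦X⟧) zD_cschZ, map_neg, qD_mul, pow_two cschZ,
      qD_mul, zD_cschZ]
    linear_combination (-cschZ ^ 2) * h1
  rw [heatOp, h4, zD_cschZ, qDz_cschZ, sinhZ_eq]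
  generalize qD ℚ⟦X⟧ sinhcZ = c' at *
  generalize sinhcZ = c at *
  generalize cschZ = w at *
  have e1 : c ^ 3 * w = c ^ 2 := by linear_combination c ^ 2 * h3
  have e2 : c ^ 3 * w ^ 2 = c := by linear_combination (c ^ 2 * w + c) * h3
  have e3 : c ^ 3 * w ^ 3 = 1 := by linear_combination (c ^ 2 * w ^ 2 + c * w + 1) * h3
  linear_combination 4 * (-X ^ 2 * C (eisP ℚ) + 2) * e1 + 4 * (- (X ^ 2 * c - c') + 3 * c') * e2
    + 8 * c' ^ 2 * e3 + 8 * h2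

/-- The normalised combination of the Appell–Lerch sum and `z / sinh z`. -/
noncomputable def upsilon : ℚ⟦X⟧⟦X⟧ := C (C (-1 / 2 : ℚ)) * cschZ + X * appellZ

theorem heatOp_upsilon : 8 * sinhcZ ^ 3 * heatOp upsilon
    = (C (eisP ℚ) - 1) * sinhZ ^ 2 - 8 + sinhZ ^ 3 * heatZ := by
  have h : (2 : ℚ⟦X⟧⟦X⟧) * C (C (-1 / 2 : ℚ)) = -1 := by
    have h2 : (2 : ℚ⟦X⟧⟦X⟧) = C (C (2 : ℚ)) := by rw [map_ofNat, map_ofNat]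
    rw [h2, ← map_mul, ← map_mul]
    norm_num
  rw [upsilon, heatOp_add, heatOp_C_mul, heatOp_X_mul_appellZ, sinhZ_eq]
  have h2 := heatOp_cschZ
  rw [sinhZ_eq] at h2
  linear_combination 4 * sinhcZ ^ 3 * heatOp cschZ * h - h2

theorem coeff_appellZ_zero : coeff 0 appellZ = 0 := by
  refine ((hasSum_iff_hasSum_coeff _).mp hasSum_appellZ 0).unique ?_
  convert hasSum_zero using 2 with i
  rw [coeff_C_mul, map_sub, coeff_expZ, coeff_expZ]
  simp

theorem coeff_cschZ_zero : coeff 0 cschZ = 1 := by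
  have h := congrArg constantCoeff sinhcZ_mul_cschZ
  rw [map_mul, constantCoeff_sinhcZ, one_mul, map_one] at h
  rw [coeff_zero_eq_constantCoeff_apply, h]

theorem coeff_upsilon_zero : coeff 0 upsilon = C (-1 / 2 : ℚ) := by
  rw [upsilon, map_add, coeff_C_mul, coeff_cschZ_zero]
  simp

theorem coeff_cschZ_one : coeff 1 cschZ = 0 := by
  have h := congrArg (coeff 1) sinhcZ_mul_cschZ
  rw [coeff_mul, Finset.Nat.sum_antidiagonal_eq_sum_range_succ_mk, sum_range_succ, sum_range_one]
    at h
  simpa [sinhcZ, coeff_one] using h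

theorem coeff_upsilon_one : coeff 1 upsilon = 0 := by
  rw [upsilon, map_add, coeff_C_mul, coeff_cschZ_one, ← zero_add 1, coeff_succ_X_mul,
    coeff_appellZ_zero]
  simp

theorem coeff_heatOp_zero (f : ℚ⟦X⟧⟦X⟧) : coeff 0 (heatOp f) = 2 * coeff 0 f := by
  rw [heatOp, map_add, coeff_X_pow_mul', if_neg (by norm_num), ← map_ofNat (C (R := ℚ⟦X⟧)) 3,
    ← map_ofNat (C (R := ℚ⟦X⟧)) 2, map_add, map_sub, coeff_C_mul, coeff_C_mul, coeff_qD, coeff_qD]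
  simp

theorem coeff_heatOp_one (f : ℚ⟦X⟧⟦X⟧) : coeff 1 (heatOp f) = 0 := by
  rw [heatOp, map_add, coeff_X_pow_mul', if_neg (by norm_num), ← map_ofNat (C (R := ℚ⟦X⟧)) 3,
    ← map_ofNat (C (R := ℚ⟦X⟧)) 2, map_add, map_sub, coeff_C_mul, coeff_C_mul, coeff_qD, coeff_qD]
  push_cast
  ring

theorem coeff_heatOp_add_two (f : ℚ⟦X⟧⟦X⟧) (k : ℕ) : coeff (k + 2) (heatOp f)
    = 24 * qD ℚ (coeff k f) - eisP ℚ * coeff k f + (k + 1) * k * coeff (k + 2) f := by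
  rw [heatOp, map_add, coeff_X_pow_mul, ← map_ofNat (C (R := ℚ⟦X⟧)) 3,
    ← map_ofNat (C (R := ℚ⟦X⟧)) 2, ← map_ofNat (C (R := ℚ⟦X⟧)) 24, map_add, map_sub, map_sub,
    coeff_C_mul, coeff_C_mul, coeff_C_mul, coeff_C_mul, coeff_qD, coeff_qD, coeff_qDz]
  push_cast
  ring

theorem constantCoeff_moment_one : constantCoeff (moment 1) = 2 := by
  rw [← coeff_zero_eq_constantCoeff_apply, coeff_hasSum_eq_sum (hasSum_moment 1) 0 {0, -1}]
  · rw [sum_pair (by decide)]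
    simp [thetaCoeff, tri, map_ofNat]
  · intro n hn
    simp only [mem_insert, mem_singleton, not_or] at hn
    refine X_pow_dvd_iff.mp (X_pow_tri_dvd 1 n) 0 ?_
    have h := two_mul_tri n
    by_contra h0
    have h0 : tri n = 0 := by omega
    rw [h0] at h
    rcases mul_eq_zero.mp h.symm with h | h <;> omega

theorem moment_one_mul_inv : moment 1 * (moment 1)⁻¹ = 1 :=
  PowerSeries.mul_inv_cancel _ (by rw [constantCoeff_moment_one]; norm_num)

theorem moment_one_ne_zero : moment 1 ≠ 0 := left_ne_zero_of_mul_eq_one moment_one_mul_inv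

/-- The theta function divided by its leading term. -/
noncomputable def sigmaZ : ℚ⟦X⟧⟦X⟧ :=
  PowerSeries.mk fun k => moment (k + 1) * (moment 1)⁻¹ * C (1 / (k + 1).factorial : ℚ)

theorem thetaZ_eq : thetaZ = C (moment 1) * (X * sigmaZ) := by
  ext1 k
  rw [coeff_thetaZ, coeff_C_mul]
  rcases k with _ | k
  · simp [moment_even]
  · rw [coeff_succ_X_mul, sigmaZ, coeff_mk]
    linear_combination (-(moment (k + 1) * C (1 / (k + 1).factorial : ℚ))) * moment_one_mul_inv

theorem coeff_sigmaZ_zero : coeff 0 sigmaZ = 1 := by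
  rw [sigmaZ, coeff_mk]
  simp [moment_one_mul_inv]

theorem sigmaZ_cube_mul_heatOp_upsilon : sigmaZ ^ 3 * heatOp upsilon = -1 := by
  have h := thetaZ_cube_mul
  rw [← heatOp_upsilon, thetaZ_eq, sinhZ_eq] at h
  have h1 : C (moment 1) ^ 3 * sigmaZ ^ 3 * heatOp upsilon = C (cubeLambert (-2)) := by
    have h8 : (8 : ℚ⟦X⟧⟦X⟧) * X ^ 3 ≠ 0 := mul_ne_zero (OfNat.ofNat_ne_zero 8) (pow_ne_zero 3 X_ne_zero)
    refine mul_left_cancel₀ h8 ?_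
    have e3 : sinhcZ ^ 3 * cschZ ^ 3 = 1 := by rw [← mul_pow, sinhcZ_mul_cschZ, one_pow]
    linear_combination cschZ ^ 3 * h + 8 * X ^ 3 * (C (cubeLambert (-2))
      - C (moment 1) ^ 3 * sigmaZ ^ 3 * heatOp upsilon) * e3
  have h2 := congrArg constantCoeff h1
  rw [map_mul, map_mul, map_pow, map_pow, constantCoeff_C, constantCoeff_C,
    ← coeff_zero_eq_constantCoeff_apply, coeff_sigmaZ_zero, ← coeff_zero_eq_constantCoeff_apply,
    coeff_heatOp_zero, coeff_upsilon_zero] at h2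
  have h3 : (2 : ℚ⟦X⟧) * C (-1 / 2 : ℚ) = -1 := by
    rw [← map_ofNat C 2, ← map_mul]
    norm_num
  rw [h3] at h2
  have h4 : C (moment 1) * C ((moment 1)⁻¹) = (1 : ℚ⟦X⟧⟦X⟧) := by
    rw [← map_mul, moment_one_mul_inv, map_one]
  have h5 : C (moment 1) ^ 3 * C ((moment 1)⁻¹) ^ 3 = (1 : ℚ⟦X⟧⟦X⟧) := by
    rw [← mul_pow, h4, one_pow]
  rw [← h2] at h1
  simp only [map_mul, map_neg, map_pow, map_one] at h1
  linear_combination C ((moment 1)⁻¹) ^ 3 * h1 - (sigmaZ ^ 3 * heatOp upsilon + 1) * h5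

theorem coeff_sigmaZ_one : coeff 1 sigmaZ = 0 := by
  rw [sigmaZ, coeff_mk, moment_even (by decide)]
  simp

theorem moment_three : moment 3 = eisP ℚ * moment 1 := by
  have h := congrArg (coeff 2) sigmaZ_cube_mul_heatOp_upsilon
  have h0 : coeff 2 (heatOp upsilon) = C (1 / 2 : ℚ) * eisP ℚ := by
    have := coeff_heatOp_add_two upsilon 0
    rw [coeff_upsilon_zero, qD_C] at this
    rw [this, show (-1 / 2 : ℚ) = - (1 / 2) by norm_num, map_neg]
    push_cast
    ring
  have h00 : coeff 0 (heatOp upsilon) = -1 := by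
    rw [coeff_heatOp_zero, coeff_upsilon_zero, ← map_ofNat C 2, ← map_mul]
    norm_num
  have h2 : coeff 2 sigmaZ = moment 3 * (moment 1)⁻¹ * C (1 / 6 : ℚ) := by
    rw [sigmaZ, coeff_mk]; rfl
  simp only [pow_succ, pow_zero, one_mul, coeff_mul, Finset.Nat.sum_antidiagonal_eq_sum_range_succ_mk,
    sum_range_succ, sum_range_zero, zero_add, coeff_sigmaZ_zero, coeff_sigmaZ_one, h2, h0, h00,
    map_neg, coeff_one] at h
  norm_num [coeff_sigmaZ_zero, coeff_sigmaZ_one, h2, coeff_one] at h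
  have h6 : C (1 / 2 : ℚ) = 3 * C (1 / 6 : ℚ) := by
    rw [← map_ofNat C 3, ← map_mul]; norm_num
  have h7 : 6 * C (1 / 6 : ℚ) = 1 := by
    rw [← map_ofNat C 6, ← map_mul]; norm_num
  have h8 : moment 3 * (moment 1)⁻¹ = eisP ℚ := by
    linear_combination (-2) * h + 2 * eisP ℚ * h6 + (eisP ℚ - moment 3 * (moment 1)⁻¹) * h7
  linear_combination moment 1 * h8 - moment 3 * moment_one_mul_inv

theorem heat_sigmaZ : X ^ 2 * (8 * qDz sigmaZ + C (eisP ℚ) * sigmaZ)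
    = qD ℚ⟦X⟧ (qD ℚ⟦X⟧ sigmaZ) + qD ℚ⟦X⟧ sigmaZ := by
  have h : X ^ 2 * (8 * qDz thetaZ + thetaZ) = qD ℚ⟦X⟧ (qD ℚ⟦X⟧ thetaZ) - qD ℚ⟦X⟧ thetaZ := by
    ext1 k
    rw [coeff_X_pow_mul', map_sub, coeff_qD, coeff_qD]
    rcases k with _ | _ | k
    · simp
    · simp
    · rw [if_pos (by omega), show k + 1 + 1 - 2 = k from rfl, ← map_ofNat (C (R := ℚ⟦X⟧)) 8, map_add,
        coeff_C_mul, coeff_qDz, coeff_thetaZ, coeff_thetaZ, moment_add_two, qD_mul,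
        qD_C]
      have : C (1 / (k.factorial : ℚ))
          = ((k + 2 : ℕ) : ℚ⟦X⟧) * ((k + 1 : ℕ) : ℚ⟦X⟧) * C (1 / ((k + 2).factorial : ℚ)) := by
        rw [← map_natCast (C (R := ℚ)), ← map_natCast (C (R := ℚ)), ← map_mul, ← map_mul,
          Nat.factorial_succ, Nat.factorial_succ]
        congr 1
        push_cast
        field_simp
        ring
      rw [this]
      push_cast
      ring
  have hm : 8 * C (qD ℚ (moment 1)) = (C (eisP ℚ) - 1) * C (moment 1) := by
    have := moment_add_two 1
    rw [show 1 + 2 = 3 from rfl, moment_three] at this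
    rw [← map_ofNat C 8, ← map_one C, ← map_mul, ← map_sub, ← map_mul]
    congr 1
    linear_combination -this
  have hJ : C (moment 1) * X ≠ (0 : ℚ⟦X⟧⟦X⟧) :=
    mul_ne_zero ((map_ne_zero_iff C C_injective).mpr moment_one_ne_zero) X_ne_zero
  refine mul_left_cancel₀ hJ ?_
  rw [thetaZ_eq] at h
  simp only [qD_mul, qDz_mul, qDz_C, qDz_X, qD_C, zD_X, map_add, mul_zero,
    add_zero] at h
  linear_combination h - X ^ 3 * sigmaZ * hm

end Normalised

/-! ### The Chazy equation -/

section Chazy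

theorem two_tri_finite (N : ℕ) : {n : ℤ | 2 * tri n ≤ N}.Finite :=
  (tri_finite N).subset fun n hn => by
    simp only [Set.mem_ofPred_eq] at hn ⊢
    omega

theorem sq_finite (N : ℕ) : {n : ℤ | n.natAbs ^ 2 ≤ N}.Finite := by
  refine (Set.finite_Icc (-(N : ℤ)) N).subset fun n hn => ?_
  have h : n.natAbs ^ 2 ≤ N := hn
  have : n.natAbs ≤ N := by nlinarith
  simp only [Set.mem_Icc]
  omega

/-- The moments of the even theta series supported on odd squares. -/
noncomputable def oddSqMoment (j : ℕ) : ℚ⟦X⟧ :=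
  ∑' i : ℤ, (2 * (i : ℚ⟦X⟧) + 1) ^ (2 * j) * X ^ (2 * tri i)

/-- The moments of the even theta series supported on even squares. -/
noncomputable def evenSqMoment (j : ℕ) : ℚ⟦X⟧ :=
  ∑' l : ℤ, (2 * (l : ℚ⟦X⟧)) ^ (2 * j) * X ^ (l.natAbs ^ 2)

theorem hasSum_oddSqMoment (j : ℕ) :
    HasSum (fun i : ℤ => (2 * (i : ℚ⟦X⟧) + 1) ^ (2 * j) * X ^ (2 * tri i)) (oddSqMoment j) :=
  (summable_of_X_pow_dvd two_tri_finite fun _ => dvd_mul_left _ _).hasSum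

theorem hasSum_evenSqMoment (j : ℕ) :
    HasSum (fun l : ℤ => (2 * (l : ℚ⟦X⟧)) ^ (2 * j) * X ^ (l.natAbs ^ 2)) (evenSqMoment j) :=
  (summable_of_X_pow_dvd sq_finite fun _ => dvd_mul_left _ _).hasSum

/-- The lattice `ℤ²` as the union of its two cosets of the sublattice `m + n` even. -/
def parityEquiv : (ℤ × ℤ) ⊕ (ℤ × ℤ) ≃ ℤ × ℤ where
  toFun := Sum.elim (fun x => (x.1 + x.2, x.1 - x.2)) fun x => (x.2 + x.1, x.2 - 1 - x.1)
  invFun y := if (y.1 + y.2) % 2 = 0 then Sum.inl ((y.1 + y.2) / 2, (y.1 - y.2) / 2)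
    else Sum.inr ((y.1 - y.2 - 1) / 2, (y.1 + y.2 + 1) / 2)
  left_inv := by
    rintro (⟨i, l⟩ | ⟨i, l⟩)
    · refine (if_pos (by simp only [Sum.elim_inl]; omega)).trans ?_
      simp only [Sum.elim_inl, Sum.inl.injEq, Prod.mk.injEq]
      omega
    · refine (if_neg (by simp only [Sum.elim_inr]; omega)).trans ?_
      simp only [Sum.elim_inr, Sum.inr.injEq, Prod.mk.injEq]
      omega
  right_inv := by
    rintro ⟨m, n⟩
    dsimp only
    split_ifs with h
    · simp only [Sum.elim_inl, Prod.mk.injEq]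
      omega
    · simp only [Sum.elim_inr, Prod.mk.injEq]
      omega

theorem thetaCoeff_mul_even (i l : ℤ) : thetaCoeff (i + l) * thetaCoeff (i - l)
    = X ^ (2 * tri i) * X ^ (l.natAbs ^ 2) := by
  have h : tri (i + l) + tri (i - l) = 2 * tri i + l.natAbs ^ 2 := by
    have h1 := two_mul_tri (i + l)
    have h2 := two_mul_tri (i - l)
    have h3 := two_mul_tri i
    zify
    rw [sq_abs]
    have h4 : 2 * ((tri (i + l) : ℤ) + tri (i - l)) = 2 * (2 * tri i + l ^ 2) := by
      linear_combination h1 + h2 - 2 * h3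
    omega
  have hs : ((Int.negOnePow (i + l) : ℤˣ) : ℚ⟦X⟧) * ((Int.negOnePow (i - l) : ℤˣ) : ℚ⟦X⟧) = 1 := by
    rw [← Int.cast_mul, ← Units.val_mul, ← Int.negOnePow_add,
      Int.negOnePow_even _ ⟨i, by ring⟩]
    simp
  rw [thetaCoeff, thetaCoeff, ← pow_add, ← h, pow_add]
  linear_combination X ^ tri (i + l) * X ^ tri (i - l) * hs

theorem thetaCoeff_mul_odd (i l : ℤ) : thetaCoeff (l + i) * thetaCoeff (l - 1 - i)
    = -(X ^ (2 * tri i) * X ^ (l.natAbs ^ 2)) := by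
  rw [show l - 1 - i = -1 - (i - l) by ring, thetaCoeff_neg, add_comm, ← thetaCoeff_mul_even]
  ring

theorem hasSum_thetaCoeff_mul (j k : ℕ) :
    HasSum (fun x : ℤ × ℤ => thetaCoeff x.1 * thetaCoeff x.2
      * (((x.1 : ℚ⟦X⟧) + x.2 + 1) ^ (2 * j) * ((x.1 : ℚ⟦X⟧) - x.2) ^ (2 * k)))
      (oddSqMoment j * evenSqMoment k - oddSqMoment k * evenSqMoment j) := by
  rw [← Equiv.hasSum_iff parityEquiv, sub_eq_add_neg]
  have H (j k : ℕ) := hasSum_mul_of_X_pow_dvd (hasSum_oddSqMoment j) (hasSum_evenSqMoment k)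
    two_tri_finite (fun _ => dvd_mul_left _ _) sq_finite (fun _ => dvd_mul_left _ _)
  refine HasSum.sum ((H j k).congr_fun fun x => ?_) ((H k j).neg.congr_fun fun x => ?_)
  · simp only [Function.comp_apply, parityEquiv, Equiv.coe_fn_mk, Sum.elim_inl]
    rw [thetaCoeff_mul_even]
    push_cast
    ring
  · simp only [Function.comp_apply, parityEquiv, Equiv.coe_fn_mk, Sum.elim_inr]
    rw [thetaCoeff_mul_odd]
    push_cast
    ring

theorem hasSum_thetaCoeff_mul_pow (i j : ℕ) :
    HasSum (fun x : ℤ × ℤ => thetaCoeff x.1 * thetaCoeff x.2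
      * ((2 * (x.1 : ℚ⟦X⟧) + 1) ^ i * (2 * (x.2 : ℚ⟦X⟧) + 1) ^ j)) (moment i * moment j) :=
  (hasSum_mul_of_X_pow_dvd (hasSum_moment i) (hasSum_moment j) tri_finite
    (X_pow_tri_dvd i) tri_finite (X_pow_tri_dvd j)).congr_fun fun n => by ring

/-- The antisymmetric combinations of the moments of the even theta series. -/
noncomputable def wronskian (j k : ℕ) : ℚ⟦X⟧ :=
  oddSqMoment j * evenSqMoment k - oddSqMoment k * evenSqMoment j

theorem wronskian_pluecker : wronskian 0 1 * wronskian 2 3 - wronskian 0 2 * wronskian 1 3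
    + wronskian 0 3 * wronskian 1 2 = 0 := by
  simp only [wronskian]
  ring

theorem hasSum_two_mul_wronskian (j k : ℕ) :
    HasSum (fun x : ℤ × ℤ => thetaCoeff x.1 * thetaCoeff x.2
      * (((x.1 : ℚ⟦X⟧) + x.2 + 1) ^ (2 * j) * ((x.1 : ℚ⟦X⟧) - x.2) ^ (2 * k)
        - ((x.1 : ℚ⟦X⟧) + x.2 + 1) ^ (2 * k) * ((x.1 : ℚ⟦X⟧) - x.2) ^ (2 * j)))
      (2 * wronskian j k) := by
  rw [show 2 * wronskian j k = wronskian j k - wronskian k j by simp only [wronskian]; ring]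
  exact ((hasSum_thetaCoeff_mul j k).sub (hasSum_thetaCoeff_mul k j)).congr_fun fun x => by ring

theorem wronskian_zero_one : 2 * wronskian 0 1 = -moment 1 ^ 2 := by
  rw [pow_two]
  refine (hasSum_two_mul_wronskian 0 1).unique
    ((hasSum_thetaCoeff_mul_pow 1 1).neg.congr_fun fun x => ?_)
  ring

theorem wronskian_zero_two : 2 * wronskian 0 2 = -(moment 1 * moment 3) := by
  have h := ((hasSum_thetaCoeff_mul_pow 1 3).add (hasSum_thetaCoeff_mul_pow 3 1)).neg
  have h2 := (((hasSum_two_mul_wronskian 0 2).mul_left 2).congr_fun fun x => by ring).unique h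
  refine mul_left_cancel₀ (two_ne_zero (α := ℚ⟦X⟧)) ?_
  linear_combination h2

theorem wronskian_zero_three :
    16 * wronskian 0 3 = -(3 * (moment 1 * moment 5) + 5 * moment 3 ^ 2) := by
  have h := ((((hasSum_thetaCoeff_mul_pow 5 1).mul_left 3).add
    ((hasSum_thetaCoeff_mul_pow 3 3).mul_left 10)).add
    ((hasSum_thetaCoeff_mul_pow 1 5).mul_left 3)).neg
  have h2 := (((hasSum_two_mul_wronskian 0 3).mul_left 16).congr_fun fun x => by ring).unique h
  refine mul_left_cancel₀ (two_ne_zero (α := ℚ⟦X⟧)) ?_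
  linear_combination h2

theorem wronskian_one_two : 16 * wronskian 1 2 = -(moment 1 * moment 5 - moment 3 ^ 2) := by
  have h := (((hasSum_thetaCoeff_mul_pow 5 1).add
    ((hasSum_thetaCoeff_mul_pow 3 3).mul_left (-2))).add (hasSum_thetaCoeff_mul_pow 1 5)).neg
  have h2 := (((hasSum_two_mul_wronskian 1 2).mul_left 16).congr_fun fun x => by ring).unique h
  refine mul_left_cancel₀ (two_ne_zero (α := ℚ⟦X⟧)) ?_
  linear_combination h2

theorem wronskian_one_three :
    32 * wronskian 1 3 = -(moment 1 * moment 7 - moment 3 * moment 5) := by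
  have h := ((((hasSum_thetaCoeff_mul_pow 7 1).sub (hasSum_thetaCoeff_mul_pow 5 3)).sub
    (hasSum_thetaCoeff_mul_pow 3 5)).add (hasSum_thetaCoeff_mul_pow 1 7)).neg
  have h2 := (((hasSum_two_mul_wronskian 1 3).mul_left 32).congr_fun fun x => by ring).unique h
  refine mul_left_cancel₀ (two_ne_zero (α := ℚ⟦X⟧)) ?_
  linear_combination h2

theorem wronskian_two_three :
    256 * wronskian 2 3 = -(moment 1 * moment 9 - 4 * (moment 3 * moment 7) + 3 * moment 5 ^ 2) := by
  have h := (((((hasSum_thetaCoeff_mul_pow 9 1).add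
    ((hasSum_thetaCoeff_mul_pow 7 3).mul_left (-4))).add
    ((hasSum_thetaCoeff_mul_pow 5 5).mul_left 6)).add
    ((hasSum_thetaCoeff_mul_pow 3 7).mul_left (-4))).add (hasSum_thetaCoeff_mul_pow 1 9)).neg
  have h2 := (((hasSum_two_mul_wronskian 2 3).mul_left 256).congr_fun fun x => by ring).unique h
  refine mul_left_cancel₀ (two_ne_zero (α := ℚ⟦X⟧)) ?_
  linear_combination h2

/-- The Eisenstein series of weight four, defined through Ramanujan's equation for `DP`. -/
noncomputable def eisQ (R : Type*) [CommRing R] : R⟦X⟧ := eisP R ^ 2 - 12 * qD R (eisP R)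

/-- The Eisenstein series of weight six, defined through Ramanujan's equation for `DQ`. -/
noncomputable def eisR (R : Type*) [CommRing R] : R⟦X⟧ :=
  eisP R * eisQ R - 3 * qD R (eisQ R)

theorem qD_ofNat {R : Type*} [CommRing R] (n : ℕ) [n.AtLeastTwo] :
    qD R (ofNat(n) : R⟦X⟧) = 0 := by
  rw [← map_ofNat (C (R := R)) n]
  exact qD_C _

theorem moment_add_two_of_eq {m : ℚ⟦X⟧} {k : ℕ} (h : moment k = m * moment 1) :
    moment (k + 2) = (8 * qD ℚ m + eisP ℚ * m) * moment 1 := by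
  have h1 := moment_add_two 1
  rw [show 1 + 2 = 3 from rfl, moment_three] at h1
  rw [moment_add_two, h, qD_mul]
  linear_combination -m * h1

theorem qD_eisR_rat : 2 * qD ℚ (eisR ℚ) = eisP ℚ * eisR ℚ - eisQ ℚ ^ 2 := by
  have m3 := moment_three
  have m5 := moment_add_two_of_eq m3
  have m7 := moment_add_two_of_eq m5
  have m9 := moment_add_two_of_eq m7
  simp only [map_add, qD_mul, qD_ofNat, mul_zero, add_zero, Nat.reduceAdd] at m5 m7 m9
  have h := wronskian_pluecker
  have h1 : (2 * wronskian 0 1) * (256 * wronskian 2 3)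
      - (2 * wronskian 0 2) * (32 * wronskian 1 3) * 8
      + (16 * wronskian 0 3) * (16 * wronskian 1 2) * 2 = 0 := by
    linear_combination 512 * h
  rw [wronskian_zero_one, wronskian_zero_two, wronskian_zero_three, wronskian_one_two,
    wronskian_one_three, wronskian_two_three, m9, m7, m5, m3] at h1
  simp only [eisR, eisQ, map_sub, map_add, pow_two, qD_mul, qD_ofNat, mul_zero, add_zero]
  generalize qD ℚ (qD ℚ (qD ℚ (eisP ℚ))) = p3 at *
  generalize qD ℚ (qD ℚ (eisP ℚ)) = p2 at *
  generalize qD ℚ (eisP ℚ) = p1 at *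
  generalize eisP ℚ = p at *
  refine mul_left_cancel₀ (mul_ne_zero (OfNat.ofNat_ne_zero 64) (pow_ne_zero 4 moment_one_ne_zero)) ?_
  linear_combination 9 * h1

end Chazy

/-! ### Graded polynomials in the Eisenstein series -/

section Modular

variable {K L : Type*} [CommRing K] [CommRing L]

theorem map_eisQ (φ : K →+* L) : PowerSeries.map φ (eisQ K) = eisQ L := by
  rw [eisQ, eisQ, map_sub, map_mul, map_pow, map_qD, map_eisP, map_ofNat]

theorem map_eisR (φ : K →+* L) : PowerSeries.map φ (eisR K) = eisR L := by
  rw [eisR, eisR, map_sub, map_mul, map_mul, map_qD, map_eisQ, map_eisP, map_ofNat]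

theorem qD_eisR : 2 * qD K (eisR K) = eisP K * eisR K - eisQ K ^ 2 := by
  have h : 2 * qD ℤ (eisR ℤ) = eisP ℤ * eisR ℤ - eisQ ℤ ^ 2 := by
    refine PowerSeries.map_injective (Int.castRingHom ℚ) Int.cast_injective ?_
    simp only [map_mul, map_sub, map_pow, map_qD, map_eisQ, map_eisR, map_eisP, map_ofNat,
      qD_eisR_rat]
  have h2 := congrArg (PowerSeries.map (Int.castRingHom K)) h
  simpa only [map_mul, map_sub, map_pow, map_qD, map_eisQ, map_eisR, map_eisP, map_ofNat] using h2

theorem qD_eisQ : 3 * qD K (eisQ K) = eisP K * eisQ K - eisR K := by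
  rw [eisR]; ring

variable (K) in
/-- Evaluation of a polynomial at the Eisenstein series, the weight being recorded by the outer
variable. -/
noncomputable def gradedEval : MvPolynomial (Fin 2) K →+* K⟦X⟧⟦X⟧ :=
  MvPolynomial.eval₂Hom ((C (R := K⟦X⟧)).comp C) ![C (eisQ K) * X ^ 4, C (eisR K) * X ^ 6]

theorem gradedEval_C (c : K) : gradedEval K (MvPolynomial.C c) = C (C c) := by
  simp [gradedEval]

theorem gradedEval_X_zero : gradedEval K (MvPolynomial.X 0) = C (eisQ K) * X ^ 4 := by
  simp [gradedEval]

theorem gradedEval_X_one : gradedEval K (MvPolynomial.X 1) = C (eisR K) * X ^ 6 := by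
  simp [gradedEval]

variable (K) in
/-- Twelve times Serre's derivation on polynomials in the Eisenstein series. -/
noncomputable def serrePoly : Derivation K (MvPolynomial (Fin 2) K) (MvPolynomial (Fin 2) K) :=
  MvPolynomial.mkDerivation K ![-4 * MvPolynomial.X 1, -6 * MvPolynomial.X 0 ^ 2]

variable (K) in
/-- The Euler derivation on polynomials in the Eisenstein series. -/
noncomputable def eulerPoly : Derivation K (MvPolynomial (Fin 2) K) (MvPolynomial (Fin 2) K) :=
  MvPolynomial.mkDerivation K ![4 * MvPolynomial.X 0, 6 * MvPolynomial.X 1]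

/-- Twelve times Serre's derivation on graded series. -/
noncomputable def serreSeries (F : K⟦X⟧⟦X⟧) : K⟦X⟧⟦X⟧ :=
  X ^ 2 * (12 * mapCoeffD (qD K) F - C (eisP K) * qD K⟦X⟧ F)

theorem mapCoeffD_mul (F G : K⟦X⟧⟦X⟧) : mapCoeffD (qD K) (F * G)
    = F * mapCoeffD (qD K) G + G * mapCoeffD (qD K) F :=
  (mapCoeffD (qD K)).leibniz F G

theorem mapCoeffD_X_pow (n : ℕ) : mapCoeffD (qD K) ((X : K⟦X⟧⟦X⟧) ^ n) = 0 := by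
  induction n with
  | zero => rw [pow_zero]; exact (mapCoeffD (qD K)).map_one_eq_zero
  | succ n ih => rw [pow_succ, mapCoeffD_mul, ih, mapCoeffD_X, mul_zero, mul_zero, add_zero]

theorem serreSeries_mul (F G : K⟦X⟧⟦X⟧) :
    serreSeries (F * G) = F * serreSeries G + G * serreSeries F := by
  simp only [serreSeries, mapCoeffD_mul, qD_mul]
  ring

theorem serreSeries_C_mul_X_pow (x : K⟦X⟧) (k : ℕ) :
    serreSeries (C x * X ^ k) = C (12 * qD K x - k * eisP K * x) * X ^ (k + 2) := by
  rw [serreSeries, mapCoeffD_mul, qD_mul, mapCoeffD_X_pow, mapCoeffD_C, qD_C, qD_X_pow]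
  simp only [map_sub, map_mul, map_ofNat, map_natCast]
  ring

theorem gradedEval_serrePoly (f : MvPolynomial (Fin 2) K) :
    gradedEval K (serrePoly K f) = serreSeries (gradedEval K f) := by
  induction f using MvPolynomial.induction_on with
  | C a =>
    rw [MvPolynomial.derivation_C, map_zero, gradedEval_C]
    have := serreSeries_C_mul_X_pow (C a) 0
    rw [pow_zero, mul_one] at this
    rw [this, qD_C]
    simp
  | add p q hp hq =>
    rw [map_add, map_add, map_add, hp, hq, serreSeries, serreSeries, serreSeries, map_add, map_add]
    ring
  | mul_X p i hp =>
    rw [(serrePoly K).leibniz p, map_add, smul_eq_mul, smul_eq_mul, map_mul (gradedEval K),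
      map_mul (gradedEval K), map_mul (gradedEval K), hp, serreSeries_mul]
    refine congrArg₂ _ (congrArg _ ?_) rfl
    fin_cases i
    · simp only [serrePoly, MvPolynomial.mkDerivation_X, Fin.zero_eta, Matrix.cons_val_zero,
        gradedEval_X_zero, serreSeries_C_mul_X_pow, map_mul, gradedEval_X_one, map_neg, map_ofNat]
      rw [show 12 * qD K (eisQ K) - (4 : ℕ) * eisP K * eisQ K = -4 * eisR K by
        push_cast; linear_combination 4 * qD_eisQ (K := K)]
      simp only [map_mul, map_neg, map_ofNat]
      ring
    · simp only [serrePoly, MvPolynomial.mkDerivation_X, Fin.mk_one, Matrix.cons_val_one,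
        Matrix.cons_val_fin_one,
        gradedEval_X_zero, serreSeries_C_mul_X_pow, map_mul, gradedEval_X_one, map_neg, map_ofNat,
        map_pow]
      rw [show 12 * qD K (eisR K) - (6 : ℕ) * eisP K * eisR K = -6 * eisQ K ^ 2 by
        push_cast; linear_combination 6 * qD_eisR (K := K)]
      simp only [map_mul, map_neg, map_ofNat, map_pow]
      ring

theorem gradedEval_eulerPoly (f : MvPolynomial (Fin 2) K) :
    gradedEval K (eulerPoly K f) = qD K⟦X⟧ (gradedEval K f) := by
  induction f using MvPolynomial.induction_on with
  | C a => rw [MvPolynomial.derivation_C, map_zero, gradedEval_C, qD_C]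
  | add p q hp hq => rw [map_add, map_add, map_add, hp, hq, map_add]
  | mul_X p i hp =>
    rw [(eulerPoly K).leibniz p, map_add, smul_eq_mul, smul_eq_mul, map_mul (gradedEval K),
      map_mul (gradedEval K), map_mul (gradedEval K), hp, qD_mul]
    refine congrArg₂ _ (congrArg _ ?_) rfl
    fin_cases i
    · simp only [eulerPoly, MvPolynomial.mkDerivation_X, Fin.zero_eta, Matrix.cons_val_zero,
        gradedEval_X_zero, map_mul, map_ofNat, qD_mul, qD_C, qD_X_pow]
      push_cast
      ring
    · simp only [eulerPoly, MvPolynomial.mkDerivation_X, Fin.mk_one, Matrix.cons_val_one,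
        Matrix.cons_val_fin_one,
        gradedEval_X_one, map_mul, map_ofNat, qD_mul, qD_C, qD_X_pow]
      push_cast
      ring

variable (K) in
/-- A series is modular of weight `k` if it is an isobaric polynomial of weight `k` in the
Eisenstein series. -/
def IsModular (k : ℕ) (x : K⟦X⟧) : Prop := ∃ f, gradedEval K f = C x * X ^ k

theorem isModular_zero (k : ℕ) : IsModular K k 0 := ⟨0, by simp⟩

theorem isModular_C (c : K) : IsModular K 0 (C c) := ⟨MvPolynomial.C c, by simp [gradedEval_C]⟩

theorem isModular_one : IsModular K 0 1 := by
  rw [← map_one C]; exact isModular_C 1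

theorem isModular_eisQ : IsModular K 4 (eisQ K) := ⟨_, gradedEval_X_zero⟩

theorem IsModular.add {k : ℕ} {x y : K⟦X⟧} (hx : IsModular K k x) (hy : IsModular K k y) :
    IsModular K k (x + y) := by
  obtain ⟨f, hf⟩ := hx
  obtain ⟨g, hg⟩ := hy
  exact ⟨f + g, by rw [map_add, hf, hg, map_add]; ring⟩

theorem IsModular.mul {k l : ℕ} {x y : K⟦X⟧} (hx : IsModular K k x) (hy : IsModular K l y) :
    IsModular K (k + l) (x * y) := by
  obtain ⟨f, hf⟩ := hx
  obtain ⟨g, hg⟩ := hy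
  exact ⟨f * g, by rw [map_mul, hf, hg, map_mul]; ring⟩

theorem IsModular.C_mul {k : ℕ} {x : K⟦X⟧} (c : K) (hx : IsModular K k x) :
    IsModular K k (C c * x) := by
  simpa using (isModular_C c).mul hx

theorem IsModular.neg {k : ℕ} {x : K⟦X⟧} (hx : IsModular K k x) : IsModular K k (-x) := by
  simpa using hx.C_mul (-1)

theorem IsModular.sub {k : ℕ} {x y : K⟦X⟧} (hx : IsModular K k x) (hy : IsModular K k y) :
    IsModular K k (x - y) := by
  rw [sub_eq_add_neg]; exact hx.add hy.neg

theorem IsModular.serre {k : ℕ} {x : K⟦X⟧} (hx : IsModular K k x) :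
    IsModular K (k + 2) (12 * qD K x - k * eisP K * x) := by
  obtain ⟨f, hf⟩ := hx
  exact ⟨serrePoly K f, by rw [gradedEval_serrePoly, hf, serreSeries_C_mul_X_pow]⟩

theorem isModular_sum {ι : Type*} {s : Finset ι} {k : ℕ} {x : ι → K⟦X⟧}
    (h : ∀ i ∈ s, IsModular K k (x i)) : IsModular K k (∑ i ∈ s, x i) := by
  classical
  induction s using Finset.induction_on with
  | empty => simpa using isModular_zero k
  | insert a s ha ih =>
    rw [sum_insert ha]
    exact (h a (mem_insert_self _ _)).add (ih fun i hi => h i (mem_insert_of_mem hi))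

end Modular

/-! ### Modularity of the normalised Taylor coefficients -/

section Taylor

/-- The exponential of `c P z²`. -/
noncomputable def expP (c : ℚ) : ℚ⟦X⟧⟦X⟧ := PowerSeries.mk fun k =>
  if Even k then C (c ^ (k / 2) / (k / 2).factorial) * eisP ℚ ^ (k / 2) else 0

theorem coeff_expP_two_mul (c : ℚ) (j : ℕ) :
    coeff (2 * j) (expP c) = C (c ^ j / j.factorial) * eisP ℚ ^ j := by
  rw [expP, coeff_mk, if_pos (even_two_mul j), Nat.mul_div_cancel_left _ two_pos]

theorem coeff_expP_two_mul_add_one (c : ℚ) (j : ℕ) : coeff (2 * j + 1) (expP c) = 0 := by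
  rw [expP, coeff_mk, if_neg (by simp)]

theorem natCast_eq_C (n : ℕ) : (n : ℚ⟦X⟧) = C (n : ℚ) := (map_natCast C n).symm

theorem C_pow_succ_div (c : ℚ) (j : ℕ) : ((j + 1 : ℕ) : ℚ⟦X⟧) * C (c ^ (j + 1) / (j + 1).factorial)
    = C c * C (c ^ j / j.factorial) := by
  rw [natCast_eq_C, ← map_mul, ← map_mul, Nat.factorial_succ]
  congr 1
  push_cast
  field_simp
  ring

theorem zD_expP (c : ℚ) : qD ℚ⟦X⟧ (expP c) = X ^ 2 * (C (2 * C c * eisP ℚ) * expP c) := by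
  ext1 k
  rw [coeff_qD, coeff_X_pow_mul']
  split_ifs with hk
  · rw [coeff_C_mul]
    obtain ⟨j, rfl | rfl⟩ := Nat.even_or_odd' k
    · obtain ⟨j, rfl⟩ := Nat.exists_eq_add_of_le' (show 1 ≤ j by omega)
      rw [show 2 * (j + 1) - 2 = 2 * j by omega, coeff_expP_two_mul, coeff_expP_two_mul,
        pow_succ (eisP ℚ)]
      have := C_pow_succ_div c j
      push_cast at this ⊢
      linear_combination 2 * eisP ℚ ^ j * eisP ℚ * this
    · obtain ⟨j, rfl⟩ := Nat.exists_eq_add_of_le' (show 1 ≤ j by omega)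
      rw [show 2 * (j + 1) + 1 - 2 = 2 * j + 1 by omega, coeff_expP_two_mul_add_one,
        coeff_expP_two_mul_add_one, mul_zero, mul_zero]
  · obtain rfl | rfl : k = 0 ∨ k = 1 := by omega
    · simp
    · rw [show 1 = 2 * 0 + 1 from rfl, coeff_expP_two_mul_add_one, mul_zero]

theorem qD_pow {R : Type*} [CommRing R] (f : R⟦X⟧) (n : ℕ) :
    qD R (f ^ (n + 1)) = (n + 1) * f ^ n * qD R f := by
  have := (qD R).leibniz_pow f (n + 1)
  rw [this]
  simp only [Nat.add_sub_cancel, nsmul_eq_mul, smul_eq_mul]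
  push_cast
  ring

theorem qDz_expP (c : ℚ) : qDz (expP c) = X ^ 2 * (C (C c * qD ℚ (eisP ℚ)) * expP c) := by
  ext1 k
  rw [coeff_qDz, coeff_X_pow_mul']
  split_ifs with hk
  · rw [coeff_C_mul]
    obtain ⟨j, rfl | rfl⟩ := Nat.even_or_odd' k
    · obtain ⟨j, rfl⟩ := Nat.exists_eq_add_of_le' (show 1 ≤ j by omega)
      rw [show 2 * (j + 1) - 2 = 2 * j by omega, coeff_expP_two_mul, coeff_expP_two_mul, qD_mul,
        qD_C, qD_pow]
      have := C_pow_succ_div c j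
      push_cast at this ⊢
      linear_combination eisP ℚ ^ j * qD ℚ (eisP ℚ) * this
    · obtain ⟨j, rfl⟩ := Nat.exists_eq_add_of_le' (show 1 ≤ j by omega)
      rw [show 2 * (j + 1) + 1 - 2 = 2 * j + 1 by omega, coeff_expP_two_mul_add_one,
        coeff_expP_two_mul_add_one, mul_zero, map_zero]
  · obtain rfl | rfl : k = 0 ∨ k = 1 := by omega
    · rw [show 0 = 2 * 0 from rfl, coeff_expP_two_mul]
      simp
    · rw [show 1 = 2 * 0 + 1 from rfl, coeff_expP_two_mul_add_one, map_zero]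

theorem coeff_expP_zero (c : ℚ) : coeff 0 (expP c) = 1 := by
  rw [show 0 = 2 * 0 from rfl, coeff_expP_two_mul]
  simp

theorem eq_one_of_zD_eq_zero {F : ℚ⟦X⟧⟦X⟧} (h : qD ℚ⟦X⟧ F = 0) (h0 : coeff 0 F = 1) : F = 1 := by
  ext1 k
  rcases k with _ | k
  · rw [h0]; simp
  · have h1 := congrArg (coeff (k + 1)) h
    rw [coeff_qD, map_zero] at h1
    rw [coeff_one, if_neg (by omega)]
    exact (mul_eq_zero.mp h1).resolve_left (Nat.cast_ne_zero.mpr (by omega))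

theorem expP_mul_neg (c : ℚ) : expP c * expP (-c) = 1 := by
  refine eq_one_of_zD_eq_zero ?_ ?_
  · rw [qD_mul, zD_expP, zD_expP]
    simp only [map_mul, map_neg]
    ring
  · rw [coeff_mul]
    simp [coeff_expP_zero]

theorem expP_cube_mul : expP (1 / 6) ^ 3 * expP (-(1 / 2)) = 1 := by
  refine eq_one_of_zD_eq_zero ?_ ?_
  · have h : C (C (1 / 2 : ℚ)) = 3 * C (C (1 / 6 : ℚ)) := by
      rw [← map_ofNat (C (R := ℚ⟦X⟧)) 3, ← map_ofNat (C (R := ℚ)) 3, ← map_mul, ← map_mul]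
      norm_num
    rw [pow_succ, pow_two, qD_mul, qD_mul, qD_mul, zD_expP, zD_expP]
    simp only [map_mul, map_neg, h]
    ring
  · rw [coeff_zero_eq_constantCoeff_apply, map_mul, map_pow, ← coeff_zero_eq_constantCoeff_apply,
      ← coeff_zero_eq_constantCoeff_apply, coeff_expP_zero, coeff_expP_zero]
    ring

/-- A series in the outer variable whose `k`-th coefficient is modular of weight `k`. -/
def IsGraded (F : ℚ⟦X⟧⟦X⟧) : Prop := ∀ k, IsModular ℚ k (coeff k F)

theorem IsGraded.mul {F G : ℚ⟦X⟧⟦X⟧} (hF : IsGraded F) (hG : IsGraded G) : IsGraded (F * G) := by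
  intro k
  rw [coeff_mul]
  refine isModular_sum fun i hi => ?_
  rw [← mem_antidiagonal.mp hi]
  exact (hF _).mul (hG _)

theorem IsGraded.of_mul_eq_one {F G : ℚ⟦X⟧⟦X⟧} (hF : IsGraded F) (h0 : coeff 0 F = 1)
    (h : F * G = 1) : IsGraded G := by
  intro k
  induction k using Nat.strong_induction_on with
  | _ k ih =>
    have h1 := congrArg (coeff k) h
    rw [coeff_mul, Finset.Nat.sum_antidiagonal_eq_sum_range_succ_mk, sum_range_succ', h0,
      one_mul, Nat.sub_zero] at h1
    have h2 : coeff k G = coeff k 1 - ∑ i ∈ range k, coeff (i + 1) F * coeff (k - (i + 1)) G := by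
      linear_combination h1
    rw [h2]
    refine IsModular.sub ?_ (isModular_sum fun i hi => ?_)
    · rw [coeff_one]
      split_ifs with hk
      · rw [hk]; exact isModular_one
      · exact isModular_zero k
    · have hi := mem_range.mp hi
      have := (hF (i + 1)).mul (ih (k - (i + 1)) (by omega))
      rwa [show i + 1 + (k - (i + 1)) = k by omega] at this

/-- The Gaussian modification of the normalised theta function. -/
noncomputable def sigmaHat : ℚ⟦X⟧⟦X⟧ := expP (-(1 / 6)) * sigmaZ

theorem sigmaZ_eq : sigmaZ = expP (1 / 6) * sigmaHat := by
  rw [sigmaHat, ← mul_assoc, expP_mul_neg, one_mul]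

theorem coeff_sigmaHat_zero : coeff 0 sigmaHat = 1 := by
  rw [sigmaHat, coeff_zero_eq_constantCoeff_apply, map_mul, ← coeff_zero_eq_constantCoeff_apply,
    ← coeff_zero_eq_constantCoeff_apply, coeff_expP_zero, coeff_sigmaZ_zero, one_mul]

theorem heat_sigmaHat : X ^ 2 * (6 * (12 * qDz sigmaHat - C (eisP ℚ) * qD ℚ⟦X⟧ sigmaHat))
    = 9 * (qD ℚ⟦X⟧ (qD ℚ⟦X⟧ sigmaHat) + qD ℚ⟦X⟧ sigmaHat) + X ^ 4 * (C (eisQ ℚ) * sigmaHat) := by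
  have h := heat_sigmaZ
  have h6 : (6 : ℚ⟦X⟧⟦X⟧) * C (C (1 / 6 : ℚ)) = 1 := by
    rw [← map_ofNat (C (R := ℚ⟦X⟧)) 6, ← map_ofNat (C (R := ℚ)) 6, ← map_mul, ← map_mul]
    norm_num
  rw [sigmaZ_eq] at h
  simp only [qDz_mul, qD_mul, qDz_expP, zD_expP, map_add, map_mul, qD_C, map_ofNat, qD_X_pow,
    qD_ofNat] at h
  have he := expP_mul_neg (1 / 6)
  rw [eisQ]
  simp only [map_sub, map_mul, map_pow, map_ofNat]
  generalize expP (1 / 6) = e at *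
  generalize expP (-(1 / 6)) = e' at *
  generalize C (C (1 / 6 : ℚ)) = c at *
  generalize qD ℚ⟦X⟧ (qD ℚ⟦X⟧ sigmaHat) = s2 at *
  generalize qD ℚ⟦X⟧ sigmaHat = s1 at *
  generalize qDz sigmaHat = s3 at *
  generalize sigmaHat = s at *
  generalize C (qD ℚ (eisP ℚ)) = p1 at *
  generalize C (eisP ℚ) = p at *
  linear_combination 9 * e' * h - 9 * (8 * X ^ 2 * s3 + 8 * c * p1 * X ^ 4 * s + p * X ^ 2 * s - s2
    - 4 * c * p * X ^ 2 * s1 - 6 * c * p * X ^ 2 * s - 4 * c ^ 2 * p ^ 2 * X ^ 4 * s - s1) * he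
    - (12 * p1 * X ^ 4 * s - 9 * p * X ^ 2 * s - 6 * p * X ^ 2 * s1
      - (6 * c + 1) * p ^ 2 * X ^ 4 * s) * h6

theorem coeff_sigmaHat_one : coeff 1 sigmaHat = 0 := by
  have h := congrArg (coeff 1) heat_sigmaHat
  rw [coeff_X_pow_mul', if_neg (by norm_num), map_add, coeff_X_pow_mul', if_neg (by norm_num),
    ← map_ofNat (C (R := ℚ⟦X⟧)) 9, coeff_C_mul, map_add, coeff_qD, coeff_qD] at h
  push_cast at h
  refine mul_left_cancel₀ (OfNat.ofNat_ne_zero 18) ?_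
  linear_combination -h

theorem coeff_sigmaHat_add_two (k : ℕ) :
    9 * ((k + 3) * (k + 2) : ℕ) * coeff (k + 2) sigmaHat
      = 6 * (12 * qD ℚ (coeff k sigmaHat) - k * eisP ℚ * coeff k sigmaHat)
        - if 2 ≤ k then eisQ ℚ * coeff (k - 2) sigmaHat else 0 := by
  have h := congrArg (coeff (k + 2)) heat_sigmaHat
  rw [coeff_X_pow_mul, map_add, coeff_X_pow_mul', ← map_ofNat (C (R := ℚ⟦X⟧)) 9,
    ← map_ofNat (C (R := ℚ⟦X⟧)) 6, ← map_ofNat (C (R := ℚ⟦X⟧)) 12] at h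
  simp only [coeff_C_mul, map_add, map_sub, coeff_qD, coeff_qDz, show (4 ≤ k + 2) = (2 ≤ k) by simp,
    show k + 2 - 4 = k - 2 by omega] at h
  push_cast at h ⊢
  linear_combination -h

theorem isModular_of_natCast_mul {k n : ℕ} (hn : n ≠ 0) {x : ℚ⟦X⟧}
    (h : IsModular ℚ k ((n : ℚ⟦X⟧) * x)) : IsModular ℚ k x := by
  have := h.C_mul (n : ℚ)⁻¹
  rwa [natCast_eq_C, ← mul_assoc, ← map_mul, inv_mul_cancel₀ (Nat.cast_ne_zero.mpr hn), map_one,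
    one_mul] at this

theorem isGraded_sigmaHat : IsGraded sigmaHat := by
  intro k
  induction k using Nat.strong_induction_on with
  | _ k ih =>
    rcases k with _ | _ | k
    · rw [coeff_sigmaHat_zero]; exact isModular_one
    · rw [coeff_sigmaHat_one]; exact isModular_zero _
    · refine isModular_of_natCast_mul (n := 9 * ((k + 3) * (k + 2))) (by positivity) ?_
      have h := coeff_sigmaHat_add_two k
      rw [show ((9 * ((k + 3) * (k + 2)) : ℕ) : ℚ⟦X⟧) = 9 * ((k + 3) * (k + 2) : ℕ) by
        push_cast; ring, h, show (6 : ℚ⟦X⟧) = C 6 by rw [map_ofNat]]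
      refine ((ih k (by omega)).serre.C_mul 6).sub ?_
      split_ifs with hk
      · have := isModular_eisQ.mul (ih (k - 2) (by omega))
        rwa [show 4 + (k - 2) = k + 2 by omega] at this
      · exact isModular_zero _

/-- The operator `24D - P` on series in the inner variable. -/
noncomputable def twistD {R : Type*} [CommRing R] (y : R⟦X⟧) : R⟦X⟧ := 24 * qD R y - eisP R * y

theorem coeff_heatOp_add_two' (f : ℚ⟦X⟧⟦X⟧) (k : ℕ) : coeff (k + 2) (heatOp f)
    = twistD (coeff k f) + (k + 1) * k * coeff (k + 2) f :=
  coeff_heatOp_add_two f k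

/-- The normalised coefficient of `z²` of `upsilon`. -/
noncomputable def upsilonHat : ℚ⟦X⟧ := coeff 2 upsilon - C (1 / 4 : ℚ) * eisP ℚ

/-- The Taylor coefficients of the homogeneous solution of the heat equation starting with
`upsilonHat`. -/
noncomputable def homogCoeff : ℕ → ℚ⟦X⟧
  | 0 => 0
  | 1 => 0
  | 2 => upsilonHat
  | k + 3 => -(C (1 / ((k + 2) * (k + 1)) : ℚ) * twistD (homogCoeff (k + 1)))

/-- The part of `upsilon` whose Gaussian modification has modular coefficients. -/
noncomputable def chiZ : ℚ⟦X⟧⟦X⟧ := upsilon - PowerSeries.mk homogCoeff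

theorem heatOp_homog : heatOp (PowerSeries.mk homogCoeff) = 0 := by
  ext1 k
  rcases k with _ | _ | k
  · rw [coeff_heatOp_zero, coeff_mk, homogCoeff, mul_zero, map_zero]
  · rw [coeff_heatOp_one, map_zero]
  · rw [coeff_heatOp_add_two', coeff_mk, coeff_mk, map_zero]
    rcases k with _ | k
    · simp [homogCoeff, twistD]
    · rw [homogCoeff]
      have : ((k + 1 + 1 : ℕ) : ℚ⟦X⟧) * ((k + 1 : ℕ) : ℚ⟦X⟧) * C (1 / ((k + 2) * (k + 1)) : ℚ)
          = 1 := by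
        rw [natCast_eq_C, natCast_eq_C, ← map_mul, ← map_mul, ← map_one C]
        congr 1
        push_cast
        field_simp
        ring
      push_cast at this ⊢
      linear_combination (-twistD (homogCoeff (k + 1))) * this

theorem heatOp_sub (f g : ℚ⟦X⟧⟦X⟧) : heatOp (f - g) = heatOp f - heatOp g := by
  simp only [heatOp, map_sub]; ring

theorem sigmaZ_cube_mul_heatOp_chiZ : sigmaZ ^ 3 * heatOp chiZ = -1 := by
  rw [chiZ, heatOp_sub, heatOp_homog, sub_zero, sigmaZ_cube_mul_heatOp_upsilon]

/-- The Gaussian modification of `chiZ`. -/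
noncomputable def chiHat : ℚ⟦X⟧⟦X⟧ := expP (1 / 2) * chiZ

theorem chiZ_eq : chiZ = expP (-(1 / 2)) * chiHat := by
  rw [chiHat, ← mul_assoc, mul_comm (expP _), expP_mul_neg, one_mul]

theorem heat_chiHat : sigmaHat ^ 3
    * (X ^ 2 * (2 * (12 * qDz chiHat - C (eisP ℚ) * qD ℚ⟦X⟧ chiHat))
      + X ^ 4 * (C (eisQ ℚ) * chiHat)
      + (qD ℚ⟦X⟧ (qD ℚ⟦X⟧ chiHat) - 3 * qD ℚ⟦X⟧ chiHat + 2 * chiHat)) = -1 := by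
  have h := sigmaZ_cube_mul_heatOp_chiZ
  have he := expP_cube_mul
  have h2 : (2 : ℚ⟦X⟧⟦X⟧) * C (C (1 / 2 : ℚ)) = 1 := by
    rw [← map_ofNat (C (R := ℚ⟦X⟧)) 2, ← map_ofNat (C (R := ℚ)) 2, ← map_mul, ← map_mul]
    norm_num
  rw [sigmaZ_eq, heatOp, chiZ_eq] at h
  simp only [qDz_mul, qD_mul, qDz_expP, zD_expP, map_add, map_mul, map_neg, qD_C, map_ofNat,
    qD_X_pow, qD_ofNat] at h
  rw [eisQ]
  simp only [map_sub, map_mul, map_pow, map_ofNat]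
  generalize expP (1 / 6) = e at *
  generalize expP (-(1 / 2)) = e' at *
  generalize C (C (1 / 2 : ℚ)) = c at *
  generalize qD ℚ⟦X⟧ (qD ℚ⟦X⟧ chiHat) = s2 at *
  generalize qD ℚ⟦X⟧ chiHat = s1 at *
  generalize qDz chiHat = s3 at *
  generalize chiHat = s at *
  generalize C (qD ℚ (eisP ℚ)) = p1 at *
  generalize C (eisP ℚ) = p at *
  have hc : sigmaHat ^ 3 * (X ^ 2 * (24 * s3 - 24 * c * p1 * X ^ 2 * s - p * s)
      + (s2 - 4 * c * p * X ^ 2 * s1 - 4 * c * p * X ^ 2 * s + 4 * c ^ 2 * p ^ 2 * X ^ 4 * s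
        - 3 * s1 + 6 * c * p * X ^ 2 * s + 2 * s)) = -1 := by
    linear_combination h - sigmaHat ^ 3 * (X ^ 2 * (24 * s3 - 24 * c * p1 * X ^ 2 * s - p * s)
      + (s2 - 4 * c * p * X ^ 2 * s1 - 4 * c * p * X ^ 2 * s + 4 * c ^ 2 * p ^ 2 * X ^ 4 * s
        - 3 * s1 + 6 * c * p * X ^ 2 * s + 2 * s)) * he
  linear_combination hc - sigmaHat ^ 3 * (-12 * p1 * X ^ 4 * s - 2 * p * X ^ 2 * s1
    + p * X ^ 2 * s + (2 * c + 1) * p ^ 2 * X ^ 4 * s) * h2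

theorem coeff_chiZ_zero : coeff 0 chiZ = C (-1 / 2 : ℚ) := by
  rw [chiZ, map_sub, coeff_upsilon_zero, coeff_mk, homogCoeff, sub_zero]

theorem coeff_chiZ_one : coeff 1 chiZ = 0 := by
  rw [chiZ, map_sub, coeff_upsilon_one, coeff_mk, homogCoeff, sub_zero]

theorem coeff_chiZ_two : coeff 2 chiZ = C (1 / 4 : ℚ) * eisP ℚ := by
  rw [chiZ, map_sub, coeff_mk, homogCoeff, upsilonHat, sub_sub_cancel]

theorem coeff_chiHat_zero : coeff 0 chiHat = C (-1 / 2 : ℚ) := by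
  rw [chiHat, coeff_mul, Finset.Nat.sum_antidiagonal_eq_sum_range_succ_mk, sum_range_one,
    coeff_expP_zero, coeff_chiZ_zero, one_mul]

theorem coeff_chiHat_one : coeff 1 chiHat = 0 := by
  rw [chiHat, coeff_mul, Finset.Nat.sum_antidiagonal_eq_sum_range_succ_mk, sum_range_succ,
    sum_range_one, coeff_chiZ_one, show coeff 1 (expP (1 / 2)) = 0 from
    coeff_expP_two_mul_add_one _ 0, mul_zero, zero_mul, add_zero]

theorem coeff_chiHat_two : coeff 2 chiHat = 0 := by
  have h2 := coeff_expP_two_mul (1 / 2) 1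
  rw [chiHat, coeff_mul, Finset.Nat.sum_antidiagonal_eq_sum_range_succ_mk, sum_range_succ,
    sum_range_succ, sum_range_one, coeff_chiZ_one, coeff_expP_zero, coeff_chiZ_two, h2,
    coeff_chiZ_zero]
  have : C (1 / 4 : ℚ) + C (1 / 2 : ℚ) * C (-1 / 2 : ℚ) = 0 := by
    rw [← map_mul, ← map_add]; norm_num
  simp only [pow_one, Nat.factorial_one, Nat.cast_one, div_one, mul_zero, add_zero]
  linear_combination eisP ℚ * this

theorem isGraded_chiHat : IsGraded chiHat := by
  have hw : IsGraded (-(X ^ 2 * (2 * (12 * qDz chiHat - C (eisP ℚ) * qD ℚ⟦X⟧ chiHat))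
      + X ^ 4 * (C (eisQ ℚ) * chiHat)
      + (qD ℚ⟦X⟧ (qD ℚ⟦X⟧ chiHat) - 3 * qD ℚ⟦X⟧ chiHat + 2 * chiHat))) := by
    refine IsGraded.of_mul_eq_one ((isGraded_sigmaHat.mul isGraded_sigmaHat).mul isGraded_sigmaHat)
      ?_ ?_
    · simp only [coeff_zero_eq_constantCoeff_apply, map_mul]
      simp only [← coeff_zero_eq_constantCoeff_apply, coeff_sigmaHat_zero, mul_one]
    · linear_combination -heat_chiHat
  intro k
  induction k using Nat.strong_induction_on with
  | _ k ih =>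
    obtain rfl | rfl | rfl | ⟨k, rfl⟩ : k = 0 ∨ k = 1 ∨ k = 2 ∨ ∃ j, k = j + 3 := by
      rcases k with _ | _ | _ | k <;> simp
    · rw [coeff_chiHat_zero]; exact isModular_C _
    · rw [coeff_chiHat_one]; exact isModular_zero _
    · rw [coeff_chiHat_two]; exact isModular_zero _
    · have h := hw (k + 1 + 2)
      rw [map_neg, map_add, map_add, coeff_X_pow_mul, coeff_X_pow_mul',
        ← map_ofNat (C (R := ℚ⟦X⟧)) 2, ← map_ofNat (C (R := ℚ⟦X⟧)) 12,
        ← map_ofNat (C (R := ℚ⟦X⟧)) 3] at h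
      simp only [coeff_C_mul, map_sub, map_add, coeff_qD, coeff_qDz] at h
      have h1 := (ih (k + 1) (by omega)).serre.C_mul 2
      have h2 : IsModular ℚ (k + 1 + 2) (if 4 ≤ k + 1 + 2 then
          eisQ ℚ * coeff (k + 1 + 2 - 4) chiHat else 0) := by
        split_ifs with hk
        · have := isModular_eisQ.mul (ih (k + 1 + 2 - 4) (by omega))
          rwa [show 4 + (k + 1 + 2 - 4) = k + 1 + 2 by omega] at this
        · exact isModular_zero _
      have h3 := ((h.add h1).add h2).neg
      refine isModular_of_natCast_mul (n := (k + 2) * (k + 1)) (by positivity) ?_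
      convert h3 using 1
      rw [map_ofNat]
      push_cast
      ring

end Taylor

/-! ### Integrality -/

section Integrality

/-- The series with integral coefficients. -/
noncomputable def intSeries : Subring ℚ⟦X⟧ := (PowerSeries.map (Int.castRingHom ℚ)).range

theorem mem_intSeries_iff {x : ℚ⟦X⟧} : x ∈ intSeries ↔ ∀ n, ∃ z : ℤ, coeff n x = z := by
  constructor
  · rintro ⟨y, rfl⟩ n
    exact ⟨coeff n y, by simp⟩
  · intro h
    choose z hz using h
    exact ⟨PowerSeries.mk z, by ext n; simp [hz]⟩

theorem X_mem_intSeries : (X : ℚ⟦X⟧) ∈ intSeries := ⟨X, map_X _⟩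

theorem hasSum_mem_intSeries {ι : Type*} {f : ι → ℚ⟦X⟧} {e : ι → ℕ}
    (he : ∀ N, {i | e i ≤ N}.Finite) (hfe : ∀ i, X ^ e i ∣ f i) {a : ℚ⟦X⟧} (h : HasSum f a)
    (hf : ∀ i, f i ∈ intSeries) : a ∈ intSeries := by
  rw [mem_intSeries_iff]
  intro n
  choose z hz using fun i => mem_intSeries_iff.mp (hf i) n
  refine ⟨∑ i ∈ (he n).toFinset, z i, ?_⟩
  rw [coeff_hasSum_eq_sum h n (he n).toFinset fun i hi => ?_]
  · push_cast
    exact sum_congr rfl fun i _ => hz i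
  · refine X_pow_dvd_iff.mp (hfe i) n ?_
    simpa using hi

theorem exists_add_prime_mul {ι : Type*} {f : ι → ℚ⟦X⟧} {e : ι → ℕ} {ℓ : ℕ} (hℓ : ℓ.Prime)
    (he : ∀ N, {i | e i ≤ N}.Finite) (hfe : ∀ i, X ^ e i ∣ f i) (hf : ∀ i, f i ∈ intSeries)
    (m : ι → ℤ) {a b : ℚ⟦X⟧} (ha : HasSum (fun i => f i * (m i : ℚ⟦X⟧) ^ ℓ) a)
    (hb : HasSum (fun i => f i * (m i : ℚ⟦X⟧) ^ 1) b) : ∃ y ∈ intSeries, a = b + ℓ * y := by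
  have : Fact ℓ.Prime := ⟨hℓ⟩
  have hm : ∀ i, ∃ t : ℤ, m i ^ ℓ - m i = ℓ * t := fun i => by
    refine (ZMod.intCast_zmod_eq_zero_iff_dvd _ ℓ).mp ?_
    simp
  choose t ht using hm
  have hs : HasSum (fun i => f i * (t i : ℚ⟦X⟧)) _ :=
    (summable_of_X_pow_dvd he fun i => (hfe i).mul_right _).hasSum
  refine ⟨_, hasSum_mem_intSeries he (fun i => (hfe i).mul_right _) hs
    fun i => mul_mem (hf i) (intCast_mem _ _), ?_⟩
  refine ha.unique ((hb.add (hs.mul_left (ℓ : ℚ⟦X⟧))).congr_fun fun i => ?_)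
  have := congrArg (Int.cast : ℤ → ℚ⟦X⟧) (ht i)
  push_cast at this
  linear_combination f i * this

theorem thetaCoeff_mem_intSeries (n : ℤ) : thetaCoeff n ∈ intSeries :=
  mul_mem (intCast_mem _ _) (pow_mem X_mem_intSeries _)

theorem moment_mem_intSeries (k : ℕ) : moment k ∈ intSeries :=
  hasSum_mem_intSeries tri_finite (X_pow_tri_dvd k) (hasSum_moment k) fun n =>
    mul_mem (thetaCoeff_mem_intSeries n) (pow_mem (add_mem (mul_mem (ofNat_mem _ 2)
      (intCast_mem _ _)) (one_mem _)) _)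

theorem exists_moment_prime {ℓ : ℕ} (hℓ : ℓ.Prime) :
    ∃ y ∈ intSeries, moment ℓ = moment 1 + ℓ * y := by
  refine exists_add_prime_mul hℓ tri_finite X_pow_tri_dvd_thetaCoeff thetaCoeff_mem_intSeries
    (fun n => 2 * n + 1) ((hasSum_moment ℓ).congr_fun fun n => ?_)
    ((hasSum_moment 1).congr_fun fun n => ?_) <;> push_cast <;> rfl

theorem appellCoeff_mem_intSeries (i : ℕ) : appellCoeff i ∈ intSeries :=
  hasSum_mem_intSeries (e := fun n => pentExp i (n + 1))
    (fun N => (pentExp_finite i N).preimage (add_left_injective 1).injOn)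
    (fun _ => dvd_mul_left _ _) (hasSum_appellCoeff i) fun _ =>
    mul_mem (pow_mem (neg_mem (one_mem _)) _) (pow_mem X_mem_intSeries _)

/-- The moments of the sequence `appellCoeff`. -/
noncomputable def appellMoment (k : ℕ) : ℚ⟦X⟧ :=
  ∑' i : ℕ, appellCoeff i * (2 * (i : ℚ⟦X⟧) + 1) ^ k

theorem X_pow_dvd_appellMoment_term (k i : ℕ) :
    X ^ (i + 2) ∣ appellCoeff i * (2 * (i : ℚ⟦X⟧) + 1) ^ k :=
  (X_pow_dvd_appellCoeff i).mul_right _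

theorem hasSum_appellMoment (k : ℕ) :
    HasSum (fun i : ℕ => appellCoeff i * (2 * (i : ℚ⟦X⟧) + 1) ^ k) (appellMoment k) :=
  (summable_of_X_pow_dvd add_two_finite (X_pow_dvd_appellMoment_term k)).hasSum

theorem appellMoment_mem_intSeries (k : ℕ) : appellMoment k ∈ intSeries :=
  hasSum_mem_intSeries add_two_finite (X_pow_dvd_appellMoment_term k) (hasSum_appellMoment k)
    fun i => mul_mem (appellCoeff_mem_intSeries i) (pow_mem (add_mem (mul_mem (ofNat_mem _ 2)
      (natCast_mem _ _)) (one_mem _)) _)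

theorem exists_appellMoment_prime {ℓ : ℕ} (hℓ : ℓ.Prime) :
    ∃ y ∈ intSeries, appellMoment ℓ = appellMoment 1 + ℓ * y := by
  refine exists_add_prime_mul hℓ add_two_finite X_pow_dvd_appellCoeff appellCoeff_mem_intSeries
    (fun n => 2 * n + 1) ((hasSum_appellMoment ℓ).congr_fun fun n => ?_)
    ((hasSum_appellMoment 1).congr_fun fun n => ?_) <;> push_cast <;> rfl

theorem coeff_appellZ (k : ℕ) : coeff k appellZ
    = if Even k then 0 else 2 * (appellMoment k * C (1 / k.factorial : ℚ)) := by
  refine ((hasSum_iff_hasSum_coeff _).mp hasSum_appellZ k).unique ?_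
  split_ifs with hk
  · convert hasSum_zero using 2 with i
    rw [coeff_C_mul, map_sub, coeff_expZ, coeff_expZ]
    push_cast
    rw [hk.neg_pow, sub_self, mul_zero]
  · refine (((hasSum_appellMoment k).mul_right _).mul_left 2).congr_fun fun i => ?_
    rw [coeff_C_mul, map_sub, coeff_expZ, coeff_expZ]
    push_cast
    rw [(Nat.not_even_iff_odd.mp hk).neg_pow]
    ring

end Integrality

/-! ### Reduction modulo a prime -/

section Reduction

variable (ℓ : ℕ) [Fact ℓ.Prime]

/-- The series `x` is integral at `ℓ` and its reduction is `w`. -/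
def Red (x : ℚ⟦X⟧) (w : (ZMod ℓ)⟦X⟧) : Prop :=
  ∃ y : ℤ_[ℓ]⟦X⟧, PowerSeries.map PadicInt.Coe.ringHom y
      = PowerSeries.map (algebraMap ℚ ℚ_[ℓ]) x ∧ PowerSeries.map PadicInt.toZMod y = w

variable {ℓ} {x x' : ℚ⟦X⟧} {w w' : (ZMod ℓ)⟦X⟧}

theorem map_padicInt_injective :
    Function.Injective (PowerSeries.map (PadicInt.Coe.ringHom (p := ℓ))) :=
  PowerSeries.map_injective _ Subtype.coe_injective

theorem Red.unique (h : Red ℓ x w) (h' : Red ℓ x w') : w = w' := by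
  obtain ⟨y, hy, rfl⟩ := h
  obtain ⟨y', hy', rfl⟩ := h'
  rw [map_padicInt_injective (hy.trans hy'.symm)]

theorem Red.add (h : Red ℓ x w) (h' : Red ℓ x' w') : Red ℓ (x + x') (w + w') := by
  obtain ⟨y, hy, rfl⟩ := h
  obtain ⟨y', hy', rfl⟩ := h'
  exact ⟨y + y', by rw [map_add, map_add, hy, hy'], map_add _ _ _⟩

theorem Red.mul (h : Red ℓ x w) (h' : Red ℓ x' w') : Red ℓ (x * x') (w * w') := by
  obtain ⟨y, hy, rfl⟩ := h
  obtain ⟨y', hy', rfl⟩ := h'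
  exact ⟨y * y', by rw [map_mul, map_mul, hy, hy'], map_mul _ _ _⟩

theorem Red.neg (h : Red ℓ x w) : Red ℓ (-x) (-w) := by
  obtain ⟨y, hy, rfl⟩ := h
  exact ⟨-y, by rw [map_neg, map_neg, hy], map_neg _ _⟩

theorem Red.sub (h : Red ℓ x w) (h' : Red ℓ x' w') : Red ℓ (x - x') (w - w') := by
  rw [sub_eq_add_neg, sub_eq_add_neg]
  exact h.add h'.neg

theorem Red.qD (h : Red ℓ x w) : Red ℓ (qD ℚ x) (qD (ZMod ℓ) w) := by
  obtain ⟨y, hy, rfl⟩ := h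
  exact ⟨SptCongruence.qD _ y, by rw [map_qD, map_qD, hy], map_qD _ _⟩

theorem red_map_int (y : ℤ⟦X⟧) :
    Red ℓ (PowerSeries.map (Int.castRingHom ℚ) y)
      (PowerSeries.map (Int.castRingHom (ZMod ℓ)) y) := by
  refine ⟨PowerSeries.map (Int.castRingHom _) y, ?_, ?_⟩ <;> ext n <;> simp

theorem red_natCast (n : ℕ) : Red ℓ n n := by
  simpa using red_map_int (ℓ := ℓ) n

theorem red_zero : Red ℓ 0 0 := by simpa using red_natCast (ℓ := ℓ) 0

theorem red_one : Red ℓ 1 1 := by simpa using red_natCast (ℓ := ℓ) 1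

theorem Red.pow (h : Red ℓ x w) (n : ℕ) : Red ℓ (x ^ n) (w ^ n) := by
  obtain ⟨y, hy, rfl⟩ := h
  exact ⟨y ^ n, by rw [map_pow, map_pow, hy], map_pow _ _ _⟩

theorem red_sum {ι : Type*} {s : Finset ι} {x : ι → ℚ⟦X⟧} {w : ι → (ZMod ℓ)⟦X⟧}
    (h : ∀ i ∈ s, Red ℓ (x i) (w i)) : Red ℓ (∑ i ∈ s, x i) (∑ i ∈ s, w i) := by
  classical
  induction s using Finset.induction_on with
  | empty => simpa using red_zero
  | insert i s hi ih =>
    rw [sum_insert hi, sum_insert hi]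
    exact (h i (mem_insert_self i s)).add (ih fun j hj => h j (mem_insert_of_mem hj))

theorem red_eisP : Red ℓ (eisP ℚ) (eisP (ZMod ℓ)) := by
  simpa only [map_eisP] using red_map_int (ℓ := ℓ) (eisP ℤ)

theorem exists_red_of_mem_intSeries (h : x ∈ intSeries) : ∃ w, Red ℓ x w := by
  obtain ⟨y, rfl⟩ := h
  exact ⟨_, red_map_int y⟩

theorem red_inv (h : Red ℓ x w) (hw : constantCoeff w ≠ 0) : ∃ w', Red ℓ x⁻¹ w' := by
  obtain ⟨y, hy, rfl⟩ := h
  have hu : IsUnit y := by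
    rw [isUnit_iff_constantCoeff]
    by_contra hn
    refine hw ?_
    have : constantCoeff y ∈ IsLocalRing.maximalIdeal ℤ_[ℓ] := hn
    rw [← PadicInt.ker_toZMod, RingHom.mem_ker] at this
    rw [← coeff_zero_eq_constantCoeff_apply, coeff_map, coeff_zero_eq_constantCoeff_apply, this]
  obtain ⟨⟨y, y', h1, h2⟩, rfl⟩ := hu
  have hx : constantCoeff x ≠ 0 := by
    intro h0
    have h3 := congrArg constantCoeff hy
    have h4 := congrArg constantCoeff h1
    have h5 := congrArg (fun t => constantCoeff (PowerSeries.map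
      (PadicInt.Coe.ringHom (p := ℓ)) t)) h1
    simp only [map_mul, map_one] at h5
    rw [h3, ← coeff_zero_eq_constantCoeff_apply, coeff_map, coeff_zero_eq_constantCoeff_apply, h0,
      map_zero, zero_mul] at h5
    exact zero_ne_one h5
  refine ⟨_, y', ?_, rfl⟩
  have h3 := PowerSeries.mul_inv_cancel x hx
  have h4 := congrArg (PowerSeries.map (PadicInt.Coe.ringHom (p := ℓ))) h1
  have h5 := congrArg (PowerSeries.map (algebraMap ℚ ℚ_[ℓ])) h3
  rw [map_mul, map_one] at h4 h5
  rw [hy] at h4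
  linear_combination (PowerSeries.map (algebraMap ℚ ℚ_[ℓ]) x⁻¹) * h4
    - (PowerSeries.map PadicInt.Coe.ringHom y') * h5

theorem Red.of_natCast_mul {n : ℕ} (hn : (n : ZMod ℓ) ≠ 0) (h : Red ℓ (n * x) (n * w)) :
    Red ℓ x w := by
  have h0 : (n : ℚ) ≠ 0 := by
    rintro h0
    exact hn (by rw [Nat.cast_eq_zero.mp h0, Nat.cast_zero])
  obtain ⟨v, hv⟩ := red_inv (red_natCast (ℓ := ℓ) n) (by simpa using hn)
  have h1 : (n : ℚ⟦X⟧) * (n : ℚ⟦X⟧)⁻¹ = 1 := PowerSeries.mul_inv_cancel _ (by simpa using h0)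
  have h2 := (red_natCast n).mul hv
  rw [h1] at h2
  have h3 := h2.unique red_one
  convert hv.mul h using 1
  · linear_combination -x * h1
  · linear_combination -w * h3

theorem red_C_inv {n : ℕ} (hn : (n : ZMod ℓ) ≠ 0) :
    Red ℓ (C (1 / n : ℚ)) (C (1 / n : ZMod ℓ)) := by
  have h0 : (n : ℚ) ≠ 0 := by
    rintro h0
    exact hn (by rw [Nat.cast_eq_zero.mp h0, Nat.cast_zero])
  refine Red.of_natCast_mul hn ?_
  rw [← map_natCast (C (R := ℚ)), ← map_natCast (C (R := ZMod ℓ)), ← map_mul, ← map_mul,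
    mul_one_div_cancel h0, mul_one_div_cancel hn, map_one, map_one]
  exact red_one

theorem cast_factorial_ne_zero {n : ℕ} (h : n < ℓ) : (n.factorial : ZMod ℓ) ≠ 0 := by
  rw [Ne, ZMod.natCast_eq_zero_iff, (Fact.out : ℓ.Prime).dvd_factorial]
  omega

theorem Red.factorial_mul (h : Red ℓ x w) : Red ℓ (ℓ.factorial * x) 0 := by
  have := (red_natCast (ℓ := ℓ) ℓ.factorial).mul h
  rwa [← map_natCast (C (R := ZMod ℓ)), (ZMod.natCast_eq_zero_iff _ _).mpr
    (Nat.dvd_factorial (Fact.out : ℓ.Prime).pos le_rfl), map_zero, zero_mul] at this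

theorem Red.prime_mul (h : Red ℓ x w) : Red ℓ (ℓ * x) 0 := by
  have := (red_natCast (ℓ := ℓ) ℓ).mul h
  rwa [← map_natCast (C (R := ZMod ℓ)), ZMod.natCast_self, map_zero, zero_mul] at this

end Reduction

/-! ### Algebraic independence of the Eisenstein series -/

section Injectivity

theorem coeff_sigmaSeries_zero (R : Type*) [CommRing R] : coeff 0 (sigmaSeries R) = 0 := by
  simp [sigmaSeries]

theorem coeff_sigmaSeries_one (R : Type*) [CommRing R] : coeff 1 (sigmaSeries R) = 1 := by
  simp [sigmaSeries]

theorem coeff_one_mul' {R : Type*} [CommRing R] (f g : R⟦X⟧) :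
    coeff 1 (f * g) = coeff 1 f * constantCoeff g + constantCoeff f * coeff 1 g := by
  rw [coeff_mul, Finset.Nat.sum_antidiagonal_eq_sum_range_succ_mk, sum_range_succ, sum_range_one,
    coeff_zero_eq_constantCoeff_apply, coeff_zero_eq_constantCoeff_apply]
  ring

theorem constantCoeff_qD {R : Type*} [CommRing R] (f : R⟦X⟧) : constantCoeff (qD R f) = 0 := by
  rw [← coeff_zero_eq_constantCoeff_apply, coeff_qD, Nat.cast_zero, zero_mul]

variable (K : Type*) [CommRing K]

theorem constantCoeff_eisP : constantCoeff (eisP K) = 1 := by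
  have := coeff_sigmaSeries_zero K
  rw [coeff_zero_eq_constantCoeff_apply] at this
  rw [eisP, map_sub, map_mul, this, map_one, mul_zero, sub_zero]

theorem coeff_one_eisP : coeff 1 (eisP K) = -24 := by
  rw [eisP, map_sub, ← map_ofNat (C (R := K)), coeff_C_mul, coeff_sigmaSeries_one, coeff_one]
  norm_num

theorem constantCoeff_eisQ : constantCoeff (eisQ K) = 1 := by
  rw [eisQ, map_sub, map_mul, map_pow, constantCoeff_eisP, constantCoeff_qD]
  ring

theorem coeff_one_eisQ : coeff 1 (eisQ K) = 240 := by
  rw [eisQ, map_sub, pow_two, ← map_ofNat (C (R := K)), coeff_C_mul, coeff_one_mul', coeff_qD,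
    constantCoeff_eisP, coeff_one_eisP]
  norm_num

theorem constantCoeff_eisR : constantCoeff (eisR K) = 1 := by
  rw [eisR, map_sub, map_mul, map_mul, constantCoeff_eisP, constantCoeff_eisQ, constantCoeff_qD]
  ring

theorem coeff_one_eisR : coeff 1 (eisR K) = -504 := by
  rw [eisR, map_sub, ← map_ofNat (C (R := K)), coeff_C_mul, coeff_one_mul', coeff_qD,
    constantCoeff_eisP, coeff_one_eisP, constantCoeff_eisQ, coeff_one_eisQ]
  norm_num

theorem coeff_one_discriminant : coeff 1 (eisQ K ^ 3 - eisR K ^ 2) = 1728 := by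
  rw [map_sub, pow_two, pow_three, coeff_one_mul', coeff_one_mul', coeff_one_mul', map_mul,
    constantCoeff_eisQ, coeff_one_eisQ, constantCoeff_eisR, coeff_one_eisR]
  norm_num

/-- The constant terms of the values of `gradedEval`. -/
noncomputable def cuspEval : MvPolynomial (Fin 2) K →ₐ[K] Polynomial K :=
  MvPolynomial.aeval ![Polynomial.X ^ 4, Polynomial.X ^ 6]

theorem cuspEval_X_zero : cuspEval K (MvPolynomial.X 0) = Polynomial.X ^ 4 := by
  simp [cuspEval]

theorem cuspEval_X_one : cuspEval K (MvPolynomial.X 1) = Polynomial.X ^ 6 := by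
  simp [cuspEval]

theorem map_constantCoeff_gradedEval (f : MvPolynomial (Fin 2) K) :
    PowerSeries.map constantCoeff (gradedEval K f) = (cuspEval K f : K⟦X⟧) := by
  have : (PowerSeries.map constantCoeff).comp (gradedEval K)
      = Polynomial.coeToPowerSeries.ringHom.comp (cuspEval K).toRingHom := by
    refine MvPolynomial.ringHom_ext (fun c => ?_) (fun i => ?_)
    · simp [gradedEval_C]
    · fin_cases i
      · simp [gradedEval_X_zero, cuspEval_X_zero, constantCoeff_eisQ]
      · simp [gradedEval_X_one, cuspEval_X_one, constantCoeff_eisR]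
  exact congrArg (fun g => g f) this

/-- The discriminant polynomial. -/
noncomputable def discPoly : MvPolynomial (Fin 2) K := MvPolynomial.X 0 ^ 3 - MvPolynomial.X 1 ^ 2

theorem gradedEval_discPoly :
    gradedEval K (discPoly K) = C (eisQ K ^ 3 - eisR K ^ 2) * X ^ 12 := by
  rw [discPoly, map_sub, map_pow, map_pow, gradedEval_X_zero, gradedEval_X_one, map_sub, map_pow,
    map_pow]
  ring

theorem exists_eq_discPoly_mul_add (f : MvPolynomial (Fin 2) K) :
    ∃ (g : MvPolynomial (Fin 2) K) (a b : Polynomial K), f = discPoly K * g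
      + Polynomial.aeval (MvPolynomial.X 0) a
      + Polynomial.aeval (MvPolynomial.X 0) b * MvPolynomial.X 1 := by
  induction f using MvPolynomial.induction_on with
  | C c => exact ⟨0, Polynomial.C c, 0, by simp [MvPolynomial.algebraMap_eq]⟩
  | add p q hp hq =>
    obtain ⟨g, a, b, hp⟩ := hp
    obtain ⟨g', a', b', hq⟩ := hq
    refine ⟨g + g', a + a', b + b', ?_⟩
    rw [hp, hq, map_add, map_add]
    ring
  | mul_X p i hp =>
    obtain ⟨g, a, b, hp⟩ := hp
    fin_cases i
    · refine ⟨g * MvPolynomial.X 0, a * Polynomial.X, b * Polynomial.X, ?_⟩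
      simp only [Fin.zero_eta, map_mul, Polynomial.aeval_X]
      rw [hp]
      ring
    · refine ⟨g * MvPolynomial.X 1 - Polynomial.aeval (MvPolynomial.X 0) b,
        b * Polynomial.X ^ 3, a, ?_⟩
      simp only [Fin.mk_one, map_mul, map_pow, Polynomial.aeval_X]
      rw [hp, discPoly]
      ring

theorem cuspEval_aeval (a : Polynomial K) :
    cuspEval K (Polynomial.aeval (MvPolynomial.X 0) a) = Polynomial.expand K 4 a := by
  rw [← Polynomial.aeval_algHom_apply, cuspEval_X_zero, Polynomial.expand_eq_sum,
    Polynomial.aeval_def, Polynomial.eval₂_eq_sum]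
  rfl

theorem discPoly_dvd_of_cuspEval_eq_zero {f : MvPolynomial (Fin 2) K} (h : cuspEval K f = 0) :
    discPoly K ∣ f := by
  obtain ⟨g, a, b, rfl⟩ := exists_eq_discPoly_mul_add K f
  have hd : cuspEval K (discPoly K) = 0 := by
    rw [discPoly, map_sub, map_pow, map_pow, cuspEval_X_zero, cuspEval_X_one]
    ring
  rw [map_add, map_add, map_mul, map_mul, hd, zero_mul, zero_add, cuspEval_aeval, cuspEval_aeval,
    cuspEval_X_one] at h
  have ha : a = 0 := by
    ext n
    have := congrArg (fun p => Polynomial.coeff p (n * 4)) h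
    simp only [Polynomial.coeff_add, Polynomial.coeff_expand_mul (show 0 < 4 by norm_num),
      Polynomial.coeff_mul_X_pow', Polynomial.coeff_expand (show 0 < 4 by norm_num),
      Polynomial.coeff_zero] at this
    split_ifs at this
    · omega
    all_goals simpa using this
  rw [ha, map_zero, zero_add] at h
  have hb : b = 0 := by
    rw [← Polynomial.expand_eq_zero (show 0 < 4 by norm_num)]
    exact Polynomial.mul_X_pow_eq_zero h
  rw [ha, hb, map_zero, zero_mul, add_zero, add_zero]
  exact dvd_mul_right _ _

theorem discPoly_ne_zero [Nontrivial K] : discPoly K ≠ 0 := by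
  intro h
  have := congrArg (MvPolynomial.eval ![1, 0]) h
  simp [discPoly] at this

theorem one_le_totalDegree_discPoly [IsDomain K] : 1 ≤ (discPoly K).totalDegree := by
  by_contra hd
  have h1 := MvPolynomial.totalDegree_eq_zero_iff_eq_C.mp
    (show (discPoly K).totalDegree = 0 by omega)
  have h2 := congrArg (MvPolynomial.eval ![1, 0]) h1
  have h3 := congrArg (MvPolynomial.eval ![0, 0]) h1
  simp only [MvPolynomial.eval_C] at h2 h3
  rw [← h3] at h2
  simp [discPoly] at h2

theorem gradedEval_injective [IsDomain K] (h : (1728 : K) ≠ 0) :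
    Function.Injective (gradedEval K) := by
  rw [injective_iff_map_eq_zero]
  intro f hf
  by_contra hf0
  induction hd : f.totalDegree using Nat.strong_induction_on generalizing f with
  | _ d ih =>
    have h1 : cuspEval K f = 0 := by
      have := map_constantCoeff_gradedEval K f
      rw [hf, map_zero] at this
      exact_mod_cast this.symm
    obtain ⟨g, rfl⟩ := discPoly_dvd_of_cuspEval_eq_zero K h1
    have hg0 := right_ne_zero_of_mul hf0
    have h2 : gradedEval K (discPoly K) ≠ 0 := by
      rw [gradedEval_discPoly]
      refine mul_ne_zero ?_ (pow_ne_zero _ X_ne_zero)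
      intro h0
      refine h ?_
      rw [← coeff_one_discriminant, (map_eq_zero_iff C C_injective).mp h0, map_zero]
    rw [map_mul] at hf
    rw [MvPolynomial.totalDegree_mul_of_isDomain (discPoly_ne_zero K) hg0] at hd
    have := one_le_totalDegree_discPoly K
    exact ih g.totalDegree (by omega) g ((mul_eq_zero.mp hf).resolve_left h2) hg0 rfl

end Injectivity

/-! ### Reduction of modular forms -/

section ModularReduction

theorem map_gradedEval {K L : Type*} [CommRing K] [CommRing L] (φ : K →+* L)
    (f : MvPolynomial (Fin 2) K) : PowerSeries.map (PowerSeries.map φ) (gradedEval K f)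
      = gradedEval L (MvPolynomial.map φ f) := by
  have : (PowerSeries.map (PowerSeries.map φ)).comp (gradedEval K)
      = (gradedEval L).comp (MvPolynomial.map φ) := by
    refine MvPolynomial.ringHom_ext (fun c => ?_) (fun i => ?_)
    · simp [gradedEval_C]
    · fin_cases i
      · simp [gradedEval_X_zero, map_eisQ]
      · simp [gradedEval_X_one, map_eisR]
  exact congrArg (fun g => g f) this

theorem exists_integer_multiple (f : MvPolynomial (Fin 2) ℚ) :
    ∃ (n : ℕ) (g : MvPolynomial (Fin 2) ℤ), n ≠ 0 ∧
      MvPolynomial.map (Int.castRingHom ℚ) g = n * f := by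
  induction f using MvPolynomial.induction_on with
  | C c =>
    refine ⟨c.den, MvPolynomial.C c.num, c.den_nz, ?_⟩
    rw [MvPolynomial.map_C, ← map_natCast (MvPolynomial.C (R := ℚ)), ← map_mul]
    congr 1
    rw [mul_comm, eq_intCast, Rat.mul_den_eq_num]
  | add p q hp hq =>
    obtain ⟨n, g, hn, hp⟩ := hp
    obtain ⟨m, h, hm, hq⟩ := hq
    refine ⟨n * m, m * g + n * h, mul_ne_zero hn hm, ?_⟩
    rw [map_add, map_mul, map_mul, hp, hq, map_natCast, map_natCast]
    push_cast
    ring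
  | mul_X p i hp =>
    obtain ⟨n, g, hn, hp⟩ := hp
    exact ⟨n, g * MvPolynomial.X i, hn, by rw [map_mul, hp, MvPolynomial.map_X, mul_assoc]⟩

variable {ℓ : ℕ} [Fact ℓ.Prime]

theorem natCast_zmod_ne_zero_of_lt {n : ℕ} (h0 : n ≠ 0) (h : n < ℓ) : (n : ZMod ℓ) ≠ 0 := by
  rw [Ne, ZMod.natCast_eq_zero_iff]
  exact Nat.not_dvd_of_pos_of_lt (Nat.pos_of_ne_zero h0) h

theorem two_ne_zero_zmod (h5 : 5 ≤ ℓ) : (2 : ZMod ℓ) ≠ 0 := by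
  exact_mod_cast natCast_zmod_ne_zero_of_lt two_ne_zero (by omega)

theorem three_ne_zero_zmod (h5 : 5 ≤ ℓ) : (3 : ZMod ℓ) ≠ 0 := by
  exact_mod_cast natCast_zmod_ne_zero_of_lt three_ne_zero (by omega)

theorem gradedEval_zmod_injective (h5 : 5 ≤ ℓ) : Function.Injective (gradedEval (ZMod ℓ)) := by
  refine gradedEval_injective _ ?_
  rw [show (1728 : ZMod ℓ) = 2 ^ 6 * 3 ^ 3 by norm_num]
  exact mul_ne_zero (pow_ne_zero _ (two_ne_zero_zmod h5)) (pow_ne_zero _ (three_ne_zero_zmod h5))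

theorem isModular_map_of_pow_mul (h5 : 5 ≤ ℓ) {k : ℕ} (y : ℤ_[ℓ]⟦X⟧) (M : ℕ)
    (g : MvPolynomial (Fin 2) ℤ_[ℓ])
    (hg : gradedEval ℤ_[ℓ] g = C ((ℓ : ℤ_[ℓ]⟦X⟧) ^ M * y) * X ^ k) :
    IsModular (ZMod ℓ) k (PowerSeries.map PadicInt.toZMod y) := by
  have h := congrArg (PowerSeries.map (PowerSeries.map PadicInt.toZMod)) hg
  rw [map_gradedEval, map_mul, map_pow (PowerSeries.map _) X, map_X, map_C, RingHom.map_mul,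
    map_pow, map_natCast] at h
  induction M generalizing g with
  | zero => exact ⟨_, by rw [h, pow_zero, one_mul]⟩
  | succ M ih =>
    have h0 : (ℓ : (ZMod ℓ)⟦X⟧) = 0 := by
      rw [← map_natCast (C (R := ZMod ℓ)), ZMod.natCast_self, map_zero]
    rw [h0, zero_pow (Nat.succ_ne_zero M), zero_mul, map_zero, zero_mul,
      map_eq_zero_iff _ (gradedEval_zmod_injective h5)] at h
    have h1 : MvPolynomial.C (ℓ : ℤ_[ℓ]) ∣ g := by
      rw [MvPolynomial.C_dvd_iff_dvd_coeff]
      intro m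
      have h2 := congrArg (MvPolynomial.coeff m) h
      rw [MvPolynomial.coeff_map, MvPolynomial.coeff_zero, ← RingHom.mem_ker,
        PadicInt.ker_toZMod, PadicInt.maximalIdeal_eq_span_p, Ideal.mem_span_singleton] at h2
      exact h2
    obtain ⟨g, rfl⟩ := h1
    have hg' : gradedEval ℤ_[ℓ] g = C ((ℓ : ℤ_[ℓ]⟦X⟧) ^ M * y) * X ^ k := by
      have hc : (C (C (ℓ : ℤ_[ℓ])) : ℤ_[ℓ]⟦X⟧⟦X⟧) ≠ 0 := by
        rw [Ne, map_eq_zero_iff _ C_injective, map_eq_zero_iff _ C_injective]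
        exact PadicInt.prime_p.ne_zero
      refine mul_left_cancel₀ hc ?_
      rw [map_mul (gradedEval _), gradedEval_C] at hg
      rw [hg, map_natCast, ← mul_assoc, ← map_mul, pow_succ]
      congr 2
      ring
    refine ih g hg' ?_
    have h := congrArg (PowerSeries.map (PowerSeries.map PadicInt.toZMod)) hg'
    rwa [map_gradedEval, map_mul, map_pow (PowerSeries.map _) X, map_X, map_C, RingHom.map_mul,
      map_pow, map_natCast] at h

theorem IsModular.red (h5 : 5 ≤ ℓ) {k : ℕ} {x : ℚ⟦X⟧} {w : (ZMod ℓ)⟦X⟧} (hx : IsModular ℚ k x)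
    (h : Red ℓ x w) : IsModular (ZMod ℓ) k w := by
  obtain ⟨f, hf⟩ := hx
  obtain ⟨y, hy, rfl⟩ := h
  obtain ⟨n, g, hn, hg⟩ := exists_integer_multiple f
  obtain ⟨M, u, hu, rfl⟩ := Nat.exists_eq_pow_mul_and_not_dvd hn ℓ (Fact.out : ℓ.Prime).ne_one
  have h1 : gradedEval ℤ_[ℓ] (MvPolynomial.map (Int.castRingHom _) g)
      = C ((ℓ : ℤ_[ℓ]⟦X⟧) ^ M * (u * y)) * X ^ k := by
    refine PowerSeries.map_injective _ (map_padicInt_injective (ℓ := ℓ)) ?_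
    have h2 := congrArg (gradedEval ℚ) hg
    rw [map_mul, hf] at h2
    have h3 := congrArg (PowerSeries.map (PowerSeries.map (algebraMap ℚ ℚ_[ℓ]))) h2
    rw [map_gradedEval, MvPolynomial.map_map] at h3
    rw [map_gradedEval, MvPolynomial.map_map]
    rw [Subsingleton.elim ((PadicInt.Coe.ringHom).comp (Int.castRingHom ℤ_[ℓ]))
      ((algebraMap ℚ ℚ_[ℓ]).comp (Int.castRingHom ℚ)), h3]
    simp only [map_mul, map_pow, map_natCast, map_C, map_X, hy]
    push_cast
    ring
  have h2 := (isModular_map_of_pow_mul h5 _ M _ h1).C_mul (u : ZMod ℓ)⁻¹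
  have hu' : (u : ZMod ℓ) ≠ 0 := by rwa [Ne, ZMod.natCast_eq_zero_iff]
  rwa [map_mul, map_natCast, ← map_natCast (C (R := ZMod ℓ)), ← mul_assoc, ← map_mul,
    inv_mul_cancel₀ hu', map_one, one_mul] at h2

end ModularReduction

/-! ### Reduction of the coefficients of order `ℓ - 1` and `ℓ + 1` -/

section Truncation

variable {ℓ : ℕ} [Fact ℓ.Prime] {r : ℕ}

variable (ℓ r) in
/-- An even series in the outer variable, integral at `ℓ = 2r + 1` in degrees less than `2r`,
together with the reductions of its coefficients of degrees `0`, `2` and those of `ℓ!` times its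
coefficients of degrees `2r`, `2r + 2`. -/
structure TruncRed (F : ℚ⟦X⟧⟦X⟧) (f₀ f₂ a b : (ZMod ℓ)⟦X⟧) : Prop where
  odd : ∀ k, Odd k → coeff k F = 0
  integral : ∀ k < 2 * r, ∃ w, Red ℓ (coeff k F) w
  zero : Red ℓ (coeff 0 F) f₀
  two : Red ℓ (coeff 2 F) f₂
  fst : Red ℓ (ℓ.factorial * coeff (2 * r) F) a
  snd : Red ℓ (ℓ.factorial * coeff (2 * r + 2) F) b

variable {F G : ℚ⟦X⟧⟦X⟧} {f₀ f₂ a b g₀ g₂ a' b' : (ZMod ℓ)⟦X⟧}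

theorem coeff_eq_sum_range {R : Type*} [CommRing R] (F G : R⟦X⟧) (k : ℕ) :
    coeff k (F * G) = ∑ i ∈ range (k + 1), coeff i F * coeff (k - i) G := by
  rw [coeff_mul, Finset.Nat.sum_antidiagonal_eq_sum_range_succ_mk]

theorem exists_red_sum {ι : Type*} {s : Finset ι} {x : ι → ℚ⟦X⟧} (h : ∀ i ∈ s, ∃ w, Red ℓ (x i) w) :
    ∃ w, Red ℓ (∑ i ∈ s, x i) w := by
  choose! w hw using h
  exact ⟨_, red_sum hw⟩

theorem coeff_mul_of_odd {R : Type*} [CommRing R] {F G : R⟦X⟧} (hF : ∀ k, Odd k → coeff k F = 0)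
    (hG : ∀ k, Odd k → coeff k G = 0) (k : ℕ) (hk : Odd k) : coeff k (F * G) = 0 := by
  rw [coeff_eq_sum_range]
  refine sum_eq_zero fun i hi => ?_
  rcases Nat.even_or_odd i with he | ho
  · rw [hG, mul_zero]
    exact Nat.Odd.sub_even (by simpa [Nat.lt_succ_iff] using hi) hk he
  · rw [hF i ho, zero_mul]

theorem TruncRed.add (hF : TruncRed ℓ r F f₀ f₂ a b) (hG : TruncRed ℓ r G g₀ g₂ a' b') :
    TruncRed ℓ r (F + G) (f₀ + g₀) (f₂ + g₂) (a + a') (b + b') where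
  odd k hk := by rw [map_add, hF.odd k hk, hG.odd k hk, add_zero]
  integral k hk := by
    obtain ⟨w, hw⟩ := hF.integral k hk
    obtain ⟨w', hw'⟩ := hG.integral k hk
    exact ⟨w + w', by rw [map_add]; exact hw.add hw'⟩
  zero := by rw [map_add]; exact hF.zero.add hG.zero
  two := by rw [map_add]; exact hF.two.add hG.two
  fst := by rw [map_add, mul_add]; exact hF.fst.add hG.fst
  snd := by rw [map_add, mul_add]; exact hF.snd.add hG.snd

theorem TruncRed.mul (hr : 2 ≤ r) (hF : TruncRed ℓ r F f₀ f₂ a b)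
    (hG : TruncRed ℓ r G g₀ g₂ a' b') : TruncRed ℓ r (F * G) (f₀ * g₀) (f₀ * g₂ + f₂ * g₀)
      (f₀ * a' + a * g₀) (f₀ * b' + f₂ * a' + a * g₂ + b * g₀) where
  odd := coeff_mul_of_odd hF.odd hG.odd
  integral k hk := by
    rw [coeff_eq_sum_range]
    refine exists_red_sum fun i hi => ?_
    have := mem_range.mp hi
    obtain ⟨w, hw⟩ := hF.integral i (by omega)
    obtain ⟨w', hw'⟩ := hG.integral (k - i) (by omega)
    exact ⟨_, hw.mul hw'⟩
  zero := by
    rw [coeff_eq_sum_range, sum_range_one]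
    exact hF.zero.mul hG.zero
  two := by
    rw [coeff_eq_sum_range, sum_range_succ, sum_range_succ, sum_range_one, hF.odd 1 odd_one,
      zero_mul, add_zero]
    exact (hF.zero.mul hG.two).add (hF.two.mul hG.zero)
  fst := by
    have hw : f₀ * a' + a * g₀ = ∑ i ∈ range (2 * r + 1),
        ((if i = 0 then f₀ * a' else 0) + if i = 2 * r then a * g₀ else 0) := by
      rw [sum_add_distrib, sum_ite_eq', sum_ite_eq', if_pos (by simp), if_pos (by simp)]
    rw [coeff_eq_sum_range, mul_sum, hw]
    refine red_sum fun i hi => ?_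
    have hi := mem_range.mp hi
    obtain rfl | rfl | ⟨h1, h2⟩ : i = 0 ∨ i = 2 * r ∨ (i ≠ 0 ∧ i ≠ 2 * r) := by omega
    · rw [if_pos rfl, if_neg (by omega), add_zero, mul_left_comm]
      exact hF.zero.mul hG.fst
    · rw [if_neg (by omega), if_pos rfl, zero_add, ← mul_assoc, Nat.sub_self]
      exact hF.fst.mul hG.zero
    · rw [if_neg h1, if_neg h2, add_zero]
      obtain ⟨w, hw⟩ := hF.integral i (by omega)
      obtain ⟨w', hw'⟩ := hG.integral (2 * r - i) (by omega)
      exact (hw.mul hw').factorial_mul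
  snd := by
    have hw : f₀ * b' + f₂ * a' + a * g₂ + b * g₀ = ∑ i ∈ range (2 * r + 2 + 1),
        ((if i = 0 then f₀ * b' else 0) + (if i = 2 then f₂ * a' else 0)
          + (if i = 2 * r then a * g₂ else 0) + if i = 2 * r + 2 then b * g₀ else 0) := by
      simp only [sum_add_distrib, sum_ite_eq']
      rw [if_pos (by simp), if_pos (by simp), if_pos (by simp), if_pos (by simp)]
    rw [coeff_eq_sum_range, mul_sum, hw]
    refine red_sum fun i hi => ?_
    have hi := mem_range.mp hi
    obtain rfl | rfl | rfl | rfl | ⟨h1, h2, h3, h4⟩ : i = 0 ∨ i = 2 ∨ i = 2 * r ∨ i = 2 * r + 2 ∨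
      (i ≠ 0 ∧ i ≠ 2 ∧ i ≠ 2 * r ∧ i ≠ 2 * r + 2) := by omega
    · rw [if_pos rfl, if_neg (by omega), if_neg (by omega), if_neg (by omega), add_zero, add_zero,
        add_zero, mul_left_comm]
      exact hF.zero.mul hG.snd
    · rw [if_neg (by omega), if_pos rfl, if_neg (by omega), if_neg (by omega), add_zero, add_zero,
        zero_add, mul_left_comm]
      exact hF.two.mul hG.fst
    · rw [if_neg (by omega), if_neg (by omega), if_pos rfl, if_neg (by omega), add_zero, zero_add,
        zero_add, ← mul_assoc, Nat.add_sub_cancel_left]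
      exact hF.fst.mul hG.two
    · rw [if_neg (by omega), if_neg (by omega), if_neg (by omega), if_pos rfl, add_zero, zero_add,
        zero_add, ← mul_assoc, Nat.sub_self]
      exact hF.snd.mul hG.zero
    · rw [if_neg h1, if_neg h2, if_neg h3, if_neg h4, add_zero, add_zero, add_zero]
      rcases Nat.even_or_odd i with he | ho
      · obtain ⟨j, rfl⟩ := he
        obtain ⟨w, hw⟩ := hF.integral (j + j) (by omega)
        obtain ⟨w', hw'⟩ := hG.integral (2 * r + 2 - (j + j)) (by omega)
        exact (hw.mul hw').factorial_mul
      · rw [hF.odd i ho, zero_mul, mul_zero]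
        exact red_zero

theorem TruncRed.neg (hF : TruncRed ℓ r F f₀ f₂ a b) :
    TruncRed ℓ r (-F) (-f₀) (-f₂) (-a) (-b) where
  odd k hk := by rw [map_neg, hF.odd k hk, neg_zero]
  integral k hk := by
    obtain ⟨w, hw⟩ := hF.integral k hk
    exact ⟨-w, by rw [map_neg]; exact hw.neg⟩
  zero := by rw [map_neg]; exact hF.zero.neg
  two := by rw [map_neg]; exact hF.two.neg
  fst := by rw [map_neg, mul_neg]; exact hF.fst.neg
  snd := by rw [map_neg, mul_neg]; exact hF.snd.neg

/-- A series all of whose relevant coefficients are integral. -/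
theorem truncRed_of_integral (h : ∀ k, Odd k → coeff k F = 0)
    (hi : ∀ k ≤ 2 * r + 2, ∃ w, Red ℓ (coeff k F) w) (h0 : Red ℓ (coeff 0 F) f₀)
    (h2 : Red ℓ (coeff 2 F) f₂) : TruncRed ℓ r F f₀ f₂ 0 0 where
  odd := h
  integral k hk := hi k (by omega)
  zero := h0
  two := h2
  fst := by
    obtain ⟨w, hw⟩ := hi (2 * r) (by omega)
    exact hw.factorial_mul
  snd := by
    obtain ⟨w, hw⟩ := hi (2 * r + 2) (by omega)
    exact hw.factorial_mul

theorem coeff_of_mul_eq_one {R : Type*} [CommRing R] {F G : R⟦X⟧} (h : F * G = 1)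
    (h0 : coeff 0 F = 1) (k : ℕ) :
    coeff k G = coeff k 1 - ∑ i ∈ range k, coeff (i + 1) F * coeff (k - (i + 1)) G := by
  have h1 := congrArg (coeff k) h
  rw [coeff_eq_sum_range, sum_range_succ', h0, one_mul, Nat.sub_zero] at h1
  linear_combination h1

theorem TruncRed.exists_of_mul_eq_one (hr : 2 ≤ r) (hF : TruncRed ℓ r F f₀ f₂ a b)
    (h : F * G = 1) (h0 : coeff 0 F = 1) : ∃ g₂ a' b', TruncRed ℓ r G 1 g₂ a' b' := by
  have hG0 : coeff 0 G = 1 := by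
    rw [coeff_of_mul_eq_one h h0, range_zero, sum_empty, sub_zero, coeff_zero_one]
  have hodd : ∀ k, Odd k → coeff k G = 0 := by
    intro k
    induction k using Nat.strong_induction_on with
    | _ k ih =>
      intro hk
      rw [coeff_of_mul_eq_one h h0, coeff_one, if_neg (by rintro rfl; simp at hk), zero_sub,
        neg_eq_zero]
      refine sum_eq_zero fun i hi => ?_
      have hi := mem_range.mp hi
      rcases Nat.even_or_odd (i + 1) with he | ho
      · rw [ih (k - (i + 1)) (by omega) (Nat.Odd.sub_even (by omega) hk he), mul_zero]
      · rw [hF.odd _ ho, zero_mul]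
  have hone : ∀ k, ∃ w, Red ℓ (coeff k 1) w := by
    intro k
    rw [coeff_one]
    split_ifs
    exacts [⟨_, red_one⟩, ⟨_, red_zero⟩]
  have hred : ∀ k < 2 * r, ∃ w, Red ℓ (coeff k G) w := by
    intro k
    induction k using Nat.strong_induction_on with
    | _ k ih =>
      intro hk
      have hs : ∃ w, Red ℓ (∑ i ∈ range k, coeff (i + 1) F * coeff (k - (i + 1)) G) w :=
        exists_red_sum fun i hi => by
          have hi := mem_range.mp hi
          obtain ⟨w, hw⟩ := hF.integral (i + 1) (by omega)
          obtain ⟨w', hw'⟩ := ih (k - (i + 1)) (by omega) (by omega)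
          exact ⟨_, hw.mul hw'⟩
      obtain ⟨v, hv⟩ := hone k
      obtain ⟨w, hw⟩ := hs
      rw [coeff_of_mul_eq_one h h0]
      exact ⟨_, hv.sub hw⟩
  have hF' : ∀ k ≤ 2 * r + 2, ∃ w, Red ℓ (ℓ.factorial * coeff k F) w := by
    intro k hk
    obtain hk | rfl | rfl | rfl : k < 2 * r ∨ k = 2 * r ∨ k = 2 * r + 1 ∨ k = 2 * r + 2 := by omega
    · obtain ⟨w, hw⟩ := hF.integral k hk
      exact ⟨_, hw.factorial_mul⟩
    · exact ⟨_, hF.fst⟩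
    · exact ⟨0, by rw [hF.odd _ (by simp), mul_zero]; exact red_zero⟩
    · exact ⟨_, hF.snd⟩
  have hG' : ∀ k ≤ 2 * r + 2, ∃ w, Red ℓ (ℓ.factorial * coeff k G) w := by
    intro k
    induction k using Nat.strong_induction_on with
    | _ k ih =>
      intro hk
      have hterm : ∀ i ∈ range k, ∃ w,
          Red ℓ (ℓ.factorial * (coeff (i + 1) F * coeff (k - (i + 1)) G)) w := by
        intro i hi
        have hi := mem_range.mp hi
        by_cases hir : i + 1 < 2 * r
        · obtain ⟨w, hw⟩ := hF.integral _ hir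
          obtain ⟨w', hw'⟩ := ih (k - (i + 1)) (by omega) (by omega)
          exact ⟨w * w', by rw [mul_left_comm]; exact hw.mul hw'⟩
        · obtain ⟨w, hw⟩ := hF' (i + 1) (by omega)
          obtain ⟨w', hw'⟩ := hred (k - (i + 1)) (by omega)
          exact ⟨w * w', by rw [← mul_assoc]; exact hw.mul hw'⟩
      obtain ⟨w, hw⟩ := exists_red_sum hterm
      obtain ⟨v, hv⟩ := hone k
      rw [coeff_of_mul_eq_one h h0, mul_sub, mul_sum]
      exact ⟨_, hv.factorial_mul.sub hw⟩
  obtain ⟨g₂, h2⟩ := hred 2 (by omega)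
  obtain ⟨a', ha⟩ := hG' (2 * r) (by omega)
  obtain ⟨b', hb⟩ := hG' (2 * r + 2) le_rfl
  exact ⟨g₂, a', b', hodd, hred, by rw [hG0]; exact red_one, h2, ha, hb⟩

end Truncation

/-! ### Modular forms of weight `ℓ - 1` and `ℓ + 1` modulo `ℓ` -/

section PrimeWeights

theorem natCast_mul_C_inv {K : Type*} [Field K] {n : ℕ} (hn : (n : K) ≠ 0) :
    (n : K⟦X⟧) * C (1 / n : K) = 1 := by
  rw [← map_natCast (C (R := K)), ← map_mul, mul_one_div_cancel hn, map_one]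

theorem factorial_mul_C_inv (n : ℕ) : (n.factorial : ℚ⟦X⟧) * C (1 / n.factorial : ℚ) = 1 :=
  natCast_mul_C_inv (by exact_mod_cast Nat.factorial_ne_zero n)

variable {ℓ : ℕ} [Fact ℓ.Prime] {r : ℕ}

theorem red_factorial_mul_C_inv (h5 : 5 ≤ ℓ) :
    Red ℓ ((ℓ.factorial : ℚ⟦X⟧) * C (1 / (ℓ + 2).factorial : ℚ)) (C (1 / 2 : ZMod ℓ)) := by
  have h1 : (((ℓ + 2) * (ℓ + 1) : ℕ) : ZMod ℓ) = 2 := by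
    push_cast
    rw [ZMod.natCast_self]
    ring
  have h2 := red_C_inv (ℓ := ℓ) (n := (ℓ + 2) * (ℓ + 1)) (by rw [h1]; exact two_ne_zero_zmod h5)
  rw [h1] at h2
  convert h2 using 1
  rw [natCast_eq_C, ← map_mul, Nat.factorial_succ, Nat.factorial_succ]
  congr 1
  have := Nat.factorial_ne_zero ℓ
  push_cast
  field_simp
  ring

theorem truncRed_expP (hr : ℓ = 2 * r + 1) (h5 : 5 ≤ ℓ) {c : ℚ} {v : (ZMod ℓ)⟦X⟧}
    (hc : Red ℓ (C c) v) : TruncRed ℓ r (expP c) 1 (v * eisP (ZMod ℓ)) 0 0 := by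
  refine truncRed_of_integral ?_ ?_ ?_ ?_
  · rintro k ⟨j, rfl⟩
    exact coeff_expP_two_mul_add_one c j
  · intro k hk
    obtain ⟨j, rfl | rfl⟩ := Nat.even_or_odd' k
    · have := (((hc.pow j).mul (red_C_inv (cast_factorial_ne_zero (ℓ := ℓ) (n := j)
        (by omega)))).mul (red_eisP.pow j))
      rw [coeff_expP_two_mul, div_eq_mul_one_div, map_mul, map_pow]
      exact ⟨_, this⟩
    · exact ⟨0, by rw [coeff_expP_two_mul_add_one]; exact red_zero⟩
  · rw [coeff_expP_zero]
    exact red_one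
  · rw [show 2 = 2 * 1 from rfl, coeff_expP_two_mul]
    simpa using hc.mul red_eisP

theorem truncRed_sigmaZ (hr : ℓ = 2 * r + 1) (h5 : 5 ≤ ℓ) :
    ∃ f₂ b, TruncRed ℓ r sigmaZ 1 f₂ 1 b := by
  obtain ⟨v, hv⟩ := exists_red_of_mem_intSeries (ℓ := ℓ) (moment_mem_intSeries 1)
  have hv0 : constantCoeff v ≠ 0 := by
    obtain ⟨y, hy⟩ := moment_mem_intSeries 1
    have h1 := red_map_int (ℓ := ℓ) y
    change PowerSeries.map (Int.castRingHom ℚ) y = _ at hy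
    rw [hy] at h1
    have h2 : coeff 0 y = 2 := by
      have h3 := constantCoeff_moment_one
      rw [← hy, ← coeff_zero_eq_constantCoeff_apply, coeff_map, eq_intCast] at h3
      exact_mod_cast h3
    rw [hv.unique h1, ← coeff_zero_eq_constantCoeff_apply, coeff_map, h2, eq_intCast]
    exact_mod_cast two_ne_zero_zmod h5
  obtain ⟨v', hv'⟩ := red_inv hv hv0
  have hred : ∀ k, ∃ w, Red ℓ (moment k * (moment 1)⁻¹) w := fun k => by
    obtain ⟨w, hw⟩ := exists_red_of_mem_intSeries (ℓ := ℓ) (moment_mem_intSeries k)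
    exact ⟨_, hw.mul hv'⟩
  have hred' : ∀ k, k + 1 < ℓ → ∃ w, Red ℓ (coeff k sigmaZ) w := fun k hk => by
    obtain ⟨w, hw⟩ := hred (k + 1)
    rw [sigmaZ, coeff_mk]
    exact ⟨_, hw.mul (red_C_inv (cast_factorial_ne_zero hk))⟩
  obtain ⟨f₂, h2⟩ := hred' 2 (by omega)
  obtain ⟨b, hb⟩ := hred (ℓ + 2)
  refine ⟨f₂, b * C (1 / 2 : ZMod ℓ), fun k hk => ?_, fun k hk => hred' k (by omega), ?_, h2, ?_, ?_⟩
  · rw [sigmaZ, coeff_mk, moment_even hk.add_one, zero_mul, zero_mul]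
  · rw [coeff_sigmaZ_zero]
    exact red_one
  · rw [sigmaZ, coeff_mk, ← hr]
    obtain ⟨y, hy, h⟩ := exists_moment_prime (Fact.out : ℓ.Prime)
    obtain ⟨w, hw⟩ := exists_red_of_mem_intSeries (ℓ := ℓ) hy
    have h1 := red_one.add (hw.mul hv').prime_mul
    rw [add_zero] at h1
    convert h1 using 1
    linear_combination (moment ℓ * (moment 1)⁻¹) * factorial_mul_C_inv ℓ
      + (moment 1)⁻¹ * h + moment_one_mul_inv
  · rw [sigmaZ, coeff_mk, show 2 * r + 2 + 1 = ℓ + 2 by omega, mul_left_comm]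
    exact hb.mul (red_factorial_mul_C_inv h5)

theorem isModular_one_zmod (hr : ℓ = 2 * r + 1) (h5 : 5 ≤ ℓ) :
    IsModular (ZMod ℓ) (2 * r) 1 := by
  have h6 : ((6 : ℕ) : ZMod ℓ) ≠ 0 := by
    have := mul_ne_zero (two_ne_zero_zmod h5) (three_ne_zero_zmod h5)
    norm_num at this ⊢
    exact this
  obtain ⟨f₂, b, h⟩ := truncRed_sigmaZ hr h5
  have hc := (red_C_inv h6).neg
  rw [← map_neg, Nat.cast_ofNat] at hc
  have h1 := ((truncRed_expP hr h5 hc).mul (by omega) h).fst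
  rw [one_mul, zero_mul, add_zero] at h1
  refine IsModular.red h5 ?_ h1
  rw [natCast_eq_C]
  exact (isGraded_sigmaHat _).C_mul _

theorem isModular_eisP_zmod (hr : ℓ = 2 * r + 1) (h5 : 5 ≤ ℓ) :
    IsModular (ZMod ℓ) (2 * r + 2) (eisP (ZMod ℓ)) := by
  have h := (isModular_one_zmod hr h5).serre
  have h0 : ((2 * r : ℕ) : (ZMod ℓ)⟦X⟧) = -1 := by
    have : ((2 * r + 1 : ℕ) : (ZMod ℓ)⟦X⟧) = 0 := by
      rw [← hr, ← map_natCast (C (R := ZMod ℓ)), ZMod.natCast_self, map_zero]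
    push_cast at this ⊢
    linear_combination this
  rw [h0, qD_one] at h
  simpa using h

end PrimeWeights

section TwistCongruence

variable {ℓ : ℕ} [Fact ℓ.Prime] {r : ℕ}

theorem coeff_sinhcZ_of_odd (k : ℕ) (hk : Odd k) : coeff k sinhcZ = 0 := by
  rw [sinhcZ, coeff_mk, if_neg (Nat.not_even_iff_odd.mpr hk)]

theorem coeff_sinhcZ_of_even (k : ℕ) (hk : Even k) :
    coeff k sinhcZ = C (1 / (k + 1).factorial : ℚ) := by
  rw [sinhcZ, coeff_mk, if_pos hk]

theorem six_ne_zero_zmod (h5 : 5 ≤ ℓ) : (6 : ZMod ℓ) ≠ 0 := by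
  have := mul_ne_zero (two_ne_zero_zmod h5) (three_ne_zero_zmod h5)
  norm_num at this
  exact this

theorem red_C_inv_ofNat (n : ℕ) [n.AtLeastTwo] (hn : (OfNat.ofNat n : ZMod ℓ) ≠ 0) :
    Red ℓ (C (1 / OfNat.ofNat n : ℚ)) (C (1 / OfNat.ofNat n : ZMod ℓ)) := by
  have := red_C_inv (ℓ := ℓ) (n := OfNat.ofNat n) (by rwa [Nat.cast_ofNat])
  rwa [Nat.cast_ofNat, Nat.cast_ofNat] at this

theorem truncRed_C {c : ℚ} {v : (ZMod ℓ)⟦X⟧} (hc : Red ℓ (C c) v) :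
    TruncRed ℓ r (C (C c)) v 0 0 0 := by
  refine truncRed_of_integral (fun k hk => ?_) (fun k _ => ?_) ?_ ?_
  · rw [coeff_C, if_neg (by rintro rfl; simp at hk)]
  · rw [coeff_C]
    split_ifs
    exacts [⟨_, hc⟩, ⟨_, red_zero⟩]
  · rwa [coeff_C, if_pos rfl]
  · rw [coeff_C, if_neg two_ne_zero]
    exact red_zero

theorem truncRed_sinhcZ (hr : ℓ = 2 * r + 1) (h5 : 5 ≤ ℓ) :
    TruncRed ℓ r sinhcZ 1 (C (1 / 6 : ZMod ℓ)) 1 (C (1 / 2 : ZMod ℓ)) where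
  odd := coeff_sinhcZ_of_odd
  integral k hk := by
    rcases Nat.even_or_odd k with he | ho
    · rw [coeff_sinhcZ_of_even k he]
      exact ⟨_, red_C_inv (cast_factorial_ne_zero (by omega))⟩
    · rw [coeff_sinhcZ_of_odd k ho]
      exact ⟨_, red_zero⟩
  zero := by
    rw [coeff_sinhcZ_of_even 0 Even.zero]
    simpa using red_one
  two := by
    rw [coeff_sinhcZ_of_even 2 even_two]
    exact red_C_inv_ofNat 6 (six_ne_zero_zmod h5)
  fst := by
    rw [coeff_sinhcZ_of_even _ (even_two_mul r), ← hr, factorial_mul_C_inv]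
    exact red_one
  snd := by
    rw [coeff_sinhcZ_of_even _ ((even_two_mul r).add even_two),
      show 2 * r + 2 + 1 = ℓ + 2 by omega]
    exact red_factorial_mul_C_inv h5

theorem truncRed_cschZ (hr : ℓ = 2 * r + 1) (h5 : 5 ≤ ℓ) :
    TruncRed ℓ r cschZ 1 (-C (1 / 6 : ZMod ℓ)) (-1) (-C (1 / 6 : ZMod ℓ)) := by
  have hs := truncRed_sinhcZ hr h5
  obtain ⟨g, a, b, hg⟩ := hs.exists_of_mul_eq_one (by omega) sinhcZ_mul_cschZ
    (by rw [coeff_sinhcZ_of_even 0 Even.zero]; simp)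
  have h := hs.mul (by omega) hg
  have h1 := truncRed_C (r := r) (c := 1) (ℓ := ℓ) (v := 1) (by rw [map_one]; exact red_one)
  rw [sinhcZ_mul_cschZ] at h
  rw [map_one, map_one] at h1
  have e2 := h.two.unique h1.two
  have ea := h.fst.unique h1.fst
  have eb := h.snd.unique h1.snd
  have hc : C (1 / 2 : ZMod ℓ) = 3 * C (1 / 6 : ZMod ℓ) := by
    rw [← map_ofNat (C (R := ZMod ℓ)) 3, ← map_mul]
    congr 1
    have := two_ne_zero_zmod h5
    have := six_ne_zero_zmod h5
    field_simp
    norm_num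
  have e2' : g = -C (1 / 6 : ZMod ℓ) := by linear_combination e2
  have ea' : a = -1 := by linear_combination ea
  have eb' : b = -C (1 / 6 : ZMod ℓ) := by
    linear_combination eb - e2 - C (1 / 6 : ZMod ℓ) * ea - hc
  rwa [e2', ea', eb'] at hg

theorem coeff_appellZ_of_odd {k : ℕ} (hk : Odd k) :
    coeff k appellZ = 2 * (appellMoment k * C (1 / k.factorial : ℚ)) := by
  rw [coeff_appellZ, if_neg (Nat.not_even_iff_odd.mpr hk)]

theorem truncRed_X_mul_appellZ (hr : ℓ = 2 * r + 1) :
    ∃ m, TruncRed ℓ r (X * appellZ) 0 m 0 m := by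
  have h2 : Red ℓ 2 2 := by simpa using red_natCast (ℓ := ℓ) 2
  have hred : ∀ k, ∃ w, Red ℓ (appellMoment k) w := fun k =>
    exists_red_of_mem_intSeries (appellMoment_mem_intSeries k)
  obtain ⟨m, hm⟩ := hred 1
  have hi : ∀ k ≤ 2 * r, ∃ w, Red ℓ (coeff k (X * appellZ)) w := fun k hk => by
    rcases k with _ | k
    · exact ⟨0, by rw [coeff_zero_X_mul]; exact red_zero⟩
    · obtain ⟨w, hw⟩ := hred k
      rw [coeff_succ_X_mul, coeff_appellZ]
      split_ifs
      · exact ⟨_, red_zero⟩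
      · exact ⟨_, h2.mul (hw.mul (red_C_inv (cast_factorial_ne_zero (by omega))))⟩
  refine ⟨2 * m, fun k hk => ?_, fun k hk => hi k hk.le, ?_, ?_, ?_, ?_⟩
  · obtain ⟨j, rfl⟩ := hk
    rw [coeff_succ_X_mul, coeff_appellZ, if_pos (even_two_mul j)]
  · rw [coeff_zero_X_mul]
    exact red_zero
  · rw [show 2 = 1 + 1 from rfl, coeff_succ_X_mul, coeff_appellZ_of_odd odd_one]
    simpa using h2.mul hm
  · obtain ⟨w, hw⟩ := hi _ le_rfl
    exact hw.factorial_mul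
  · rw [coeff_succ_X_mul, ← hr, coeff_appellZ_of_odd (hr ▸ odd_two_mul_add_one r)]
    obtain ⟨y, hy, h⟩ := exists_appellMoment_prime (Fact.out : ℓ.Prime)
    obtain ⟨w, hw⟩ := exists_red_of_mem_intSeries (ℓ := ℓ) hy
    have h1 := h2.mul (hm.add hw.prime_mul)
    rw [add_zero, ← h] at h1
    convert h1 using 1
    linear_combination 2 * appellMoment ℓ * factorial_mul_C_inv ℓ

theorem truncRed_upsilon (hr : ℓ = 2 * r + 1) (h5 : 5 ≤ ℓ) :
    ∃ u, TruncRed ℓ r upsilon (-C (1 / 2 : ZMod ℓ)) u (C (1 / 2 : ZMod ℓ)) u := by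
  obtain ⟨m, hm⟩ := truncRed_X_mul_appellZ hr
  have hc := (red_C_inv_ofNat (ℓ := ℓ) 2 (two_ne_zero_zmod h5)).neg
  rw [← map_neg, ← neg_div] at hc
  have h := ((truncRed_C (r := r) hc).mul (by omega) (truncRed_cschZ hr h5)).add hm
  refine ⟨C (1 / 2 : ZMod ℓ) * C (1 / 6 : ZMod ℓ) + m, ?_⟩
  rw [upsilon]
  convert h using 1 <;> ring

theorem homogCoeff_two_mul_add_one (j : ℕ) : homogCoeff (2 * j + 1) = 0 := by
  induction j with
  | zero => rfl
  | succ j ih =>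
    rw [show 2 * (j + 1) + 1 = 2 * j + 3 by omega, homogCoeff, ih]
    simp [twistD]

theorem twistD_C_mul {K : Type*} [CommRing K] (c : K) (y : K⟦X⟧) :
    twistD (C c * y) = C c * twistD y := by
  rw [twistD, twistD, qD_mul, qD_C]
  ring

theorem homogCoeff_two_mul_add_two (j : ℕ) : homogCoeff (2 * j + 2)
    = C (1 / (2 * j + 1).factorial : ℚ) * ((-1) ^ j * twistD^[j] upsilonHat) := by
  induction j with
  | zero => simp [homogCoeff]
  | succ j ih =>
    have hc : C (1 / (((2 * j + 1 : ℕ) + 2) * ((2 * j + 1 : ℕ) + 1)) : ℚ)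
        * C (1 / (2 * j + 1).factorial : ℚ) = C (1 / (2 * (j + 1) + 1).factorial : ℚ) := by
      rw [← map_mul, show 2 * (j + 1) + 1 = 2 * j + 1 + 1 + 1 by omega,
        Nat.factorial_succ (2 * j + 1 + 1), Nat.factorial_succ (2 * j + 1)]
      have := Nat.factorial_ne_zero (2 * j + 1)
      generalize (2 * j + 1).factorial = n at this ⊢
      congr 1
      push_cast
      field_simp
      ring
    rw [show 2 * (j + 1) + 2 = 2 * j + 1 + 3 by omega, homogCoeff,
      show 2 * j + 1 + 1 = 2 * j + 2 by omega, ih, ← hc, Function.iterate_succ_apply',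
      show ((-1 : ℚ⟦X⟧) ^ j) = C ((-1) ^ j : ℚ) by simp, twistD_C_mul, twistD_C_mul, pow_succ,
      map_pow, map_neg, map_one]
    ring

theorem Red.twistD {x : ℚ⟦X⟧} {w : (ZMod ℓ)⟦X⟧} (h : Red ℓ x w) :
    Red ℓ (twistD x) (twistD w) :=
  ((by simpa using red_natCast (ℓ := ℓ) 24 : Red ℓ 24 24).mul h.qD).sub (red_eisP.mul h)

theorem Red.twistD_iterate {x : ℚ⟦X⟧} {w : (ZMod ℓ)⟦X⟧} (h : Red ℓ x w) (n : ℕ) :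
    Red ℓ (SptCongruence.twistD^[n] x) (SptCongruence.twistD^[n] w) := by
  induction n with
  | zero => exact h
  | succ n ih =>
    rw [Function.iterate_succ_apply', Function.iterate_succ_apply']
    exact ih.twistD

theorem red_neg_one_pow (n : ℕ) : Red ℓ ((-1) ^ n) ((-1) ^ n) := red_one.neg.pow n

theorem truncRed_homog (hr : ℓ = 2 * r + 1) {υ : (ZMod ℓ)⟦X⟧} (hυ : Red ℓ upsilonHat υ) :
    TruncRed ℓ r (PowerSeries.mk homogCoeff) 0 υ 0 ((-1) ^ r * twistD^[r] υ) := by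
  have hi : ∀ k ≤ 2 * r, ∃ w, Red ℓ (coeff k (PowerSeries.mk homogCoeff)) w := fun k hk => by
    rw [coeff_mk]
    obtain rfl | ⟨j, rfl | rfl⟩ : k = 0 ∨ ∃ j, k = 2 * j + 1 ∨ k = 2 * j + 2 := by
      obtain ⟨j, rfl | rfl⟩ := Nat.even_or_odd' k
      · rcases j with _ | j
        · exact Or.inl rfl
        · exact Or.inr ⟨j, Or.inr rfl⟩
      · exact Or.inr ⟨j, Or.inl rfl⟩
    · exact ⟨_, red_zero⟩
    · rw [homogCoeff_two_mul_add_one]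
      exact ⟨_, red_zero⟩
    · rw [homogCoeff_two_mul_add_two]
      exact ⟨_, (red_C_inv (cast_factorial_ne_zero (by omega))).mul
        ((red_neg_one_pow j).mul (hυ.twistD_iterate j))⟩
  refine ⟨fun k hk => ?_, fun k hk => hi k hk.le, ?_, ?_, ?_, ?_⟩
  · obtain ⟨j, rfl⟩ := hk
    rw [coeff_mk, homogCoeff_two_mul_add_one]
  · rw [coeff_mk, homogCoeff]
    exact red_zero
  · rwa [coeff_mk, homogCoeff]
  · obtain ⟨w, hw⟩ := hi _ le_rfl
    exact hw.factorial_mul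
  · rw [coeff_mk, homogCoeff_two_mul_add_two, ← hr, ← mul_assoc, factorial_mul_C_inv, one_mul]
    exact (red_neg_one_pow r).mul (hυ.twistD_iterate r)

/-- The difference of `upsilonHat` and its twist is modular of weight `ℓ + 1` modulo `ℓ`. -/
theorem exists_isModular_sub_twistD (hr : ℓ = 2 * r + 1) (h5 : 5 ≤ ℓ) :
    ∃ υ, Red ℓ upsilonHat υ ∧
      IsModular (ZMod ℓ) (2 * r + 2) (υ - (-1) ^ r * twistD^[r] υ) := by
  obtain ⟨u, hu⟩ := truncRed_upsilon hr h5
  have h4 : (4 : ZMod ℓ) ≠ 0 := by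
    have := pow_ne_zero 2 (two_ne_zero_zmod h5)
    norm_num at this
    exact this
  have hυ := hu.two.sub ((red_C_inv_ofNat 4 h4).mul red_eisP)
  refine ⟨_, hυ, ?_⟩
  have hchi := hu.add (truncRed_homog hr hυ).neg
  rw [← sub_eq_add_neg upsilon] at hchi
  have h := (((truncRed_expP hr h5 (red_C_inv_ofNat 2 (two_ne_zero_zmod h5))).mul (by omega)
    hchi).snd)
  have hm := IsModular.red h5 (by rw [natCast_eq_C]; exact (isGraded_chiHat _).C_mul _) h
  convert hm.sub ((isModular_eisP_zmod hr h5).C_mul (1 / 4 + 1 / 2 * (1 / 2))) using 1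
  simp only [map_add, map_mul]
  ring

end TwistCongruence

/-! ### The twist has no eigenvectors among modular forms of weight `ℓ + 1` -/

section Homogeneous

variable {K : Type*} [CommRing K]

theorem gradedEval_monomial (d : Fin 2 →₀ ℕ) (c : K) : gradedEval K (MvPolynomial.monomial d c)
    = C (C c * eisQ K ^ d 0 * eisR K ^ d 1) * X ^ (4 * d 0 + 6 * d 1) := by
  rw [MvPolynomial.monomial_eq, map_mul, gradedEval_C, Finsupp.prod_fintype _ _ (by simp),
    Fin.prod_univ_two, map_mul, map_pow, map_pow, gradedEval_X_zero, gradedEval_X_one]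
  simp only [map_mul, map_pow]
  ring

theorem exists_isobaric (f : MvPolynomial (Fin 2) K) (k : ℕ) : ∃ g : MvPolynomial (Fin 2) K,
    (∀ d, g.coeff d ≠ 0 → 4 * d 0 + 6 * d 1 = k) ∧
      gradedEval K g = C (coeff k (gradedEval K f)) * X ^ k := by
  induction f using MvPolynomial.induction_on' with
  | monomial d c =>
    by_cases hk : 4 * d 0 + 6 * d 1 = k
    · refine ⟨MvPolynomial.monomial d c, fun e he => ?_, ?_⟩
      · rw [MvPolynomial.coeff_monomial] at he
        split_ifs at he with h
        · rwa [← h]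
        · exact absurd rfl he
      · rw [gradedEval_monomial, coeff_C_mul, hk, coeff_X_pow_self, mul_one]
    · refine ⟨0, fun e he => absurd (MvPolynomial.coeff_zero e) he, ?_⟩
      rw [gradedEval_monomial, coeff_C_mul, coeff_X_pow, if_neg (Ne.symm hk), mul_zero, map_zero,
        map_zero, zero_mul]
  | add p q hp hq =>
    obtain ⟨g, hg, hpg⟩ := hp
    obtain ⟨h, hh, hqh⟩ := hq
    refine ⟨g + h, fun d hd => ?_, ?_⟩
    · by_cases h0 : g.coeff d = 0
      · refine hh d fun h1 => hd ?_
        rw [MvPolynomial.coeff_add, h0, h1, add_zero]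
      · exact hg d h0
    · rw [map_add, hpg, hqh, map_add, map_add, map_add, add_mul]

theorem IsModular.exists_isobaric {k : ℕ} {x : K⟦X⟧} (hx : IsModular K k x) :
    ∃ g : MvPolynomial (Fin 2) K, (∀ d, g.coeff d ≠ 0 → 4 * d 0 + 6 * d 1 = k) ∧
      gradedEval K g = C x * X ^ k := by
  obtain ⟨f, hf⟩ := hx
  have := SptCongruence.exists_isobaric f k
  rwa [hf, coeff_C_mul, coeff_X_pow_self, mul_one] at this

theorem IsModular.eq_zero_of_weight_two {x : K⟦X⟧} (hx : IsModular K 2 x) : x = 0 := by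
  obtain ⟨g, hg, hgx⟩ := hx.exists_isobaric
  have h0 : g = 0 := by
    ext d
    by_contra hd
    have := hg d hd
    omega
  have := congrArg (coeff 2) hgx
  rwa [h0, map_zero, map_zero, coeff_C_mul, coeff_X_pow_self, mul_one, eq_comm] at this

theorem exists_C_of_pderiv_mem {F : Type*} [Field F] (p : ℕ) [CharP F p]
    {J : MvPolynomial (Fin 2) F → Prop} (hJ : ∀ i f, J f → J (MvPolynomial.pderiv i f)) (n : ℕ)
    (hn : n < p) {f : MvPolynomial (Fin 2) F} (h0 : f ≠ 0) (hf : J f)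
    (hd : ∀ d, f.coeff d ≠ 0 → d 0 + d 1 ≤ n) : ∃ c : F, c ≠ 0 ∧ J (MvPolynomial.C c) := by
  induction n generalizing f with
  | zero =>
    have hC : f = MvPolynomial.C (f.coeff 0) := by
      ext d
      rw [MvPolynomial.coeff_C]
      split_ifs with h
      · rw [h]
      · by_contra hc
        have := hd d hc
        refine h (Finsupp.ext fun i => ?_)
        fin_cases i <;> simp <;> omega
    refine ⟨f.coeff 0, fun h => h0 ?_, hC ▸ hf⟩
    rw [hC, h, map_zero]
  | succ n ih =>
    by_cases hc : ∃ i, MvPolynomial.pderiv i f ≠ 0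
    · obtain ⟨i, hi⟩ := hc
      refine ih (by omega) hi (hJ i f hf) fun d hdi => ?_
      rw [MvPolynomial.coeff_pderiv] at hdi
      have := hd _ (left_ne_zero_of_mul hdi)
      fin_cases i <;> simp at this <;> omega
    · push Not at hc
      refine ih (by omega) h0 hf fun d hdf => ?_
      have hz : ∀ i, d i = 0 := fun i => by
        by_contra hi
        have h1 := congrArg (MvPolynomial.coeff (d - Finsupp.single i 1)) (hc i)
        rw [MvPolynomial.coeff_pderiv, MvPolynomial.coeff_zero,
          tsub_add_cancel_of_le (by simpa [Nat.one_le_iff_ne_zero] using hi)] at h1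
        have h2 : (((d - Finsupp.single i 1 : Fin 2 →₀ ℕ) i : ℕ) : F) + 1 = (d i : ℕ) := by
          rw [Finsupp.tsub_apply, Finsupp.single_eq_same, ← Nat.cast_add_one]
          congr 1
          omega
        rw [h2] at h1
        have h3 := (CharP.cast_eq_zero_iff F p _).mp ((mul_eq_zero.mp h1).resolve_left hdf)
        have h4 := Nat.le_of_dvd (Nat.pos_of_ne_zero hi) h3
        have h5 := hd d hdf
        have h6 : d i ≤ d 0 + d 1 := by
          fin_cases i <;> simp
        omega
      rw [hz, hz]
      omega

end Homogeneous

section Eigenvectors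

theorem four_mul_discPoly_mul_pderiv {K : Type*} [CommRing K] (f : MvPolynomial (Fin 2) K) :
    4 * discPoly K * MvPolynomial.pderiv 0 f
      = MvPolynomial.X 1 * serrePoly K f + MvPolynomial.X 0 ^ 2 * eulerPoly K f := by
  have h : (4 * discPoly K) • MvPolynomial.pderiv 0
      = (MvPolynomial.X 1 : MvPolynomial (Fin 2) K) • serrePoly K
        + (MvPolynomial.X 0 ^ 2 : MvPolynomial (Fin 2) K) • eulerPoly K := by
    refine MvPolynomial.derivation_ext fun i => ?_
    fin_cases i <;>
    simp only [Derivation.add_apply, Derivation.smul_apply, smul_eq_mul, serrePoly, eulerPoly,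
      MvPolynomial.mkDerivation_X, Fin.zero_eta, Fin.mk_one, Matrix.cons_val_zero,
      Matrix.cons_val_one, Matrix.cons_val_fin_one, MvPolynomial.pderiv_X_self,
      MvPolynomial.pderiv_X_of_ne (one_ne_zero : (1 : Fin 2) ≠ 0), discPoly] <;> ring
  exact DFunLike.congr_fun h f

theorem six_mul_discPoly_mul_pderiv {K : Type*} [CommRing K] (f : MvPolynomial (Fin 2) K) :
    -6 * discPoly K * MvPolynomial.pderiv 1 f
      = MvPolynomial.X 0 * serrePoly K f + MvPolynomial.X 1 * eulerPoly K f := by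
  have h : (-6 * discPoly K) • MvPolynomial.pderiv 1
      = (MvPolynomial.X 0 : MvPolynomial (Fin 2) K) • serrePoly K
        + (MvPolynomial.X 1 : MvPolynomial (Fin 2) K) • eulerPoly K := by
    refine MvPolynomial.derivation_ext fun i => ?_
    fin_cases i <;>
    simp only [Derivation.add_apply, Derivation.smul_apply, smul_eq_mul, serrePoly, eulerPoly,
      MvPolynomial.mkDerivation_X, Fin.zero_eta, Fin.mk_one, Matrix.cons_val_zero,
      Matrix.cons_val_one, Matrix.cons_val_fin_one, MvPolynomial.pderiv_X_self,
      MvPolynomial.pderiv_X_of_ne (zero_ne_one : (0 : Fin 2) ≠ 1), discPoly] <;> ring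
  exact DFunLike.congr_fun h f

theorem cuspEval_discPoly {K : Type*} [CommRing K] : cuspEval K (discPoly K) = 0 := by
  rw [discPoly, map_sub, map_pow, map_pow, cuspEval_X_zero, cuspEval_X_one]
  ring

theorem dvd_of_dvd_discPoly_pow_mul {K : Type*} [CommRing K] [IsDomain K]
    {A f : MvPolynomial (Fin 2) K} (hA : cuspEval K A ≠ 0) (n : ℕ) (h : A ∣ discPoly K ^ n * f) :
    A ∣ f := by
  induction n with
  | zero => simpa using h
  | succ n ih =>
    obtain ⟨g, hg⟩ := h
    have h1 := congrArg (cuspEval K) hg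
    rw [pow_succ', map_mul, map_mul, map_mul, cuspEval_discPoly, zero_mul, zero_mul,
      eq_comm, mul_eq_zero] at h1
    obtain ⟨g', rfl⟩ := discPoly_dvd_of_cuspEval_eq_zero K (h1.resolve_left hA)
    refine ih ⟨g', mul_left_cancel₀ (discPoly_ne_zero K) ?_⟩
    linear_combination hg

theorem derivation_mem_span_pair {K : Type*} [CommRing K]
    (d : Derivation K (MvPolynomial (Fin 2) K) (MvPolynomial (Fin 2) K))
    {A B f : MvPolynomial (Fin 2) K} (hA : d A ∈ Ideal.span {A, B})
    (hB : d B ∈ Ideal.span {A, B}) (hf : f ∈ Ideal.span {A, B}) : d f ∈ Ideal.span {A, B} := by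
  obtain ⟨a, b, rfl⟩ := Ideal.mem_span_pair.mp hf
  rw [map_add, d.leibniz, d.leibniz]
  simp only [smul_eq_mul]
  have h1 : A ∈ Ideal.span {A, B} := Ideal.subset_span (by simp)
  have h2 : B ∈ Ideal.span {A, B} := Ideal.subset_span (by simp)
  exact add_mem (add_mem (Ideal.mul_mem_left _ _ hA) (Ideal.mul_mem_right _ _ h1))
    (add_mem (Ideal.mul_mem_left _ _ hB) (Ideal.mul_mem_right _ _ h2))

variable {ℓ : ℕ} [Fact ℓ.Prime] {r : ℕ}

theorem natCast_two_mul_zmod {R : Type*} [CommRing R] [Algebra (ZMod ℓ) R] (hr : ℓ = 2 * r + 1) :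
    (2 * r : R) = -1 := by
  have h : ((ℓ : ZMod ℓ)) = 0 := ZMod.natCast_self ℓ
  have h2 := congrArg (algebraMap (ZMod ℓ) R) h
  rw [map_natCast, map_zero] at h2
  have h3 : ((2 * r + 1 : ℕ) : R) = 0 := by rw [← hr]; exact h2
  push_cast at h3
  linear_combination h3

/-- The ideal generated by isobaric lifts of `1` and `P` contains a power of the discriminant. -/
theorem exists_discPoly_pow_mem (hr : ℓ = 2 * r + 1) (h5 : 5 ≤ ℓ)
    {A B : MvPolynomial (Fin 2) (ZMod ℓ)} (hA : gradedEval (ZMod ℓ) A = C 1 * X ^ (2 * r))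
    (hB : gradedEval (ZMod ℓ) B = C (eisP (ZMod ℓ)) * X ^ (2 * r + 2))
    (hAd : ∀ d, A.coeff d ≠ 0 → 4 * d 0 + 6 * d 1 = 2 * r) :
    ∃ N, discPoly (ZMod ℓ) ^ N ∈ Ideal.span {A, B} := by
  have hinj := gradedEval_zmod_injective h5
  have hAm : A ∈ Ideal.span {A, B} := Ideal.subset_span (by simp)
  have hBm : B ∈ Ideal.span {A, B} := Ideal.subset_span (by simp)
  have h2r : ((2 * r : ℕ) : (ZMod ℓ)⟦X⟧) = -1 := by
    push_cast
    exact natCast_two_mul_zmod hr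
  have h2r' : ((2 * r : ℕ) : (ZMod ℓ)⟦X⟧⟦X⟧) = -1 := by
    rw [← map_natCast (C (R := (ZMod ℓ)⟦X⟧)), h2r, map_neg, map_one]
  have sA : serrePoly _ A = B := hinj (by
    rw [gradedEval_serrePoly, hA, serreSeries_C_mul_X_pow, hB, qD_one, h2r]
    congr 2
    ring)
  have sB : serrePoly _ B = -MvPolynomial.X 0 * A := hinj (by
    rw [gradedEval_serrePoly, hB, serreSeries_C_mul_X_pow, map_mul, map_neg, gradedEval_X_zero, hA,
      Nat.cast_add, h2r, eisQ]
    simp only [map_sub, map_mul, map_pow, map_ofNat, map_add, map_neg, map_one, Nat.cast_ofNat]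
    ring)
  have eA : eulerPoly _ A = -A := hinj (by
    rw [gradedEval_eulerPoly, map_neg, hA, qD_mul, qD_C, qD_X_pow, h2r']
    ring)
  have eB : eulerPoly _ B = B := hinj (by
    rw [gradedEval_eulerPoly, hB, qD_mul, qD_C, qD_X_pow, Nat.cast_add, h2r']
    push_cast
    ring)
  have hs : ∀ f ∈ Ideal.span {A, B}, serrePoly _ f ∈ Ideal.span {A, B} := fun f hf =>
    derivation_mem_span_pair _ (sA ▸ hBm) (sB ▸ Ideal.mul_mem_left _ _ hAm) hf
  have he : ∀ f ∈ Ideal.span {A, B}, eulerPoly _ f ∈ Ideal.span {A, B} := fun f hf =>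
    derivation_mem_span_pair _ (eA ▸ neg_mem hAm) (eB.symm ▸ hBm) hf
  have hunit : ∀ (c : ZMod ℓ) f, c ≠ 0 → MvPolynomial.C c * f ∈ Ideal.span {A, B} →
      f ∈ Ideal.span {A, B} := fun c f hc h => by
    have := Ideal.mul_mem_left _ (MvPolynomial.C c⁻¹) h
    rwa [← mul_assoc, ← map_mul, inv_mul_cancel₀ hc, map_one, one_mul] at this
  have h4 : (4 : ZMod ℓ) ≠ 0 := by
    have := pow_ne_zero 2 (two_ne_zero_zmod h5)
    norm_num at this
    exact this
  have hd : ∀ i, ∀ f ∈ Ideal.span {A, B},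
      discPoly _ * MvPolynomial.pderiv i f ∈ Ideal.span {A, B} := by
    intro i f hf
    fin_cases i
    · refine hunit 4 _ h4 ?_
      rw [map_ofNat, ← mul_assoc]
      exact four_mul_discPoly_mul_pderiv f ▸ add_mem (Ideal.mul_mem_left _ _ (hs f hf))
        (Ideal.mul_mem_left _ _ (he f hf))
    · refine hunit (-6) _ (neg_ne_zero.mpr (six_ne_zero_zmod h5)) ?_
      rw [map_neg, map_ofNat, ← mul_assoc]
      exact six_mul_discPoly_mul_pderiv f ▸ add_mem (Ideal.mul_mem_left _ _ (hs f hf))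
        (Ideal.mul_mem_left _ _ (he f hf))
  obtain ⟨c, hc, N, hN⟩ := exists_C_of_pderiv_mem (F := ZMod ℓ) ℓ
    (J := fun f => ∃ N, discPoly _ ^ N * f ∈ Ideal.span {A, B})
    (by
      rintro i f ⟨N, hN⟩
      refine ⟨N + 1, ?_⟩
      have h1 := hd i _ hN
      rw [(MvPolynomial.pderiv i).leibniz, (MvPolynomial.pderiv i).leibniz_pow] at h1
      simp only [smul_eq_mul, nsmul_eq_mul] at h1
      rcases N with _ | N
      · simpa using h1
      · rw [Nat.add_sub_cancel] at h1
        have h2 := Ideal.mul_mem_left _ (((N + 1 : ℕ) : MvPolynomial (Fin 2) (ZMod ℓ))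
          * MvPolynomial.pderiv i (discPoly _)) hN
        convert sub_mem h1 h2 using 1
        ring) (2 * r) (by omega) (f := A)
    (by
      rintro rfl
      rw [map_zero, map_one, one_mul, eq_comm] at hA
      exact pow_ne_zero _ X_ne_zero hA)
    ⟨0, by simpa using hAm⟩ (fun d h => by have := hAd d h; omega)
  exact ⟨N, hunit c _ hc (by rwa [mul_comm])⟩

/-- Modular forms of weight `ℓ + 1` modulo `ℓ` which are eigenvectors of the twist vanish. -/
theorem IsModular.eq_zero_of_twistD (hr : ℓ = 2 * r + 1) (h5 : 5 ≤ ℓ) {g : (ZMod ℓ)⟦X⟧}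
    (hg : IsModular (ZMod ℓ) (2 * r + 2) g) {c : ZMod ℓ} (h : twistD^[r] g = C c * g) : g = 0 := by
  have hinj := gradedEval_zmod_injective h5
  obtain ⟨A, hAd, hA⟩ := (isModular_one_zmod hr h5).exists_isobaric
  obtain ⟨B, hB⟩ := isModular_eisP_zmod hr h5
  obtain ⟨G, hG⟩ := hg
  have h2r : (2 * r : (ZMod ℓ)⟦X⟧) = -1 := natCast_two_mul_zmod hr
  have hstep : ∀ i, ∃ f, gradedEval (ZMod ℓ) f = C (twistD^[i] g) * X ^ ((i + 1) * (2 * r + 2)) ∧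
      A ∣ f - MvPolynomial.C (∏ j ∈ range i, (2 * j + 1 : ZMod ℓ)) * (B ^ i * G) := by
    intro i
    induction i with
    | zero => exact ⟨G, by simpa using hG, by simp⟩
    | succ i ih =>
      obtain ⟨f, hf, hd⟩ := ih
      refine ⟨2 * A * serrePoly _ f + MvPolynomial.C (2 * i + 1 : ZMod ℓ) * B * f, ?_, ?_⟩
      · rw [map_add, map_mul, map_mul, map_mul, map_mul, map_ofNat, gradedEval_serrePoly, hf,
          serreSeries_C_mul_X_pow, gradedEval_C, hA, hB, Function.iterate_succ_apply', twistD]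
        have hk : (((i + 1) * (2 * r + 2) : ℕ) : (ZMod ℓ)⟦X⟧) = i + 1 := by
          push_cast
          linear_combination ((i : (ZMod ℓ)⟦X⟧) + 1) * h2r
        rw [hk]
        simp only [map_sub, map_mul, map_ofNat, map_add, map_one, map_natCast]
        ring
      · obtain ⟨w, hw⟩ := hd
        refine ⟨2 * serrePoly _ f + MvPolynomial.C (2 * i + 1 : ZMod ℓ) * B * w, ?_⟩
        rw [prod_range_succ, map_mul]
        linear_combination MvPolynomial.C (2 * i + 1 : ZMod ℓ) * B * hw
  obtain ⟨f, hf, hd⟩ := hstep r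
  have hfe : f = MvPolynomial.C c * A ^ (r + 1) * G := hinj (by
    rw [hf, h, map_mul C, map_mul, map_mul, map_pow, gradedEval_C, hA, hG, map_one]
    ring)
  have hp : (∏ j ∈ range r, (2 * j + 1 : ZMod ℓ)) ≠ 0 := by
    refine prod_ne_zero_iff.mpr fun j hj => ?_
    have := mem_range.mp hj
    exact_mod_cast natCast_zmod_ne_zero_of_lt (ℓ := ℓ) (n := 2 * j + 1) (by omega) (by omega)
  have hBG : A ∣ B ^ r * G := by
    have h1 : A ∣ MvPolynomial.C (∏ j ∈ range r, (2 * j + 1 : ZMod ℓ)) * (B ^ r * G) := by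
      refine (dvd_sub_right ?_).mp hd
      rw [hfe]
      exact ⟨MvPolynomial.C c * A ^ r * G, by ring⟩
    have h2 := h1.mul_left (MvPolynomial.C (∏ j ∈ range r, (2 * j + 1 : ZMod ℓ))⁻¹)
    rwa [← mul_assoc, ← map_mul, inv_mul_cancel₀ hp, map_one, one_mul] at h2
  obtain ⟨N, hN⟩ := exists_discPoly_pow_mem hr h5 hA hB hAd
  obtain ⟨a, b, hab⟩ := Ideal.mem_span_pair.mp hN
  have hdisc : A ∣ discPoly _ ^ (N * r) * G := by
    have h1 : A ∣ (a * A + b * B) ^ r - (b * B) ^ r :=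
      (Dvd.intro_left a (by ring)).trans (sub_dvd_pow_sub_pow _ _ r)
    rw [pow_mul, ← hab]
    have h2 := (h1.mul_right G).add (hBG.mul_left (b ^ r))
    convert h2 using 1
    ring
  have hcusp : cuspEval _ A ≠ 0 := by
    intro h0
    have h1 := map_constantCoeff_gradedEval (ZMod ℓ) A
    rw [h0, hA, map_one, one_mul, map_pow, map_X, Polynomial.coe_zero] at h1
    exact pow_ne_zero _ X_ne_zero h1
  obtain ⟨G', rfl⟩ := dvd_of_dvd_discPoly_pow_mul hcusp _ hdisc
  refine IsModular.eq_zero_of_weight_two ⟨G', mul_left_cancel₀ (pow_ne_zero (2 * r) X_ne_zero) ?_⟩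
  rw [map_mul, hA, map_one, one_mul] at hG
  rw [hG]
  ring

end Eigenvectors

/-! ### Generating functions of partitions by smallest part -/

section SmallestPart

open Nat.Partition

theorem genFun_factor (f : ℕ → ℕ → ℚ) (i : ℕ) :
    (1 + ∑' j, f (i + 1) (j + 1) • X ^ ((i + 1) * (j + 1)) : ℚ⟦X⟧)
      = PowerSeries.mk fun m =>
        if m = 0 then 1 else if i + 1 ∣ m then f (i + 1) (m / (i + 1)) else 0 := by
  ext m
  rw [map_add, (summable_genFun_term f i).map_tsum _ (continuous_coeff _ _), coeff_mk]
  simp only [map_smul, coeff_X_pow, smul_eq_mul, mul_ite, mul_one, mul_zero, coeff_one]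
  by_cases hm : m = 0
  · subst hm
    simp
  by_cases hd : i + 1 ∣ m
  · obtain ⟨c, rfl⟩ := hd
    obtain ⟨c, rfl⟩ : ∃ d, c = d + 1 := Nat.exists_eq_add_one_of_ne_zero (by rintro rfl; simp at hm)
    rw [tsum_eq_single c]
    · simp
    · intro b hb
      rw [if_neg]
      intro h
      exact hb (by simpa using (Nat.eq_of_mul_eq_mul_left (Nat.succ_pos i) h).symm)
  · rw [if_neg hm, if_neg hm, if_neg hd, zero_add]
    convert tsum_zero with j
    rw [if_neg]
    rintro rfl
    exact hd (dvd_mul_right _ _)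

/-- The generating function of the partition numbers. -/
noncomputable def partSeries : ℚ⟦X⟧ := PowerSeries.mk fun n => (partitionCount n : ℚ)

/-- The generating function of `spt`. -/
noncomputable def sptSeries : ℚ⟦X⟧ := PowerSeries.mk fun n => (spt n : ℚ)

/-- The weight selecting the partitions all of whose parts exceed `n`. -/
def gtWeight (n k _c : ℕ) : ℚ := if n < k then 1 else 0

/-- The weight that counts the parts `n` in the partitions all of whose parts are at least `n`. -/
def eqWeight (n k c : ℕ) : ℚ := if n < k then 1 else if k = n then c else 0

theorem partSeries_eq_genFun : partSeries = genFun fun _ _ => (1 : ℚ) := by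
  ext n
  simp [partSeries, partitionCount, Finsupp.prod]

theorem hasProd_partSeries : HasProd (fun i => geom (i + 1)) partSeries := by
  rw [partSeries_eq_genFun]
  refine (hasProd_genFun _).congr_fun fun i => (Eq.trans ?_ (genFun_factor (fun _ _ => 1) i).symm)
  ext m
  rw [geom, coeff_mk, coeff_mk]
  rcases eq_or_ne m 0 with rfl | h <;> simp [*]

theorem hasProd_qPoch (n : ℕ) :
    HasProd (fun i => if i < n then 1 - X ^ (i + 1) else 1) (qPoch n) := by
  have h := hasProd_prod_of_ne_finset_one (s := range n) (L := .unconditional ℕ)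
    (f := fun i => if i < n then 1 - X ^ (i + 1) else (1 : ℚ⟦X⟧))
    (fun i hi => if_neg (by simpa using hi))
  rwa [prod_congr rfl fun i hi => if_pos (mem_range.mp hi)] at h

theorem geom_eq_factor_gtWeight {n i : ℕ} (h : n ≤ i) : geom (i + 1) = PowerSeries.mk fun m =>
        if m = 0 then 1 else if i + 1 ∣ m then gtWeight n (i + 1) (m / (i + 1)) else 0 := by
  ext m
  simp only [geom, coeff_mk, gtWeight, if_pos (Nat.lt_succ_of_le h)]
  rcases eq_or_ne m 0 with rfl | h <;> simp [*]

theorem genFun_gtWeight (n : ℕ) : genFun (gtWeight n) = partSeries * qPoch n := by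
  refine (hasProd_genFun _).unique ((hasProd_partSeries.mul (hasProd_qPoch n)).congr_fun fun i => ?_)
  rw [genFun_factor]
  split_ifs with h
  · rw [mul_comm, one_sub_mul_geom (Nat.succ_ne_zero i)]
    ext m
    simp only [coeff_mk, gtWeight, if_neg (show ¬n < i + 1 by omega), coeff_one, ite_self]
  · rw [mul_one, geom_eq_factor_gtWeight (not_lt.mp h)]

theorem genFun_eqWeight (n : ℕ) :
    genFun (eqWeight (n + 1)) = partSeries * qPoch (n + 1) * (1 + geomSq (n + 1)) := by
  rw [← genFun_gtWeight]
  refine (hasProd_genFun _).unique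
    (((hasProd_genFun _).mul (hasProd_ite_eq n (1 + geomSq (n + 1)))).congr_fun fun i => ?_)
  rw [genFun_factor, genFun_factor]
  rcases eq_or_ne i n with rfl | h
  · have : (PowerSeries.mk fun m => if m = 0 then 1 else
        if i + 1 ∣ m then gtWeight (i + 1) (i + 1) (m / (i + 1)) else 0 : ℚ⟦X⟧) = 1 := by
      ext m
      simp [gtWeight, coeff_one]
    rw [this, if_pos rfl, one_mul]
    ext m
    rw [coeff_mk, geomSq, map_add, coeff_mk, coeff_one]
    rcases eq_or_ne m 0 with rfl | h
    · simp
    · simp only [eqWeight, h, if_false, lt_irrefl, if_true, zero_add]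
  · rw [if_neg h, mul_one]
    ext m
    rw [coeff_mk, coeff_mk, gtWeight, eqWeight, if_neg (c := i + 1 = n + 1) (by omega)]

theorem X_pow_dvd_partSeries_mul_qPoch (n : ℕ) : X ^ (n + 1) ∣ partSeries * qPoch n - 1 := by
  rw [X_pow_dvd_iff, ← genFun_gtWeight]
  intro m hm
  rw [map_sub, coeff_genFun, coeff_one]
  rcases eq_or_ne m 0 with rfl | h0
  · simp
  rw [if_neg h0, sub_zero]
  refine sum_eq_zero fun p _ => ?_
  obtain ⟨i, hi⟩ : ∃ i, i ∈ p.parts := by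
    refine Multiset.exists_mem_of_ne_zero fun h => h0 ?_
    rw [← p.parts_sum, h, Multiset.sum_zero]
  refine prod_eq_zero (i := i) (by simpa using hi) (if_neg ?_)
  have := p.le_of_mem_parts hi
  omega

theorem eulerProd_mul_partSeries : eulerProd * partSeries = 1 := by
  refine eq_of_forall_X_pow_dvd_sub fun N => ?_
  have h := ((X_pow_dvd_eulerProd_sub_qPoch N).mul_right partSeries).add
    (X_pow_dvd_partSeries_mul_qPoch N)
  convert h using 1
  ring

theorem prod_eqWeight_sub_prod_gtWeight {n : ℕ} (p : n.Partition) (k : ℕ) :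
    p.parts.toFinsupp.prod (eqWeight k) - p.parts.toFinsupp.prod (gtWeight k)
      = if ∀ i ∈ p.parts, k ≤ i then (p.parts.count k : ℚ) else 0 := by
  simp only [Finsupp.prod, Multiset.toFinsupp_support, Multiset.toFinsupp_apply]
  split_ifs with h
  · by_cases hk : k ∈ p.parts
    · rw [prod_eq_zero (f := fun i => gtWeight k i _) (Multiset.mem_toFinset.mpr hk)
        (by simp [gtWeight]), sub_zero, prod_eq_single k]
      · simp [eqWeight]
      · intro i hi hik
        have := h i (by simpa using hi)
        rw [eqWeight, if_pos (by omega)]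
      · simp [hk]
    · rw [Multiset.count_eq_zero.mpr hk, Nat.cast_zero, sub_eq_zero]
      refine prod_congr rfl fun i hi => ?_
      have hi' := Multiset.mem_toFinset.mp hi
      have := h i hi'
      have : i ≠ k := fun e => hk (e ▸ hi')
      rw [eqWeight, gtWeight, if_neg (c := i = k) this]
  · push Not at h
    obtain ⟨i, hi, hik⟩ := h
    rw [prod_eq_zero (Multiset.mem_toFinset.mpr hi) (by rw [eqWeight, if_neg (by omega), if_neg (by omega)]),
      prod_eq_zero (Multiset.mem_toFinset.mpr hi) (by rw [gtWeight, if_neg (by omega)]), sub_zero]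

theorem card_filter_smallest {n N : ℕ} (hn : n ≤ N) (p : n.Partition) :
    (p.parts.filter (fun j => ∀ i ∈ p.parts, j ≤ i)).card
      = ∑ k ∈ range N, if ∀ i ∈ p.parts, k + 1 ≤ i then p.parts.count (k + 1) else 0 := by
  have hsub : (p.parts.filter (fun j => ∀ i ∈ p.parts, j ≤ i)).toFinset
      ⊆ (range N).map (addRightEmbedding 1) := by
    intro j hj
    have hj' : j ∈ p.parts := (Multiset.mem_filter.mp (Multiset.mem_toFinset.mp hj)).1
    have h1 := p.parts_pos hj'
    have h2 := p.le_of_mem_parts hj'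
    simp only [mem_map, mem_range, addRightEmbedding_apply]
    exact ⟨j - 1, by omega, by omega⟩
  rw [← Multiset.toFinset_sum_count_eq, sum_subset hsub (by simp), sum_map]
  refine sum_congr rfl fun k _ => ?_
  rw [addRightEmbedding_apply, Multiset.count_filter]

theorem X_pow_dvd_sptSeries_sub (N : ℕ) : X ^ (N + 1) ∣
    sptSeries - ∑ k ∈ range N, geomSq (k + 1) * qPoch (k + 1) * partSeries := by
  rw [X_pow_dvd_iff]
  intro m hm
  rw [sum_congr rfl (g := fun k => genFun (eqWeight (k + 1)) - genFun (gtWeight (k + 1)))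
    fun k _ => by rw [genFun_eqWeight, genFun_gtWeight]; ring]
  simp only [map_sub, map_sum, coeff_genFun, sptSeries, coeff_mk, spt, ← sum_sub_distrib,
    prod_eqWeight_sub_prod_gtWeight]
  rw [sum_comm, sub_eq_zero, Nat.cast_sum]
  refine sum_congr rfl fun p _ => ?_
  rw [card_filter_smallest (Nat.lt_succ_iff.mp hm)]
  push_cast
  rfl

theorem X_pow_dvd_eulerProd_mul_sptSeries_sub (N : ℕ) : X ^ (N + 1) ∣
    eulerProd * sptSeries - ∑ k ∈ range N, X ^ (k + 1) * qPoch k * geom (k + 1) := by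
  have h := (X_pow_dvd_sptSeries_sub N).mul_left eulerProd
  convert h using 1
  rw [mul_sub, mul_sum]
  congr 1
  refine sum_congr rfl fun k _ => ?_
  rw [geomSq_eq k.add_one_ne_zero, qPoch_succ]
  linear_combination (-X ^ (k + 1) * geom (k + 1) ^ 2 * qPoch k * (1 - X ^ (k + 1)))
    * eulerProd_mul_partSeries - X ^ (k + 1) * geom (k + 1) * qPoch k
    * one_sub_mul_geom k.add_one_ne_zero

end SmallestPart

/-! ### Two finite Bailey-type identities -/

section Bailey

/-- The inverse of `(q; q)_n`. -/
noncomputable def qInv (n : ℕ) : ℚ⟦X⟧ := ∏ k ∈ range n, geom (k + 1)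

theorem qInv_succ (n : ℕ) : qInv (n + 1) = qInv n * geom (n + 1) := prod_range_succ _ _

theorem qPoch_mul_qInv (n : ℕ) : qPoch n * qInv n = 1 := by
  rw [qPoch, qInv, ← prod_mul_distrib]
  exact prod_eq_one fun k _ => one_sub_mul_geom k.add_one_ne_zero

theorem one_sub_mul_qInv_succ (n : ℕ) : (1 - X ^ (n + 1)) * qInv (n + 1) = qInv n := by
  rw [qInv_succ]
  linear_combination qInv n * one_sub_mul_geom n.add_one_ne_zero

/-- The coefficients `1 / ((q; q)_{n - r} (q; q)_{n + r})`, extended by zero to `r > n`. -/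
noncomputable def baileyCoeff (n r : ℕ) : ℚ⟦X⟧ :=
  if r ≤ n then qInv (n - r) * qInv (n + r) else 0

theorem baileyCoeff_of_lt {n r : ℕ} (h : n < r) : baileyCoeff n r = 0 := if_neg (by omega)

theorem baileyCoeff_add (r m : ℕ) : baileyCoeff (r + m) r = qInv m * qInv (2 * r + m) := by
  rw [baileyCoeff, if_pos (by omega), show r + m - r = m by omega,
    show r + m + r = 2 * r + m by omega]

theorem baileyCoeff_succ_left (n r : ℕ) :
    (1 - X ^ (n + 1 - r)) * (1 - X ^ (n + 1 + r)) * baileyCoeff (n + 1) r = baileyCoeff n r := by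
  rcases lt_trichotomy (n + 1) r with h | rfl | h
  · rw [baileyCoeff_of_lt h, baileyCoeff_of_lt (by omega), mul_zero]
  · rw [baileyCoeff_of_lt (n := n) (by omega), Nat.sub_self, pow_zero, sub_self, zero_mul, zero_mul]
  · obtain ⟨m, rfl⟩ := Nat.exists_eq_add_of_le (Nat.lt_succ_iff.mp h)
    rw [baileyCoeff_add, add_assoc r m 1, baileyCoeff_add, show r + (m + 1) - r = m + 1 by omega,
      show r + (m + 1) + r = 2 * r + m + 1 by ring, ← one_sub_mul_qInv_succ m,
      ← one_sub_mul_qInv_succ (2 * r + m)]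
    ring_nf

theorem baileyCoeff_succ_right (n r : ℕ) :
    baileyCoeff n (r + 1) * (1 - X ^ (n + r + 1)) = baileyCoeff n r * (1 - X ^ (n - r)) := by
  rcases lt_trichotomy n r with h | rfl | h
  · rw [baileyCoeff_of_lt h, baileyCoeff_of_lt (by omega), zero_mul, zero_mul]
  · rw [baileyCoeff_of_lt (by omega), Nat.sub_self, pow_zero, sub_self, mul_zero, zero_mul]
  · obtain ⟨m, rfl⟩ := Nat.exists_eq_add_of_le h
    rw [baileyCoeff_add, show r.succ + m - r = m + 1 by omega,
      show r.succ + m = r + (m + 1) by omega, baileyCoeff_add, ← one_sub_mul_qInv_succ m,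
      show 2 * (r + 1) + m = (2 * r + (m + 1)) + 1 by ring,
      ← one_sub_mul_qInv_succ (2 * r + (m + 1)),
      show r + (m + 1) + r + 1 = 2 * r + (m + 1) + 1 by ring]
    ring

/-- The pentagonal numbers `r (3 r - 1) / 2`. -/
def pent (r : ℕ) : ℕ := ∑ k ∈ range r, (3 * k + 1)

theorem pent_succ (r : ℕ) : pent (r + 1) = pent r + (3 * r + 1) := sum_range_succ _ _

theorem pent_add_self (r : ℕ) : pent r + r = pentExp 0 r := by
  have h := two_mul_pentExp 0 r
  have : 2 * (pent r + r) = r * (3 * r + 1) := by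
    induction r with
    | zero => simp [pent]
    | succ r ih =>
      rw [pent_succ]
      have := ih (two_mul_pentExp 0 r)
      linarith
  omega

/-- The terms `(-1)^r q^{r(3r-1)/2}` of the pentagonal number series. -/
noncomputable def pentTerm (r : ℕ) : ℚ⟦X⟧ := (-1) ^ r * X ^ pent r

theorem pentTerm_succ (r : ℕ) : pentTerm (r + 1) = -(X ^ (3 * r + 1) * pentTerm r) := by
  rw [pentTerm, pentTerm, pent_succ, pow_add, pow_succ]
  ring

theorem pentTerm_zero : pentTerm 0 = 1 := by simp [pentTerm, pent]

/-- The telescoping primitive of the summands in the induction step for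
`qPoch_mul_sum_pentTerm`. -/
noncomputable def baileyPrimitive (n r : ℕ) : ℚ⟦X⟧ :=
  -(qPoch n * pentTerm r * baileyCoeff (n + 1) r * X ^ (n + 1 - r) * (1 - X ^ (n + 1 + r)))

theorem baileyPrimitive_succ {n r : ℕ} (h : r ≤ n + 1) : baileyPrimitive n (r + 1)
    = qPoch n * pentTerm r * baileyCoeff (n + 1) r * X ^ (n + 1 + 2 * r)
      * (1 - X ^ (n + 1 - r)) := by
  have key := baileyCoeff_succ_right (n + 1) r
  rw [baileyPrimitive, pentTerm_succ, show n + 1 + (r + 1) = n + 1 + r + 1 by ring]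
  rcases h.eq_or_lt with rfl | h
  · rw [baileyCoeff_of_lt (by omega), Nat.sub_self]
    ring
  · rw [show n + 1 + 2 * r = (3 * r + 1) + (n + 1 - (r + 1)) by omega, pow_add]
    linear_combination qPoch n * pentTerm r * X ^ (3 * r + 1) * X ^ (n + 1 - (r + 1)) * key

theorem baileyPrimitive_sub {n r : ℕ} (h : r ≤ n + 1) :
    pentTerm r * (1 + X ^ r)
        * (qPoch (n + 1) * baileyCoeff (n + 1) r - qPoch n * baileyCoeff n r)
      = baileyPrimitive n (r + 1) - baileyPrimitive n r := by
  rw [baileyPrimitive_succ h, baileyPrimitive, ← baileyCoeff_succ_left n r, qPoch_succ]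
  obtain ⟨m, hm⟩ := Nat.exists_eq_add_of_le h
  rw [hm, show r + m - r = m by omega]
  ring

theorem qPoch_mul_sum_pentTerm (n : ℕ) : qPoch n * (baileyCoeff n 0
    + ∑ r ∈ range n, pentTerm (r + 1) * (1 + X ^ (r + 1)) * baileyCoeff n (r + 1)) = 1 := by
  induction n with
  | zero => simp [qPoch, baileyCoeff, qInv]
  | succ n ih =>
    have hext : ∑ r ∈ range n, pentTerm (r + 1) * (1 + X ^ (r + 1)) * baileyCoeff n (r + 1)
        = ∑ r ∈ range (n + 1), pentTerm (r + 1) * (1 + X ^ (r + 1)) * baileyCoeff n (r + 1) := by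
      rw [sum_range_succ, baileyCoeff_of_lt n.lt_succ_self, mul_zero, add_zero]
    have htel := sum_range_sub (fun r => baileyPrimitive n (r + 1)) (n + 1)
    rw [sum_congr rfl fun r hr =>
      (baileyPrimitive_sub (n := n) (r := r + 1) (by have := mem_range.mp hr; omega)).symm] at htel
    have hlast : baileyPrimitive n (n + 1 + 1) = 0 := by
      rw [baileyPrimitive, baileyCoeff_of_lt (by omega)]
      ring
    have hfirst := baileyPrimitive_succ (n := n) (r := 0) (by omega)
    have h0 := baileyCoeff_succ_left n 0
    rw [pentTerm_zero] at hfirst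
    simp only [Nat.sub_zero, mul_zero, add_zero, zero_add] at hfirst h0 htel
    rw [hlast] at htel
    rw [hext, ← h0] at ih
    simp only [mul_sub, sum_sub_distrib] at htel
    have pull : ∀ p : ℚ⟦X⟧, ∀ w : ℕ → ℚ⟦X⟧,
        ∑ r ∈ range (n + 1), pentTerm (r + 1) * (1 + X ^ (r + 1)) * (p * w (r + 1))
          = p * ∑ r ∈ range (n + 1), pentTerm (r + 1) * (1 + X ^ (r + 1)) * w (r + 1) := by
      intro p w
      rw [mul_sum]
      exact sum_congr rfl fun r _ => by ring
    rw [pull, pull] at htel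
    rw [qPoch_succ] at htel ⊢
    linear_combination ih + htel - hfirst

/-- The approximations `(q; q)_n² / ((q; q)_{n - r} (q; q)_{n + r})` to `1`. -/
noncomputable def baileyRatio (n r : ℕ) : ℚ⟦X⟧ := qPoch n ^ 2 * baileyCoeff n r

theorem geomSq_mul_baileyRatio_sub {n r : ℕ} (h0 : r ≠ 0) (h : r ≤ n + 1) :
    geomSq r * (baileyRatio (n + 1) r - baileyRatio n r)
      = qPoch n ^ 2 * X ^ (n + 1) * baileyCoeff (n + 1) r := by
  rw [baileyRatio, baileyRatio, ← baileyCoeff_succ_left n r, qPoch_succ, geomSq_eq h0]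
  obtain ⟨m, hm⟩ := Nat.exists_eq_add_of_le h
  rw [hm, show r + m - r = m by omega]
  linear_combination (X ^ r * X ^ m * qPoch n ^ 2 * baileyCoeff (r + m) r *
    (1 + (1 - X ^ r) * geom r)) * one_sub_mul_geom h0

theorem sum_geom_eq (N : ℕ) : ∑ k ∈ range N, X ^ (k + 1) * qPoch k * geom (k + 1)
    = ∑ k ∈ range N, geomSq (k + 1) + ∑ r ∈ range N,
      pentTerm (r + 1) * (1 + X ^ (r + 1)) * (geomSq (r + 1) * baileyRatio N (r + 1)) := by
  induction N with
  | zero => simp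
  | succ n ih =>
    have hext : ∑ r ∈ range n,
          pentTerm (r + 1) * (1 + X ^ (r + 1)) * (geomSq (r + 1) * baileyRatio n (r + 1))
        = ∑ r ∈ range (n + 1),
          pentTerm (r + 1) * (1 + X ^ (r + 1)) * (geomSq (r + 1) * baileyRatio n (r + 1)) := by
      rw [sum_range_succ _ n, baileyRatio, baileyCoeff_of_lt n.lt_succ_self]
      ring
    have hdiff : ∑ r ∈ range (n + 1),
          pentTerm (r + 1) * (1 + X ^ (r + 1)) * (geomSq (r + 1) * baileyRatio (n + 1) (r + 1))
        - ∑ r ∈ range (n + 1),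
          pentTerm (r + 1) * (1 + X ^ (r + 1)) * (geomSq (r + 1) * baileyRatio n (r + 1))
        = qPoch n ^ 2 * X ^ (n + 1) * ∑ r ∈ range (n + 1),
          pentTerm (r + 1) * (1 + X ^ (r + 1)) * baileyCoeff (n + 1) (r + 1) := by
      rw [← sum_sub_distrib, mul_sum]
      refine sum_congr rfl fun r hr => ?_
      linear_combination pentTerm (r + 1) * (1 + X ^ (r + 1)) *
        geomSq_mul_baileyRatio_sub r.add_one_ne_zero
          (show r + 1 ≤ n + 1 by have := mem_range.mp hr; omega)
    have hA := qPoch_mul_sum_pentTerm (n + 1)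
    have h0 := baileyCoeff_add 0 (n + 1)
    simp only [mul_zero, zero_add] at h0
    rw [h0] at hA
    rw [sum_range_succ, sum_range_succ (fun k => geomSq (k + 1)), ih, hext,
      geomSq_eq n.add_one_ne_zero]
    generalize hS : ∑ r ∈ range (n + 1),
      pentTerm (r + 1) * (1 + X ^ (r + 1)) * baileyCoeff (n + 1) (r + 1) = S at hdiff hA
    have hInv : S = qInv (n + 1) - qInv (n + 1) * qInv (n + 1) := by
      linear_combination qInv (n + 1) * hA
        - (qInv (n + 1) * qInv (n + 1) + S) * qPoch_mul_qInv (n + 1)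
    rw [hInv, qInv_succ] at hdiff
    have hq := qPoch_mul_qInv n
    linear_combination -hdiff + (X ^ (n + 1) * geom (n + 1) ^ 2 * (qPoch n * qInv n + 1)
      - X ^ (n + 1) * geom (n + 1) * qPoch n) * hq

end Bailey

/-! ### The generating function of `spt` -/

section SptSeries

theorem X_pow_dvd_eulerProd_mul_qInv_sub (n : ℕ) : X ^ (n + 1) ∣ eulerProd * qInv n - 1 := by
  have h := (X_pow_dvd_eulerProd_sub_qPoch n).mul_right (qInv n)
  rwa [sub_mul, qPoch_mul_qInv] at h

theorem X_pow_dvd_qPoch_mul_qInv_sub {k n m : ℕ} (hn : k ≤ n) (hm : k ≤ m) :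
    X ^ (k + 1) ∣ qPoch n * qInv m - 1 := by
  have h1 := (pow_dvd_pow X (by omega : k + 1 ≤ n + 1)).trans (X_pow_dvd_eulerProd_sub_qPoch n)
  have h2 := (pow_dvd_pow X (by omega : k + 1 ≤ m + 1)).trans (X_pow_dvd_eulerProd_mul_qInv_sub m)
  convert dvd_sub h2 (h1.mul_right (qInv m)) using 1
  ring

theorem X_pow_dvd_baileyRatio_sub (r m : ℕ) : X ^ (m + 1) ∣ baileyRatio (r + m) r - 1 := by
  have h1 := X_pow_dvd_qPoch_mul_qInv_sub (k := m) (n := r + m) (m := m) (by omega) le_rfl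
  have h2 := X_pow_dvd_qPoch_mul_qInv_sub (k := m) (n := r + m) (m := 2 * r + m) (by omega)
    (by omega)
  rw [baileyRatio, baileyCoeff_add]
  convert dvd_add (h1.mul_right (qPoch (r + m) * qInv (2 * r + m))) h2 using 1
  ring

/-- The terms of the Lambert series that accounts for the crank part of `spt`. -/
noncomputable def pentLambertTerm (r : ℕ) : ℚ⟦X⟧ :=
  pentTerm r * (1 + X ^ r) * geomSq r

theorem X_pow_dvd_eulerProd_mul_sptSeries_sub_sum (N : ℕ) : X ^ (N + 1) ∣
    eulerProd * sptSeries
      - (∑ k ∈ range N, geomSq (k + 1) + ∑ r ∈ range N, pentLambertTerm (r + 1)) := by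
  have h := X_pow_dvd_eulerProd_mul_sptSeries_sub N
  rw [sum_geom_eq] at h
  have h' : X ^ (N + 1) ∣ ∑ r ∈ range N, pentTerm (r + 1) * (1 + X ^ (r + 1))
      * (geomSq (r + 1) * baileyRatio N (r + 1)) - ∑ r ∈ range N, pentLambertTerm (r + 1) := by
    rw [← sum_sub_distrib]
    refine dvd_sum fun r hr => ?_
    obtain ⟨m, rfl⟩ := Nat.exists_eq_add_of_lt (mem_range.mp hr)
    have := mul_dvd_mul (geomSq_eq r.add_one_ne_zero ▸ dvd_mul_right _ _ : X ^ (r + 1) ∣ geomSq (r + 1))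
      (X_pow_dvd_baileyRatio_sub (r + 1) m)
    rw [← pow_add, show r + 1 + m = r + m + 1 by ring,
      show r + 1 + (m + 1) = r + m + 1 + 1 by ring] at this
    convert this.mul_left (pentTerm (r + 1) * (1 + X ^ (r + 1))) using 1
    rw [pentLambertTerm]
    ring
  convert dvd_add h h' using 1
  ring

theorem hasSum_odd_mul_X_pow {n : ℕ} (hn : n ≠ 0) :
    HasSum (fun i : ℕ => (2 * (i : ℚ⟦X⟧) + 1) * X ^ (n * i)) (2 * geomSq n + geom n) := by
  rw [hasSum_iff_hasSum_coeff]
  intro d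
  have hc : ∀ i : ℕ, coeff d ((2 * (i : ℚ⟦X⟧) + 1) * X ^ (n * i))
      = if d = n * i then 2 * (i : ℚ) + 1 else 0 := by
    intro i
    rw [show (2 * (i : ℚ⟦X⟧) + 1) = C (2 * (i : ℚ) + 1) by
        rw [map_add, map_mul, map_ofNat, map_natCast, map_one],
      coeff_C_mul, coeff_X_pow]
    split_ifs <;> simp
  simp only [hc]
  have hv : coeff d (2 * geomSq n + geom n) = if n ∣ d then 2 * ((d / n : ℕ) : ℚ) + 1 else 0 := by
    rw [two_mul, map_add, map_add, geomSq, geom, coeff_mk, coeff_mk]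
    split_ifs <;> ring
  rw [hv]
  split_ifs with hd
  · obtain ⟨c, rfl⟩ := hd
    rw [Nat.mul_div_cancel_left _ (Nat.pos_of_ne_zero hn)]
    refine (hasSum_ite_eq c (2 * (c : ℚ) + 1)).congr_fun fun i => ?_
    by_cases h : i = c
    · simp [h]
    · rw [if_neg h, if_neg fun e => h (Nat.eq_of_mul_eq_mul_left (Nat.pos_of_ne_zero hn) e).symm]
  · convert hasSum_zero with i
    rw [if_neg]
    rintro rfl
    exact hd (dvd_mul_right _ _)

theorem pentExp_succ (i n : ℕ) : pentExp i (n + 1) = pent (n + 1) + (n + 1) + (n + 1) * i := by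
  have h0 := two_mul_pentExp 0 (n + 1)
  have hi := two_mul_pentExp i (n + 1)
  have := pent_add_self (n + 1)
  rw [mul_zero, mul_zero, add_zero] at h0
  generalize (n + 1) * (3 * (n + 1) + 1) = a at *
  omega

theorem hasSum_pentLambertTerm_inner (n : ℕ) :
    HasSum (fun i : ℕ => (-1) ^ (n + 1) * X ^ pentExp i (n + 1) * (2 * (i : ℚ⟦X⟧) + 1) ^ 1)
      (pentLambertTerm (n + 1)) := by
  have h := (hasSum_odd_mul_X_pow n.add_one_ne_zero).mul_left (pentTerm (n + 1) * X ^ (n + 1))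
  have hv : pentTerm (n + 1) * X ^ (n + 1) * (2 * geomSq (n + 1) + geom (n + 1))
      = pentLambertTerm (n + 1) := by
    rw [pentLambertTerm, geomSq_eq n.add_one_ne_zero]
    linear_combination (-pentTerm (n + 1) * X ^ (n + 1) * geom (n + 1))
      * one_sub_mul_geom n.add_one_ne_zero
  rw [hv] at h
  refine h.congr_fun fun i => ?_
  rw [pentExp_succ, pow_add, pow_add, pentTerm]
  ring

theorem summable_appell_double : Summable fun x : ℕ × ℕ =>
    (-1 : ℚ⟦X⟧) ^ (x.2 + 1) * X ^ pentExp x.1 (x.2 + 1) * (2 * (x.1 : ℚ⟦X⟧) + 1) ^ 1 :=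
  summable_of_X_pow_dvd (e := fun x => x.1 + x.2)
    (finite_add_le (e := id) (e' := id) Set.finite_Iic Set.finite_Iic) fun x =>
    ((pow_dvd_pow X (by have := le_pentExp_succ x.1 x.2; omega)).mul_left _).mul_right _

theorem hasSum_pentLambertTerm : HasSum (fun n => pentLambertTerm (n + 1)) (appellMoment 1) := by
  have hs := summable_appell_double.hasSum
  have hi : ∀ i : ℕ, HasSum (fun n : ℕ =>
      (-1 : ℚ⟦X⟧) ^ (n + 1) * X ^ pentExp i (n + 1) * (2 * (i : ℚ⟦X⟧) + 1) ^ 1)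
      (appellCoeff i * (2 * (i : ℚ⟦X⟧) + 1) ^ 1) := fun i => (hasSum_appellCoeff i).mul_right _
  have h1 := hs.prod_fiberwise hi
  have hs' : HasSum (fun x : ℕ × ℕ =>
      (-1 : ℚ⟦X⟧) ^ (x.1 + 1) * X ^ pentExp x.2 (x.1 + 1) * (2 * (x.2 : ℚ⟦X⟧) + 1) ^ 1) _ :=
    (Equiv.prodComm ℕ ℕ).hasSum_iff.mpr hs
  have h2 := hs'.prod_fiberwise hasSum_pentLambertTerm_inner
  rwa [h1.unique (hasSum_appellMoment 1)] at h2

theorem X_pow_dvd_appellMoment_one_sub (N : ℕ) :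
    X ^ (N + 1) ∣ appellMoment 1 - ∑ r ∈ range N, pentLambertTerm (r + 1) := by
  refine X_pow_dvd_of_hasSum ((hasSum_nat_add_iff' N).mpr hasSum_pentLambertTerm) fun i => ?_
  rw [pentLambertTerm, geomSq_eq (i + N).add_one_ne_zero]
  exact ((pow_dvd_pow X (by omega)).trans (dvd_mul_right _ _)).mul_left _

theorem eulerProd_mul_sptSeries : eulerProd * sptSeries = sigmaSeries ℚ + appellMoment 1 := by
  refine eq_of_forall_X_pow_dvd_sub fun N => ?_
  convert dvd_sub (dvd_sub (X_pow_dvd_eulerProd_mul_sptSeries_sub_sum N)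
    (X_pow_dvd_sigmaSeries_sub N)) (X_pow_dvd_appellMoment_one_sub N) using 1
  ring

end SptSeries

/-! ### The mock modular form in terms of `upsilonHat` -/

section MockForm

theorem coeff_cschZ_two : coeff 2 cschZ = -C (1 / 6 : ℚ) := by
  have h := congrArg (coeff 2) sinhcZ_mul_cschZ
  rw [coeff_mul, Finset.Nat.sum_antidiagonal_eq_sum_range_succ_mk, sum_range_succ, sum_range_succ,
    sum_range_one, coeff_cschZ_zero, coeff_cschZ_one, coeff_sinhcZ_of_even 0 (by decide),
    coeff_sinhcZ_of_even 2 (by decide), coeff_one, if_neg two_ne_zero] at h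
  norm_num [Nat.factorial] at h ⊢
  linear_combination h

theorem coeff_upsilon_two : coeff 2 upsilon = C (1 / 12 : ℚ) + 2 * appellMoment 1 := by
  rw [upsilon, map_add, coeff_C_mul, coeff_cschZ_two, coeff_succ_X_mul, coeff_appellZ,
    if_neg (by decide), ← map_neg, ← map_mul]
  norm_num

/-- The integer power series with coefficients `sptA (24 n - 1)`. -/
noncomputable def mockSeries : ℤ⟦X⟧ := PowerSeries.mk fun n => sptA (24 * n - 1)

theorem sptA_mul_sub_one (n : ℕ) :
    sptA (24 * n - 1) = -(12 * spt n + (24 * n - 1) * partitionCount n) := by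
  rw [sptA, if_pos ⟨by omega, by simp⟩, sub_add_cancel,
    Int.mul_ediv_cancel_left _ (by norm_num), Int.toNat_natCast]

theorem map_mockSeries : PowerSeries.map (Int.castRingHom ℚ) mockSeries
    = -(12 * sptSeries + (24 * qD ℚ partSeries - partSeries)) := by
  ext n
  rw [coeff_map, mockSeries, coeff_mk, sptA_mul_sub_one, eq_intCast, ← map_ofNat (C (R := ℚ)) 12,
    ← map_ofNat (C (R := ℚ)) 24, map_neg, map_add, map_sub, coeff_C_mul, coeff_C_mul, coeff_qD,
    sptSeries, partSeries, coeff_mk, coeff_mk]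
  push_cast
  ring

theorem eulerProd_mul_mockSeries :
    eulerProd * PowerSeries.map (Int.castRingHom ℚ) mockSeries = -(6 * upsilonHat) := by
  have h1 := eulerProd_mul_sptSeries
  have h2 := eulerProd_mul_partSeries
  have h3 := qD_eulerProd_eq_eisP_mul
  have h4 := congrArg (qD ℚ) h2
  rw [qD_mul, qD_one] at h4
  have c1 : 12 * C (1 / 12 : ℚ) = 1 := by
    rw [← map_ofNat (C (R := ℚ)) 12, ← map_mul]; norm_num
  have c2 : C (1 / 4 : ℚ) = 3 * C (1 / 12 : ℚ) := by
    rw [← map_ofNat (C (R := ℚ)) 3, ← map_mul]; norm_num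
  rw [map_mockSeries, upsilonHat, coeff_upsilon_two]
  have h5 : eisP ℚ = 1 - 24 * sigmaSeries ℚ := rfl
  linear_combination -12 * h1 - 24 * h4 + partSeries * h3 + eisP ℚ * h2 - 6 * eisP ℚ * c2
    + (1 - 18 * C (1 / 12 : ℚ)) * h5 - (1 - 36 * sigmaSeries ℚ) * c1

end MockForm

section Conclusion

variable {ℓ : ℕ} [Fact ℓ.Prime] {r : ℕ}

theorem map_pentagonalSeries {R S : Type*} [CommRing R] [CommRing S] (φ : R →+* S) :
    PowerSeries.map φ (pentagonalSeries R) = pentagonalSeries S := by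
  ext n
  rw [coeff_map]
  by_cases h : n ∈ Set.range pentagonal
  · obtain ⟨k, rfl⟩ := h
    rw [coeff_pentagonalSeries_pentagonal, coeff_pentagonalSeries_pentagonal, map_intCast]
  · rw [coeff_pentagonalSeries_eq_zero _ h, coeff_pentagonalSeries_eq_zero _ h, map_zero]

theorem red_eulerProd : Red ℓ eulerProd (pentagonalSeries (ZMod ℓ)) := by
  simpa only [map_pentagonalSeries] using red_map_int (ℓ := ℓ) (pentagonalSeries ℤ)

theorem red_ofNat (n : ℕ) [n.AtLeastTwo] : Red ℓ (OfNat.ofNat n) (OfNat.ofNat n) := by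
  have := red_natCast (ℓ := ℓ) (OfNat.ofNat n)
  rwa [Nat.cast_ofNat, Nat.cast_ofNat] at this

theorem red_partSeries : Red ℓ partSeries (PowerSeries.mk fun n => (partitionCount n : ZMod ℓ)) := by
  convert red_map_int (ℓ := ℓ) (PowerSeries.mk fun n => (partitionCount n : ℤ)) <;>
    ext n <;> simp [partSeries]

theorem exists_pentagonalSeries_mul_eq_one :
    ∃ p : (ZMod ℓ)⟦X⟧, pentagonalSeries (ZMod ℓ) * p = 1 :=
  ⟨_, (eulerProd_mul_partSeries ▸ red_eulerProd.mul red_partSeries).unique red_one⟩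

/-- The operator multiplying the coefficient of `q^n` by `24 n - 1`. -/
noncomputable def shiftD {R : Type*} [CommRing R] (y : R⟦X⟧) : R⟦X⟧ := 24 * qD R y - y

theorem coeff_shiftD_iterate {R : Type*} [CommRing R] (y : R⟦X⟧) (k n : ℕ) :
    coeff n (shiftD^[k] y) = (24 * n - 1) ^ k * coeff n y := by
  induction k with
  | zero => simp
  | succ k ih =>
    rw [Function.iterate_succ_apply', shiftD, ← map_ofNat (C (R := R)) 24, map_sub, coeff_C_mul,
      coeff_qD, ih]
    ring

theorem twistD_pentagonalSeries_mul (y : (ZMod ℓ)⟦X⟧) :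
    twistD (pentagonalSeries (ZMod ℓ) * y) = pentagonalSeries (ZMod ℓ) * shiftD y := by
  have h : 24 * qD (ZMod ℓ) (pentagonalSeries (ZMod ℓ)) + pentagonalSeries (ZMod ℓ)
      = eisP (ZMod ℓ) * pentagonalSeries (ZMod ℓ) :=
    (((red_ofNat 24).mul red_eulerProd.qD).add red_eulerProd).unique
      (qD_eulerProd_eq_eisP_mul ▸ red_eisP.mul red_eulerProd)
  rw [twistD, shiftD, qD_mul]
  linear_combination y * h

theorem twistD_iterate_pentagonalSeries_mul (y : (ZMod ℓ)⟦X⟧) (k : ℕ) :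
    twistD^[k] (pentagonalSeries (ZMod ℓ) * y) = pentagonalSeries (ZMod ℓ) * shiftD^[k] y := by
  induction k with
  | zero => rfl
  | succ k ih =>
    rw [Function.iterate_succ_apply', Function.iterate_succ_apply', ih,
      twistD_pentagonalSeries_mul]

theorem twistD_iterate_C_mul (c : ZMod ℓ) (y : (ZMod ℓ)⟦X⟧) (k : ℕ) :
    twistD^[k] (C c * y) = C c * twistD^[k] y := by
  induction k with
  | zero => rfl
  | succ k ih =>
    rw [Function.iterate_succ_apply', Function.iterate_succ_apply', ih, twistD_C_mul]

theorem exists_isModular_mockSeries (hr : ℓ = 2 * r + 1) (h5 : 5 ≤ ℓ) :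
    ∃ h : (ZMod ℓ)⟦X⟧, (∀ n : ℕ, coeff n h
        = (1 - (1 - 24 * n : ZMod ℓ) ^ r) * (sptA (24 * n - 1) : ZMod ℓ))
      ∧ IsModular (ZMod ℓ) (2 * r + 2) (pentagonalSeries (ZMod ℓ) * h) := by
  obtain ⟨υ, hυ, hg⟩ := exists_isModular_sub_twistD hr h5
  set v := PowerSeries.map (Int.castRingHom (ZMod ℓ)) mockSeries with hv
  have key : pentagonalSeries (ZMod ℓ) * v = C (-6) * υ := by
    have h := (red_eulerProd.mul (red_map_int mockSeries)).unique
      (eulerProd_mul_mockSeries ▸ ((red_ofNat (ℓ := ℓ) 6).mul hυ).neg)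
    rw [map_neg, map_ofNat, neg_mul, ← h]
  refine ⟨v - (-1) ^ r * shiftD^[r] v, fun n => ?_, ?_⟩
  · have hC : ((-1) ^ r : (ZMod ℓ)⟦X⟧) = C ((-1) ^ r) := by simp
    rw [map_sub, hC, coeff_C_mul, coeff_shiftD_iterate, hv, coeff_map, mockSeries, coeff_mk,
      eq_intCast, ← mul_assoc, ← mul_pow]
    ring
  · have h := hg.C_mul (-6)
    rw [mul_sub, ← key, mul_left_comm, ← twistD_iterate_C_mul, ← key,
      twistD_iterate_pentagonalSeries_mul, mul_left_comm, ← mul_sub] at h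
    exact h

theorem prime_dvd_sptA (hr : ℓ = 2 * r + 1) (h5 : 5 ≤ ℓ)
    (hU : ∀ n : ℤ, 1 ≤ n → (ℓ : ℤ) ∣ sptA (ℓ * n)) (m : ℕ)
    (hm : legendreSym ℓ (-(24 * m - 1)) ≠ 1) : (ℓ : ℤ) ∣ sptA (24 * m - 1) := by
  have hdvd : ∀ n : ℕ, (ℓ : ℤ) ∣ 24 * n - 1 → (ℓ : ℤ) ∣ sptA (24 * n - 1) := by
    rintro n ⟨k, hk⟩
    rw [hk]
    refine hU k ?_
    by_contra hlt
    have : (ℓ : ℤ) * k ≤ 0 := mul_nonpos_of_nonneg_of_nonpos (by positivity) (by omega)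
    obtain rfl : n = 0 := by omega
    have : (ℓ : ℤ) ∣ 1 := ⟨-k, by push_cast at hk; linarith⟩
    have := Int.le_of_dvd one_pos this
    omega
  have hsym : ∀ n : ℕ, (1 - 24 * n : ZMod ℓ) ^ r = legendreSym ℓ (-(24 * n - 1)) := by
    intro n
    rw [legendreSym.eq_pow, show ℓ / 2 = r by omega]
    push_cast
    ring
  obtain ⟨h, hcoeff, hmod⟩ := exists_isModular_mockSeries hr h5
  have heig : shiftD^[r] h = C (-(-1) ^ r) * h := by
    ext n
    rw [coeff_shiftD_iterate, coeff_C_mul, hcoeff]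
    by_cases hn : (ℓ : ℤ) ∣ 24 * n - 1
    · rw [(ZMod.intCast_zmod_eq_zero_iff_dvd _ _).mpr (hdvd n hn)]
      ring
    · have hs : ((1 - 24 * n : ZMod ℓ) ^ r) ^ 2 = 1 := by
        rw [hsym, ← Int.cast_pow, legendreSym.sq_one, Int.cast_one]
        rw [Int.cast_neg, neg_ne_zero, Ne, ZMod.intCast_zmod_eq_zero_iff_dvd]
        exact hn
      have hs' : (24 * n - 1 : ZMod ℓ) ^ r = (-1) ^ r * (1 - 24 * n : ZMod ℓ) ^ r := by
        rw [← mul_pow]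
        ring
      rw [hs']
      linear_combination (-(-1) ^ r * (sptA (24 * n - 1) : ZMod ℓ)) * hs
  have hzero : pentagonalSeries (ZMod ℓ) * h = 0 := by
    refine hmod.eq_zero_of_twistD hr h5 (c := -(-1) ^ r) ?_
    rw [twistD_iterate_pentagonalSeries_mul, heig]
    ring
  obtain ⟨p, hp⟩ := exists_pentagonalSeries_mul_eq_one (ℓ := ℓ)
  have h0 : h = 0 := by linear_combination p * hzero - h * hp
  have hc := hcoeff m
  rw [h0, map_zero, hsym] at hc
  by_cases hn : (ℓ : ℤ) ∣ 24 * m - 1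
  · exact hdvd m hn
  rw [← ZMod.intCast_zmod_eq_zero_iff_dvd]
  have hne : ((-(24 * m - 1) : ℤ) : ZMod ℓ) ≠ 0 := by
    rwa [Int.cast_neg, neg_ne_zero, Ne, ZMod.intCast_zmod_eq_zero_iff_dvd]
  rw [(legendreSym.eq_one_or_neg_one ℓ hne).resolve_left hm] at hc
  refine (mul_eq_zero.mp hc.symm).resolve_left ?_
  have := two_ne_zero_zmod (ℓ := ℓ) h5
  rwa [Int.cast_neg, Int.cast_one, sub_neg_eq_add, one_add_one_eq_two]

end Conclusion

end SptCongruence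

/-- If `f | U_ℓ ≡ 0 (mod ℓ)` (i.e. `ℓ ∣ a(ℓn)` for all `n ≥ 1`), then
`f_ℓ ≡ 0 (mod ℓ)`; coefficientwise, `ℓ ∣ a(n)` whenever the Legendre symbol
`(-n / ℓ)` is not `1`. -/
theorem fell_zero_of_U_zero (ℓ : ℕ) (hℓ : ℓ.Prime) (h5 : 5 ≤ ℓ)
    (hU : ∀ n : ℤ, 1 ≤ n → (ℓ : ℤ) ∣ sptA (ℓ * n)) :
    ∀ n : ℤ, -1 ≤ n → jacobiSym (-n) ℓ ≠ 1 → (ℓ : ℤ) ∣ sptA n := by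
  intro n hn hsym
  by_cases hd : (24 : ℤ) ∣ n + 1
  · obtain ⟨k, hk⟩ := hd
    obtain ⟨m, rfl⟩ := Int.eq_ofNat_of_zero_le (show 0 ≤ k by omega)
    obtain rfl : n = 24 * m - 1 := by omega
    have := Fact.mk hℓ
    obtain ⟨r, hr⟩ := hℓ.odd_of_ne_two (by omega)
    rw [← jacobiSym.legendreSym.to_jacobiSym] at hsym
    exact SptCongruence.prime_dvd_sptA hr h5 hU m hsym
  · rw [sptA, if_neg fun h => hd h.2]
    exact dvd_zero _
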